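/- Let ℓ ∈ ℕ, ℓ ≥ 1, be fixed, let f ∈ C([0,1]) and let 0 < λ ≤ 2ℓ. Then the following are equivalent: (i) there exists a constant C₁ such that ‖f − B_{m,ℓ}(f)‖ ≤ C₁ · m^{−λ/2} for all m ≥ 1; (ii) there exists a constant C₂ such that ω_φ^{2ℓ}(f,t) ≤ C₂ · t^λ for all t ∈ (0,1]. -/

import Mathlib

open Set MeasureTheory

/-- Bernstein basis polynomial `p_{m,k}(x) = C(m,k) x^k (1-x)^(m-k)`. -/
noncomputable def bern (m k : ℕ) (x : ℝ) : ℝ :=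
  (m.choose k : ℝ) * x ^ k * (1 - x) ^ (m - k)

/-- The Bernstein operator `B_m`. -/
noncomputable def Bop (m : ℕ) (f : ℝ → ℝ) : ℝ → ℝ :=
  fun x => ∑ k ∈ Finset.range (m + 1), bern m k x * f ((k : ℝ) / (m : ℝ))

/-- The generalized Bernstein operator `B_{m,ℓ} = I - (I - B_m)^ℓ`. -/
noncomputable def GBop (m l : ℕ) (f : ℝ → ℝ) : ℝ → ℝ :=
  fun x => f x - ((fun g => g - Bop m g)^[l] f) x

/-- Fundamental generalized Bernstein polynomials
`p^{(ℓ)}_{m,j} = ∑_{i=1}^ℓ C(ℓ,i) (-1)^{i-1} B_m^{i-1}(p_{m,j})`. -/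
noncomputable def gbBasis (m l j : ℕ) : ℝ → ℝ :=
  fun x => ∑ i ∈ Finset.Icc 1 l,
    (l.choose i : ℝ) * (-1 : ℝ) ^ (i - 1) * ((Bop m)^[i - 1] (bern m j) x)

/-- Sup norm on `[0,1]`. -/
noncomputable def supNorm (f : ℝ → ℝ) : ℝ := ⨆ x : Set.Icc (0 : ℝ) 1, |f (x : ℝ)|

/-- `φ(x) = √(x(1-x))`. -/
noncomputable def phiDT (x : ℝ) : ℝ := Real.sqrt (x * (1 - x))

/-- Symmetric difference `Δ^r_{hφ} f(x)`. -/
noncomputable def dtDiff (r : ℕ) (h : ℝ) (f : ℝ → ℝ) (x : ℝ) : ℝ :=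
  ∑ k ∈ Finset.range (r + 1),
    (-1 : ℝ) ^ k * (r.choose k : ℝ) * f (x + ((r : ℝ) - 2 * k) * (h / 2) * phiDT x)

/-- `x ∈ [0,1]` and all the nodes of `Δ^r_{hφ} f(x)` lie in `[0,1]`. -/
def dtAdmissible (r : ℕ) (h : ℝ) (x : ℝ) : Prop :=
  x ∈ Set.Icc (0 : ℝ) 1 ∧
    ∀ k ≤ r, x + ((r : ℝ) - 2 * k) * (h / 2) * phiDT x ∈ Set.Icc (0 : ℝ) 1

/-- Ditzian–Totik modulus of smoothness `ω^r_φ(f,t)`. -/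
noncomputable def omegaDT (r : ℕ) (f : ℝ → ℝ) (t : ℝ) : ℝ :=
  sSup {y | ∃ h x, 0 < h ∧ h ≤ t ∧ dtAdmissible r h x ∧ y = |dtDiff r h f x|}

/-- The set of quotients `ω^r_φ(f,t)/t^λ`, `t > 0`. -/
def zygSet (lam : ℝ) (r : ℕ) (f : ℝ → ℝ) : Set ℝ :=
  {y | ∃ t : ℝ, 0 < t ∧ y = omegaDT r f t / t ^ lam}

/-- Membership in the Hölder–Zygmund space `Z_λ` (modulus of order `r`). -/
def memZ (lam : ℝ) (r : ℕ) (f : ℝ → ℝ) : Prop :=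
  ContinuousOn f (Set.Icc 0 1) ∧ BddAbove (zygSet lam r f)

/-- The Zygmund norm `‖f‖_{Z_λ} = ‖f‖ + sup_{t>0} ω^r_φ(f,t)/t^λ`. -/
noncomputable def Znorm (lam : ℝ) (r : ℕ) (f : ℝ → ℝ) : ℝ :=
  supNorm f + sSup (zygSet lam r f)

/-- Volterra integral operator `(Vf)(s) = ∫_0^s k(t,s) f(t) (s-t)^α t^β dt`. -/
noncomputable def Vop (alp bet : ℝ) (k : ℝ → ℝ → ℝ) (f : ℝ → ℝ) (s : ℝ) : ℝ :=
  ∫ t in (0 : ℝ)..s, k t s * f t * (s - t) ^ alp * t ^ bet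

/-- Quadrature coefficients `Q^{(ℓ)}_j(s) = ∫_0^s p^{(ℓ)}_{m,j}(t)(s-t)^α t^β dt`. -/
noncomputable def Qcoef (alp bet : ℝ) (m l j : ℕ) (s : ℝ) : ℝ :=
  ∫ t in (0 : ℝ)..s, gbBasis m l j t * (s - t) ^ alp * t ^ bet

/-- Discrete Volterra operator `(V_m^{(ℓ)}f)(s) = ∑_j Q^{(ℓ)}_j(s) k(j/m,s) f(j/m)`. -/
noncomputable def Vmop (alp bet : ℝ) (k : ℝ → ℝ → ℝ) (m l : ℕ) (f : ℝ → ℝ) (s : ℝ) : ℝ :=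
  ∑ j ∈ Finset.range (m + 1),
    Qcoef alp bet m l j s * k ((j : ℝ) / (m : ℝ)) s * f ((j : ℝ) / (m : ℝ))

theorem bern_nonneg (m k : ℕ) {x : ℝ} (hx : x ∈ Icc (0 : ℝ) 1) : 0 ≤ bern m k x := by
  have h1 := hx.1
  have h2 : 0 ≤ 1 - x := by linarith [hx.2]
  unfold bern
  positivity

theorem sum_bern_mul_pow (m : ℕ) (x a b : ℝ) :
    ∑ k ∈ Finset.range (m + 1), bern m k x * (a ^ k * b ^ (m - k))
      = (x * a + (1 - x) * b) ^ m := by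
  rw [add_pow]
  refine Finset.sum_congr rfl fun k _ => ?_
  unfold bern
  rw [mul_pow, mul_pow]
  ring

theorem sum_bern (m : ℕ) (x : ℝ) : ∑ k ∈ Finset.range (m + 1), bern m k x = 1 := by
  simpa using sum_bern_mul_pow m x 1 1

theorem node_mem {m k : ℕ} (hk : k ∈ Finset.range (m + 1)) :
    (k : ℝ) / (m : ℝ) ∈ Icc (0 : ℝ) 1 := by
  have hk' : (k : ℝ) ≤ m := by exact_mod_cast Nat.lt_succ_iff.mp (Finset.mem_range.mp hk)
  exact ⟨by positivity, div_le_one_of_le₀ hk' (by positivity)⟩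

theorem abs_Bop_le {m : ℕ} {u v : ℝ → ℝ} (h : ∀ y ∈ Icc (0 : ℝ) 1, |u y| ≤ v y) {x : ℝ}
    (hx : x ∈ Icc (0 : ℝ) 1) : |Bop m u x| ≤ Bop m v x := by
  unfold Bop
  refine (Finset.abs_sum_le_sum_abs _ _).trans (Finset.sum_le_sum fun k hk => ?_)
  rw [abs_mul, abs_of_nonneg (bern_nonneg m k hx)]
  exact mul_le_mul_of_nonneg_left (h _ (node_mem hk)) (bern_nonneg m k hx)

theorem Bop_mono {m : ℕ} {u v : ℝ → ℝ} (h : ∀ y ∈ Icc (0 : ℝ) 1, u y ≤ v y) {x : ℝ}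
    (hx : x ∈ Icc (0 : ℝ) 1) : Bop m u x ≤ Bop m v x :=
  Finset.sum_le_sum fun k hk => mul_le_mul_of_nonneg_left (h _ (node_mem hk)) (bern_nonneg m k hx)

theorem Bop_const (m : ℕ) (a x : ℝ) : Bop m (fun _ => a) x = a := by
  unfold Bop
  rw [← Finset.sum_mul, sum_bern, one_mul]

theorem Bop_const_mul (m : ℕ) (a : ℝ) (u : ℝ → ℝ) (x : ℝ) :
    Bop m (fun y => a * u y) x = a * Bop m u x := by
  unfold Bop
  rw [Finset.mul_sum]
  exact Finset.sum_congr rfl fun k _ => by ring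

theorem Bop_reflect {m : ℕ} (hm : 1 ≤ m) (u : ℝ → ℝ) (x : ℝ) :
    Bop m (fun y => u (1 - y)) x = Bop m u (1 - x) := by
  unfold Bop
  rw [← Finset.sum_range_reflect]
  refine Finset.sum_congr rfl fun k hk => ?_
  have hk' : k ≤ m := Nat.lt_succ_iff.mp (Finset.mem_range.mp hk)
  have hm' : (m : ℝ) ≠ 0 := by positivity
  have e : m + 1 - 1 - k = m - k := by omega
  rw [e]
  unfold bern
  rw [Nat.choose_symm hk', Nat.cast_sub hk', Nat.sub_sub_self hk']
  have e2 : 1 - ((m : ℝ) - k) / m = k / m := by field_simp; ring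
  beta_reduce
  rw [e2, sub_sub_cancel]
  ring

/-- The Bernstein operator as a linear endomorphism of the space of all real functions. -/
noncomputable def BopL (m : ℕ) : Module.End ℝ (ℝ → ℝ) where
  toFun := Bop m
  map_add' u v := by
    funext x
    simp only [Bop, Pi.add_apply, mul_add, Finset.sum_add_distrib]
  map_smul' a u := by
    funext x
    exact Bop_const_mul m a u x

/-- The operator `I - B_m`. -/
noncomputable def TopL (m : ℕ) : Module.End ℝ (ℝ → ℝ) := 1 - BopL m

theorem TopL_apply (m : ℕ) (u : ℝ → ℝ) : TopL m u = u - Bop m u := rfl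

theorem sub_GBop_eq (m l : ℕ) (f : ℝ → ℝ) (x : ℝ) :
    f x - GBop m l f x = ((TopL m) ^ l) f x := by
  rw [Module.End.pow_apply]
  have : (⇑(TopL m) : (ℝ → ℝ) → (ℝ → ℝ)) = fun g => g - Bop m g := by
    funext g; rfl
  rw [this]
  simp [GBop]

theorem TopL_pow_reflect {m : ℕ} (hm : 1 ≤ m) (l : ℕ) (u : ℝ → ℝ) (x : ℝ) :
    ((TopL m) ^ l) (fun y => u (1 - y)) x = ((TopL m) ^ l) u (1 - x) := by
  induction l generalizing u x with
  | zero => rfl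
  | succ l ih =>
    rw [pow_succ, Module.End.mul_apply, Module.End.mul_apply, ← ih]
    have e : TopL m (fun y => u (1 - y)) = fun y => TopL m u (1 - y) := by
      funext y
      simp only [TopL_apply, Pi.sub_apply, Bop_reflect hm]
    rw [e]

/-! ### Exponential moments -/

theorem exp_le_one_add_add_sq {u : ℝ} (hu : |u| ≤ 1) : Real.exp u ≤ 1 + u + u ^ 2 := by
  have := (abs_le.mp (Real.abs_exp_sub_one_sub_id_le hu)).2
  linarith

theorem Bop_exp_le {n : ℕ} (hn : 1 ≤ n) {y s : ℝ} (hy : y ∈ Icc (0 : ℝ) 1) (hs : |s| ≤ 1) :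
    Bop n (fun z => Real.exp (s * (n * (z - y)))) y ≤ Real.exp (s ^ 2 * (n * (y * (1 - y)))) := by
  have hn' : (n : ℝ) ≠ 0 := by positivity
  have h1 : 0 ≤ 1 - y := by linarith [hy.2]
  have e : Bop n (fun z => Real.exp (s * (n * (z - y)))) y
      = (y * Real.exp (s * (1 - y)) + (1 - y) * Real.exp (-(s * y))) ^ n := by
    rw [← sum_bern_mul_pow]
    refine Finset.sum_congr rfl fun k hk => ?_
    have hk' : k ≤ n := Nat.lt_succ_iff.mp (Finset.mem_range.mp hk)
    beta_reduce
    congr 1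
    rw [← Real.exp_nat_mul, ← Real.exp_nat_mul, ← Real.exp_add]
    congr 1
    push_cast [Nat.cast_sub hk']
    field_simp
    ring
  rw [e]
  have b1 : Real.exp (s * (1 - y)) ≤ 1 + s * (1 - y) + (s * (1 - y)) ^ 2 := by
    apply exp_le_one_add_add_sq
    rw [abs_mul, abs_of_nonneg h1]
    nlinarith [abs_nonneg s, hy.1]
  have b2 : Real.exp (-(s * y)) ≤ 1 + -(s * y) + (-(s * y)) ^ 2 := by
    apply exp_le_one_add_add_sq
    rw [abs_neg, abs_mul, abs_of_nonneg hy.1]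
    nlinarith [abs_nonneg s, hy.2, hy.1]
  have b3 : y * Real.exp (s * (1 - y)) + (1 - y) * Real.exp (-(s * y))
      ≤ Real.exp (s ^ 2 * (y * (1 - y))) := by
    calc _ ≤ y * (1 + s * (1 - y) + (s * (1 - y)) ^ 2) + (1 - y) * (1 + -(s * y) + (-(s * y)) ^ 2) :=
          add_le_add (mul_le_mul_of_nonneg_left b1 hy.1) (mul_le_mul_of_nonneg_left b2 h1)
      _ = s ^ 2 * (y * (1 - y)) + 1 := by ring
      _ ≤ _ := Real.add_one_le_exp _
  have b0 : 0 ≤ y * Real.exp (s * (1 - y)) + (1 - y) * Real.exp (-(s * y)) := by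
    have := hy.1; positivity
  calc _ ≤ (Real.exp (s ^ 2 * (y * (1 - y)))) ^ n := pow_le_pow_left₀ b0 b3 n
    _ = _ := by rw [← Real.exp_nat_mul]; congr 1; ring

theorem Bop_add (m : ℕ) (u v : ℝ → ℝ) (x : ℝ) :
    Bop m (fun y => u y + v y) x = Bop m u x + Bop m v x :=
  congrFun ((BopL m).map_add u v) x

theorem pow_le_exp_half (a : ℕ) {v : ℝ} (hv : 0 ≤ v) :
    v ^ a ≤ 2 ^ a * a.factorial * Real.exp (v / 2) := by
  have := Real.pow_div_factorial_le_exp (v / 2) (by positivity) a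
  rw [div_le_iff₀ (by positivity)] at this
  calc v ^ a = 2 ^ a * (v / 2) ^ a := by rw [← mul_pow]; congr 1; ring
    _ ≤ 2 ^ a * (Real.exp (v / 2) * a.factorial) := by gcongr
    _ = _ := by ring

theorem Bop_exp_abs_le {n : ℕ} (hn : 1 ≤ n) {y s : ℝ} (hy : y ∈ Icc (0 : ℝ) 1) (hs : |s| ≤ 1) :
    Bop n (fun z => Real.exp (|s * (n * (z - y))|)) y
      ≤ 2 * Real.exp (s ^ 2 * (n * (y * (1 - y)))) := by
  have h1 := Bop_exp_le hn hy hs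
  have h2 := Bop_exp_le hn hy (s := -s) (by rwa [abs_neg])
  rw [neg_sq] at h2
  have : Bop n (fun z => Real.exp (|s * (n * (z - y))|)) y ≤
      Bop n (fun z => Real.exp (s * (n * (z - y))) + Real.exp (-s * (n * (z - y)))) y := by
    refine Bop_mono (fun z _ => ?_) hy
    have := Real.exp_pos (s * (n * (z - y)))
    have h' := Real.exp_pos (-s * (n * (z - y)))
    rcases abs_cases (s * (n * (z - y))) with h | h
    · rw [h.1]; linarith
    · rw [h.1, ← neg_mul]; linarith
  rw [Bop_add] at this
  linarith

/-- The weights `(ρ + |· - c|) ^ a` are almost invariant under `B_n`. -/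
theorem Bop_weight_le (a : ℕ) : ∃ C : ℝ, 1 ≤ C ∧ ∀ (n : ℕ) (c ρ y : ℝ), 1 ≤ n →
    c ∈ Icc (0 : ℝ) 1 → 0 < ρ → c * (1 - c) ≤ n * ρ ^ 2 → 1 ≤ n * ρ → y ∈ Icc (0 : ℝ) 1 →
    Bop n (fun z => (ρ + |z - c|) ^ a) y ≤ C * (ρ + |y - c|) ^ a := by
  refine ⟨2 ^ a * a.factorial * (2 * Real.exp 1) + 1, by
    have : 0 ≤ 2 ^ a * (a.factorial : ℝ) * (2 * Real.exp 1) := by positivity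
    linarith, ?_⟩
  intro n c ρ y hn hc hρ h1 h2 hy
  have hn0 : (0 : ℝ) < n := by positivity
  set τ := ρ + |y - c| with hτ
  have hτρ : ρ ≤ τ := by simp [hτ]
  have hτ0 : 0 < τ := hρ.trans_le hτρ
  have hnτ : 1 ≤ n * τ := h2.trans (by gcongr)
  set s : ℝ := 1 / (2 * (n * τ)) with hs
  have hs0 : 0 < s := by positivity
  have hs1 : |s| ≤ 1 := by
    rw [abs_of_pos hs0, hs]
    apply div_le_one_of_le₀ <;> nlinarith
  have hφ : y * (1 - y) ≤ n * τ ^ 2 := by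
    have : y * (1 - y) ≤ c * (1 - c) + |y - c| := by
      have e : y * (1 - y) - c * (1 - c) = (y - c) * (1 - y - c) := by ring
      have : (y - c) * (1 - y - c) ≤ |y - c| := by
        refine (le_abs_self _).trans ?_
        rw [abs_mul]
        have : |1 - y - c| ≤ 1 := by rw [abs_le]; constructor <;> linarith [hy.1, hy.2, hc.1, hc.2]
        nlinarith [abs_nonneg (y - c)]
      linarith
    have h3 : |y - c| ≤ n * ρ * |y - c| := by nlinarith [abs_nonneg (y - c)]
    have h4 : (n : ℝ) * τ ^ 2 = n * ρ ^ 2 + 2 * (n * ρ * |y - c|) + n * |y - c| ^ 2 := by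
      rw [hτ]; ring
    have : 0 ≤ n * ρ * |y - c| := by positivity
    have : 0 ≤ n * |y - c| ^ 2 := by positivity
    nlinarith
  have key : ∀ z ∈ Icc (0 : ℝ) 1, (ρ + |z - c|) ^ a ≤
      (τ ^ a * (2 ^ a * a.factorial * Real.exp (1 / 2))) * Real.exp (|s * (n * (z - y))|) := by
    intro z _
    have e1 : |s * (n * (z - y))| = |z - y| / (2 * τ) := by
      rw [abs_mul, abs_mul, abs_of_pos hs0, abs_of_pos hn0, hs]
      field_simp
    have e2 : ρ + |z - c| ≤ τ * (1 + |z - y| / τ) := by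
      have : τ * (1 + |z - y| / τ) = τ + |z - y| := by field_simp
      rw [this, hτ]
      have := abs_sub_le z y c
      linarith
    calc (ρ + |z - c|) ^ a ≤ (τ * (1 + |z - y| / τ)) ^ a := by gcongr
      _ = τ ^ a * (1 + |z - y| / τ) ^ a := mul_pow _ _ _
      _ ≤ τ ^ a * (2 ^ a * a.factorial * Real.exp ((1 + |z - y| / τ) / 2)) := by
        gcongr
        exact pow_le_exp_half a (by positivity)
      _ = _ := by
        rw [e1, add_div, Real.exp_add, div_div, mul_comm τ 2]; ring
  refine (Bop_mono key hy).trans ?_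
  rw [Bop_const_mul]
  have h5 := Bop_exp_abs_le hn hy hs1
  have h6 : s ^ 2 * (n * (y * (1 - y))) ≤ 1 / 2 := by
    calc s ^ 2 * (n * (y * (1 - y))) ≤ s ^ 2 * (n * (n * τ ^ 2)) := by gcongr
      _ = 1 / 4 := by rw [hs]; field_simp; norm_num
      _ ≤ _ := by norm_num
  have h7 : Real.exp (s ^ 2 * (n * (y * (1 - y)))) ≤ Real.exp (1 / 2) := Real.exp_le_exp.mpr h6
  have h8 : Real.exp (1 / 2) * Real.exp (1 / 2) = Real.exp 1 := by
    rw [← Real.exp_add]; norm_num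
  calc _ ≤ (τ ^ a * (2 ^ a * a.factorial * Real.exp (1 / 2))) * (2 * Real.exp (1 / 2)) := by
        gcongr; linarith
    _ = 2 ^ a * a.factorial * (2 * (Real.exp (1 / 2) * Real.exp (1 / 2))) * τ ^ a := by ring
    _ ≤ _ := by
        rw [h8]
        have : 0 ≤ τ ^ a := by positivity
        nlinarith

/-- Admissible parameters of a weight `(ρ + |· - c|) ^ a` for `B_n`. -/
structure WeightOK (n : ℕ) (c ρ : ℝ) : Prop where
  one_le : 1 ≤ n
  mem : c ∈ Icc (0 : ℝ) 1
  pos : 0 < ρ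
  var_le : c * (1 - c) ≤ n * ρ ^ 2
  one_le_mul : 1 ≤ n * ρ

theorem weightOK_one {n : ℕ} (hn : 1 ≤ n) : WeightOK n 0 1 where
  one_le := hn
  mem := by simp
  pos := one_pos
  var_le := by simp
  one_le_mul := by simpa using hn

theorem cone_Bop (a : ℕ) : ∃ C : ℝ, 1 ≤ C ∧ ∀ (n : ℕ) (c ρ κ : ℝ) (u : ℝ → ℝ), WeightOK n c ρ →
    (∀ y ∈ Icc (0 : ℝ) 1, |u y| ≤ κ * (ρ + |y - c|) ^ a) →
    ∀ y ∈ Icc (0 : ℝ) 1, Bop n (fun z => |u z|) y ≤ C * κ * (ρ + |y - c|) ^ a := by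
  obtain ⟨C, hC, H⟩ := Bop_weight_le a
  refine ⟨C, hC, fun n c ρ κ u h hu y hy => ?_⟩
  have hρ := h.pos
  have hκ : 0 ≤ κ := by
    have h0 := (abs_nonneg _).trans (hu y hy)
    exact nonneg_of_mul_nonneg_left h0 (by positivity)
  refine (Bop_mono hu hy).trans ?_
  rw [Bop_const_mul]
  have := H n c ρ y h.one_le h.mem h.pos h.var_le h.one_le_mul hy
  calc _ ≤ κ * (C * (ρ + |y - c|) ^ a) := by gcongr
    _ = _ := by ring

theorem cone_TopL (a : ℕ) : ∃ C : ℝ, 1 ≤ C ∧ ∀ (n : ℕ) (c ρ κ : ℝ) (u : ℝ → ℝ), WeightOK n c ρ →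
    (∀ y ∈ Icc (0 : ℝ) 1, |u y| ≤ κ * (ρ + |y - c|) ^ a) →
    ∀ y ∈ Icc (0 : ℝ) 1, |TopL n u y| ≤ C * κ * (ρ + |y - c|) ^ a := by
  obtain ⟨C, hC, H⟩ := cone_Bop a
  refine ⟨C + 1, by linarith, fun n c ρ κ u h hu y hy => ?_⟩
  have h1 := H n c ρ κ u h hu y hy
  have h2 : |Bop n u y| ≤ Bop n (fun z => |u z|) y := abs_Bop_le (fun _ _ => le_rfl) hy
  rw [TopL_apply, Pi.sub_apply]
  have h3 := abs_sub (u y) (Bop n u y)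
  have h4 := hu y hy
  calc _ ≤ κ * (ρ + |y - c|) ^ a + C * κ * (ρ + |y - c|) ^ a := by linarith
    _ = _ := by ring

theorem cone_TopL_pow (a l : ℕ) : ∃ C : ℝ, 1 ≤ C ∧ ∀ (n : ℕ) (c ρ κ : ℝ) (u : ℝ → ℝ),
    WeightOK n c ρ → (∀ y ∈ Icc (0 : ℝ) 1, |u y| ≤ κ * (ρ + |y - c|) ^ a) →
    ∀ y ∈ Icc (0 : ℝ) 1, |((TopL n) ^ l) u y| ≤ C * κ * (ρ + |y - c|) ^ a := by
  induction l with
  | zero => exact ⟨1, le_rfl, fun n c ρ κ u _ hu y hy => by simpa using hu y hy⟩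
  | succ l ih =>
    obtain ⟨C, hC, H⟩ := ih
    obtain ⟨D, hD, K⟩ := cone_TopL a
    refine ⟨D * C, one_le_mul_of_one_le_of_one_le hD hC, fun n c ρ κ u h hu y hy => ?_⟩
    rw [pow_succ', Module.End.mul_apply]
    have := K n c ρ (C * κ) _ h (H n c ρ κ u h hu) y hy
    rwa [← mul_assoc] at this

/-- The operator `∑_{i<l} (I - B_n)^i`, so that `B_n Q = I - (I - B_n)^l`. -/
noncomputable def Qop (n l : ℕ) : Module.End ℝ (ℝ → ℝ) := ∑ i ∈ Finset.range l, (TopL n) ^ i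

theorem Bop_Qop (n l : ℕ) (u : ℝ → ℝ) : Bop n (Qop n l u) = u - ((TopL n) ^ l) u := by
  have h : BopL n = 1 - TopL n := by simp [TopL]
  have := mul_neg_geom_sum (TopL n) l
  rw [← h] at this
  exact congrArg (fun A : Module.End ℝ (ℝ → ℝ) => A u) this

theorem cone_Qop (a l : ℕ) : ∃ C : ℝ, 1 ≤ C ∧ ∀ (n : ℕ) (c ρ κ : ℝ) (u : ℝ → ℝ),
    WeightOK n c ρ → (∀ y ∈ Icc (0 : ℝ) 1, |u y| ≤ κ * (ρ + |y - c|) ^ a) →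
    ∀ y ∈ Icc (0 : ℝ) 1, |Qop n l u y| ≤ C * κ * (ρ + |y - c|) ^ a := by
  induction l with
  | zero =>
    refine ⟨1, le_rfl, fun n c ρ κ u _ hu y hy => ?_⟩
    simpa [Qop] using (abs_nonneg _).trans (hu y hy)
  | succ l ih =>
    obtain ⟨C, hC, H⟩ := ih
    obtain ⟨D, hD, K⟩ := cone_TopL_pow a l
    refine ⟨C + D, by linarith, fun n c ρ κ u h hu y hy => ?_⟩
    have e : Qop n (l + 1) u y = Qop n l u y + ((TopL n) ^ l) u y := by
      simp [Qop, Finset.sum_range_succ]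
    rw [e]
    have h1 := K n c ρ κ u h hu y hy
    have h2 := H n c ρ κ u h hu y hy
    have h3 := abs_add_le (Qop n l u y) (((TopL n) ^ l) u y)
    linarith

/-- Sup-norm form of `cone_TopL_pow`. -/
theorem TopL_pow_bound (l : ℕ) : ∃ C : ℝ, 1 ≤ C ∧ ∀ (n : ℕ) (κ : ℝ) (u : ℝ → ℝ), 1 ≤ n →
    (∀ y ∈ Icc (0 : ℝ) 1, |u y| ≤ κ) → ∀ y ∈ Icc (0 : ℝ) 1, |((TopL n) ^ l) u y| ≤ C * κ := by
  obtain ⟨C, hC, H⟩ := cone_TopL_pow 0 l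
  refine ⟨C, hC, fun n κ u hn hu y hy => ?_⟩
  simpa using H n 0 1 κ u (weightOK_one hn) (by simpa using hu) y hy

theorem Qop_bound (l : ℕ) : ∃ C : ℝ, 1 ≤ C ∧ ∀ (n : ℕ) (κ : ℝ) (u : ℝ → ℝ), 1 ≤ n →
    (∀ y ∈ Icc (0 : ℝ) 1, |u y| ≤ κ) → ∀ y ∈ Icc (0 : ℝ) 1, |Qop n l u y| ≤ C * κ := by
  obtain ⟨C, hC, H⟩ := cone_Qop 0 l
  refine ⟨C, hC, fun n κ u hn hu y hy => ?_⟩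
  simpa using H n 0 1 κ u (weightOK_one hn) (by simpa using hu) y hy

/-! ### The operators on polynomials -/

section Poly
open Polynomial

/-- The Bernstein polynomial of `u`, as a polynomial. -/
noncomputable def BPoly (m : ℕ) (u : ℝ → ℝ) : ℝ[X] :=
  ∑ k ∈ Finset.range (m + 1), C (u (k / m)) * ((m.choose k : ℝ[X]) * X ^ k * (1 - X) ^ (m - k))

@[simp] theorem eval_BPoly (m : ℕ) (u : ℝ → ℝ) (x : ℝ) : (BPoly m u).eval x = Bop m u x := by
  simp only [BPoly, Bop, bern, eval_finsetSum]
  exact Finset.sum_congr rfl fun k _ => by simp; ring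

/-- `B_m` on polynomials. -/
noncomputable def BPL (m : ℕ) : Module.End ℝ ℝ[X] where
  toFun p := BPoly m (fun y => p.eval y)
  map_add' p q := by
    simp only [BPoly, eval_add, C_add, add_mul, Finset.sum_add_distrib]
  map_smul' a p := by
    simp only [BPoly, smul_eq_C_mul, eval_mul, eval_C, C_mul, Finset.mul_sum, mul_assoc,
      RingHom.id_apply]

/-- `I - B_m` on polynomials. -/
noncomputable def TP (m : ℕ) : Module.End ℝ ℝ[X] := 1 - BPL m

theorem eval_BPL (m : ℕ) (p : ℝ[X]) (x : ℝ) :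
    (BPL m p).eval x = Bop m (fun y => p.eval y) x := by
  rw [← eval_BPoly]
  rfl

theorem eval_TP (m : ℕ) (p : ℝ[X]) (x : ℝ) :
    (TP m p).eval x = TopL m (fun y => p.eval y) x := by
  simp [TP, TopL_apply, eval_BPL]

theorem eval_TP_pow (m l : ℕ) (p : ℝ[X]) (x : ℝ) :
    (((TP m) ^ l) p).eval x = ((TopL m) ^ l) (fun y => p.eval y) x := by
  induction l generalizing p x with
  | zero => rfl
  | succ l ih =>
    rw [pow_succ, Module.End.mul_apply, ih, pow_succ, Module.End.mul_apply]
    have e : (fun y => (TP m p).eval y) = TopL m (fun y => p.eval y) := by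
      funext y
      exact eval_TP m p y
    rw [e]

theorem X_mul_one_sub_X_mul_derivative_bernstein (m k : ℕ) (hk : k ≤ m) :
    X * (1 - X) * derivative ((m.choose k : ℝ[X]) * X ^ k * (1 - X) ^ (m - k))
      = (C (k : ℝ) - C (m : ℝ) * X) * ((m.choose k : ℝ[X]) * X ^ k * (1 - X) ^ (m - k)) := by
  have h1 : X * derivative ((X : ℝ[X]) ^ k) = C (k : ℝ) * X ^ k := by
    rcases k with _ | k
    · simp
    · rw [derivative_X_pow]; simp only [Nat.add_sub_cancel]; ring
  have h2 : (1 - X) * derivative ((1 - X : ℝ[X]) ^ (m - k))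
      = - (C ((m : ℝ) - k)) * (1 - X) ^ (m - k) := by
    obtain ⟨j, rfl⟩ := Nat.exists_eq_add_of_le hk
    rw [Nat.add_sub_cancel_left]
    rcases j with _ | j
    · simp
    · rw [derivative_pow]
      simp only [Nat.add_sub_cancel, derivative_sub, derivative_one, derivative_X]
      push_cast [C_add, C_sub, C_1]
      simp only [map_natCast]
      ring
  rw [derivative_mul, derivative_mul, derivative_natCast]
  calc _ = (m.choose k : ℝ[X]) * (1 - X) * (1 - X) ^ (m - k) * (X * derivative ((X : ℝ[X]) ^ k))
        + (m.choose k : ℝ[X]) * X ^ k * X * ((1 - X) * derivative ((1 - X : ℝ[X]) ^ (m - k))) := by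
        ring
    _ = _ := by rw [h1, h2, C_sub]; ring

theorem BPoly_id_mul {m : ℕ} (hm : 1 ≤ m) (u : ℝ → ℝ) :
    BPoly m (fun y => y * u y)
      = X * BPoly m u + C ((m : ℝ)⁻¹) * (X * (1 - X) * derivative (BPoly m u)) := by
  have hm' : (m : ℝ) ≠ 0 := by positivity
  have e : X * (1 - X) * derivative (BPoly m u) = ∑ k ∈ Finset.range (m + 1),
      C (u (k / m)) * ((C (k : ℝ) - C (m : ℝ) * X) *
        ((m.choose k : ℝ[X]) * X ^ k * (1 - X) ^ (m - k))) := by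
    rw [BPoly, derivative_sum, Finset.mul_sum]
    refine Finset.sum_congr rfl fun k hk => ?_
    rw [← X_mul_one_sub_X_mul_derivative_bernstein m k
      (Nat.lt_succ_iff.mp (Finset.mem_range.mp hk)), derivative_C_mul]
    ring
  rw [e, BPoly, BPoly, Finset.mul_sum, Finset.mul_sum, ← Finset.sum_add_distrib]
  refine Finset.sum_congr rfl fun k _ => ?_
  have h3 : C ((k : ℝ) / m) = C ((m : ℝ)⁻¹) * C (k : ℝ) := by
    rw [← C_mul]; congr 1; field_simp
  have h4 : C ((m : ℝ)⁻¹) * C (m : ℝ) = (1 : ℝ[X]) := by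
    rw [← C_mul, inv_mul_cancel₀ hm', C_1]
  rw [C_mul, h3]
  linear_combination (X : ℝ[X]) * (C (u (k / m)) *
    ((m.choose k : ℝ[X]) * X ^ k * (1 - X) ^ (m - k))) * h4

theorem BPoly_one (m : ℕ) : BPoly m (fun _ => 1) = 1 := by
  refine Polynomial.funext fun x => ?_
  rw [eval_BPoly, Bop_const, eval_one]

theorem natDegree_BPoly_pow {m : ℕ} (hm : 1 ≤ m) (j : ℕ) :
    (BPoly m (fun y => y ^ j)).natDegree ≤ j := by
  induction j with
  | zero => simp [BPoly_one]
  | succ j ih =>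
    have e : (fun y : ℝ => y ^ (j + 1)) = fun y => y * y ^ j := by funext y; ring
    rw [e, BPoly_id_mul hm]
    have h1 : (X * BPoly m (fun y => y ^ j)).natDegree ≤ j + 1 :=
      natDegree_mul_le.trans (by rw [natDegree_X]; omega)
    have h2 : (1 - X : ℝ[X]).natDegree ≤ 1 := by
      refine (natDegree_sub_le _ _).trans ?_
      simp
    refine (natDegree_add_le _ _).trans (max_le h1 ?_)
    rcases j with _ | j
    · simp [BPoly_one]
    · refine (natDegree_C_mul_le _ _).trans (natDegree_mul_le.trans ?_)
      have h3 := natDegree_derivative_le (BPoly m (fun y => y ^ (j + 1)))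
      have h4 : (X * (1 - X) : ℝ[X]).natDegree ≤ 2 :=
        natDegree_mul_le.trans (by rw [natDegree_X]; omega)
      omega

theorem natDegree_BPL {m : ℕ} (hm : 1 ≤ m) {N : ℕ} {p : ℝ[X]} (hp : p.natDegree ≤ N) :
    (BPL m p).natDegree ≤ N := by
  rw [p.as_sum_range_C_mul_X_pow' (Nat.lt_succ_of_le hp), map_sum]
  refine natDegree_sum_le_of_forall_le _ _ fun i hi => ?_
  rw [← smul_eq_C_mul, map_smul]
  refine (natDegree_smul_le _ _).trans ?_
  have := natDegree_BPoly_pow hm i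
  have e : BPL m (X ^ i) = BPoly m (fun y => y ^ i) := by simp [BPL]
  rw [e]
  have := Finset.mem_range.mp hi
  omega

theorem natDegree_TP {m : ℕ} (hm : 1 ≤ m) {N : ℕ} {p : ℝ[X]} (hp : p.natDegree ≤ N) :
    (TP m p).natDegree ≤ N :=
  (natDegree_sub_le _ _).trans (max_le hp (natDegree_BPL hm hp))

theorem natDegree_TP_pow {m : ℕ} (hm : 1 ≤ m) {N : ℕ} {p : ℝ[X]} (hp : p.natDegree ≤ N) (l : ℕ) :
    (((TP m) ^ l) p).natDegree ≤ N := by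
  induction l with
  | zero => exact hp
  | succ l ih => rw [pow_succ', Module.End.mul_apply]; exact natDegree_TP hm ih

theorem Bop_sub_self {m : ℕ} (hm : 1 ≤ m) (y : ℝ) : Bop m (fun z => z - y) y = 0 := by
  have h := congrArg (eval y) (BPoly_id_mul hm (fun _ => 1))
  rw [BPoly_one, eval_BPoly] at h
  have h' := Bop_add m (fun z => z * 1) (fun _ => -y) y
  rw [h, Bop_const] at h'
  simpa [← sub_eq_add_neg] using h'

theorem Bop_sub_self_sq {m : ℕ} (hm : 1 ≤ m) (y : ℝ) :
    Bop m (fun z => (z - y) ^ 2) y = y * (1 - y) / m := by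
  have h1 := BPoly_id_mul hm (fun _ => 1)
  have h2 := congrArg (eval y) (BPoly_id_mul hm (fun z => z * 1))
  rw [BPoly_one] at h1
  rw [h1, eval_BPoly] at h2
  have h3 := Bop_add m (fun z => z * (z * 1)) (fun z => (-2 * y) * z + y ^ 2) y
  have h4 := Bop_add m (fun z => (-2 * y) * z) (fun z => y ^ 2) y
  rw [Bop_const_mul, Bop_const] at h4
  have h5 := congrArg (eval y) h1
  rw [eval_BPoly] at h5
  have e : (fun z => (z - y) ^ 2) = fun z => z * (z * 1) + ((-2 * y) * z + y ^ 2) := by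
    funext z; ring
  rw [e, h3, h4, h2]
  simp at h5 ⊢
  rw [h5]
  ring

end Poly

section Markov
open Polynomial

theorem eval_iterate_derivative_eq (p : ℝ[X]) (k : ℕ) (y : ℝ) :
    (derivative^[k] p).eval y = k.factorial * (taylor y p).coeff k := by
  rw [taylor_coeff, ← factorial_smul_hasseDeriv]
  simp

theorem eval_eq_sum_taylor {N : ℕ} {p : ℝ[X]} (hp : p.natDegree ≤ N) (a y : ℝ) :
    p.eval y = ∑ i ∈ Finset.range (N + 1), (taylor a p).coeff i * (y - a) ^ i := by
  rw [← taylor_eval_sub a p y, eval_eq_sum_range' (Nat.lt_succ_of_le ((natDegree_taylor p a).le.trans hp))]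

theorem poly_eq_sum_taylor {N : ℕ} {p : ℝ[X]} (hp : p.natDegree ≤ N) (a : ℝ) :
    p = ∑ i ∈ Finset.range (N + 1), (taylor a p).coeff i • (X - C a) ^ i := by
  refine Polynomial.funext fun y => ?_
  rw [eval_eq_sum_taylor hp a y, eval_finsetSum]
  simp

theorem coeff_bound_of_unit (N : ℕ) : ∃ K : ℝ, 1 ≤ K ∧ ∀ (q : ℝ[X]) (B : ℝ), q.natDegree ≤ N →
    (∀ t ∈ Icc (0 : ℝ) 1, |q.eval t| ≤ B) → ∀ i, |q.coeff i| ≤ K * B := by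
  set s := Finset.range (N + 1)
  set v : ℕ → ℝ := fun k => (k : ℝ) / (N + 1) with hv
  have hN : (0 : ℝ) < N + 1 := by positivity
  have hinj : Set.InjOn v s := by
    intro a _ b _ hab
    simp only [hv] at hab
    rw [div_left_inj' hN.ne'] at hab
    exact_mod_cast hab
  set D : ℝ := ∑ i ∈ s, ∑ k ∈ s, |(Lagrange.basis s v k).coeff i| with hD
  have hD0 : 0 ≤ D := by positivity
  refine ⟨D + 1, by linarith, fun q B hq hB i => ?_⟩
  have hB0 : 0 ≤ B := (abs_nonneg _).trans (hB 0 (by simp))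
  by_cases hi : i ∈ s
  · have hdeg : q.degree < (s.card : ℕ) := by
      refine (degree_le_natDegree).trans_lt ?_
      simp only [s, Finset.card_range]
      exact_mod_cast Nat.lt_succ_of_le hq
    have e := Lagrange.eq_interpolate hinj hdeg
    have e2 : q.coeff i = ∑ k ∈ s, q.eval (v k) * (Lagrange.basis s v k).coeff i := by
      conv_lhs => rw [e, Lagrange.interpolate_apply, finsetSum_coeff]
      simp
    rw [e2]
    have hmem : ∀ k ∈ s, v k ∈ Icc (0 : ℝ) 1 := by
      intro k hk
      have hk' : (k : ℝ) < N + 1 := by exact_mod_cast Finset.mem_range.mp hk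
      exact ⟨by positivity, by simp only [hv]; rw [div_le_one hN]; exact hk'.le⟩
    calc _ ≤ ∑ k ∈ s, |q.eval (v k) * (Lagrange.basis s v k).coeff i| :=
          Finset.abs_sum_le_sum_abs _ _
      _ ≤ ∑ k ∈ s, B * |(Lagrange.basis s v k).coeff i| := by
          refine Finset.sum_le_sum fun k hk => ?_
          rw [abs_mul]
          gcongr
          exact hB _ (hmem k hk)
      _ = B * ∑ k ∈ s, |(Lagrange.basis s v k).coeff i| := by rw [Finset.mul_sum]
      _ ≤ B * D := by
          gcongr
          exact Finset.single_le_sum (f := fun i => ∑ k ∈ s, |(Lagrange.basis s v k).coeff i|)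
            (fun i _ => by positivity) hi
      _ ≤ _ := by nlinarith
  · have : q.coeff i = 0 := by
      apply coeff_eq_zero_of_natDegree_lt
      have := Finset.mem_range.not.mp hi
      omega
    rw [this, abs_zero]
    positivity

theorem markov_coeff (N : ℕ) : ∃ K : ℝ, 1 ≤ K ∧ ∀ (p : ℝ[X]) (a L B : ℝ), p.natDegree ≤ N →
    (∀ t ∈ Icc (0 : ℝ) 1, |p.eval (a + L * t)| ≤ B) →
    ∀ i, |(taylor a p).coeff i| * |L| ^ i ≤ K * B := by
  obtain ⟨K, hK, H⟩ := coeff_bound_of_unit N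
  refine ⟨K, hK, fun p a L B hp hB i => ?_⟩
  have := H ((taylor a p).comp (C L * X)) B ?_ ?_ i
  · rwa [comp_C_mul_X_coeff, abs_mul, abs_pow] at this
  · refine natDegree_comp_le.trans ?_
    rw [natDegree_taylor]
    calc _ ≤ N * 1 := Nat.mul_le_mul hp ((natDegree_C_mul_le L X).trans natDegree_X_le)
      _ = N := mul_one N
  · intro t ht
    have := hB t ht
    simpa [taylor_eval, add_comm] using this

theorem markov_growth (N : ℕ) : ∃ K : ℝ, 1 ≤ K ∧ ∀ (p : ℝ[X]) (a L B : ℝ), p.natDegree ≤ N →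
    L ≠ 0 → (∀ t ∈ Icc (0 : ℝ) 1, |p.eval (a + L * t)| ≤ B) →
    ∀ y, |p.eval y| ≤ K * B * (1 + |y - a| / |L|) ^ N := by
  obtain ⟨K, hK, H⟩ := markov_coeff N
  refine ⟨(N + 1) * K, by nlinarith [Nat.cast_nonneg (α := ℝ) N], fun p a L B hp hL hB y => ?_⟩
  have hB0 : 0 ≤ B := (abs_nonneg _).trans (hB 0 (by simp))
  have hL' : 0 < |L| := abs_pos.mpr hL
  rw [eval_eq_sum_taylor hp a y]
  refine (Finset.abs_sum_le_sum_abs _ _).trans ?_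
  have : ∀ i ∈ Finset.range (N + 1), |(taylor a p).coeff i * (y - a) ^ i| ≤
      K * B * (1 + |y - a| / |L|) ^ N := by
    intro i hi
    have hi' : i ≤ N := Nat.lt_succ_iff.mp (Finset.mem_range.mp hi)
    have h1 := H p a L B hp hB i
    have e : |(taylor a p).coeff i * (y - a) ^ i|
        = (|(taylor a p).coeff i| * |L| ^ i) * (|y - a| / |L|) ^ i := by
      rw [abs_mul, abs_pow, div_pow]; field_simp
    rw [e]
    gcongr
    have h0 : 0 ≤ |y - a| / |L| := by positivity
    calc (|y - a| / |L|) ^ i ≤ (1 + |y - a| / |L|) ^ i := by gcongr; linarith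
      _ ≤ _ := pow_le_pow_right₀ (by linarith) hi'
  refine (Finset.sum_le_card_nsmul _ _ _ this).trans ?_
  simp only [Finset.card_range, nsmul_eq_mul]
  push_cast
  exact le_of_eq (by ring)

theorem exists_half_segment {a b y : ℝ} (hab : a < b) (hy : y ∈ Icc a b) :
    ∃ L : ℝ, |L| = (b - a) / 2 ∧ ∀ t ∈ Icc (0 : ℝ) 1, y + L * t ∈ Icc a b := by
  rcases le_total y ((a + b) / 2) with h | h
  · refine ⟨(b - a) / 2, abs_of_pos (by linarith), fun t ht => ⟨?_, ?_⟩⟩ <;>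
      nlinarith [ht.1, ht.2, hy.1, hy.2]
  · refine ⟨-((b - a) / 2), by rw [abs_neg]; exact abs_of_pos (by linarith),
      fun t ht => ⟨?_, ?_⟩⟩ <;> nlinarith [ht.1, ht.2, hy.1, hy.2]

theorem markov_Icc (N : ℕ) : ∃ K : ℝ, 1 ≤ K ∧ ∀ (p : ℝ[X]) (a b B : ℝ), p.natDegree ≤ N →
    a < b → (∀ t ∈ Icc a b, |p.eval t| ≤ B) →
    ∀ y ∈ Icc a b, ∀ i, |(taylor y p).coeff i| * (b - a) ^ i ≤ K * B := by
  obtain ⟨K, hK, H⟩ := markov_coeff N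
  refine ⟨2 ^ N * K, one_le_mul_of_one_le_of_one_le (one_le_pow₀ one_le_two) hK,
    fun p a b B hp hab hB y hy i => ?_⟩
  have hB0 : 0 ≤ B := (abs_nonneg _).trans (hB y hy)
  obtain ⟨L, hL, hmem⟩ := exists_half_segment hab hy
  rcases le_or_gt i N with hi | hi
  · have h1 := H p y L B hp (fun t ht => hB _ (hmem t ht)) i
    rw [hL, div_pow] at h1
    calc |(taylor y p).coeff i| * (b - a) ^ i
        = 2 ^ i * (|(taylor y p).coeff i| * ((b - a) ^ i / 2 ^ i)) := by field_simp
      _ ≤ 2 ^ N * (K * B) := by gcongr; norm_num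
      _ = _ := by ring
  · have : (taylor y p).coeff i = 0 := by
      apply coeff_eq_zero_of_natDegree_lt
      rw [natDegree_taylor]; omega
    rw [this, abs_zero, zero_mul]
    positivity

/-- The second order operator `x(1-x) d²/dx²`. -/
noncomputable def EP : Module.End ℝ ℝ[X] where
  toFun p := X * (1 - X) * derivative (derivative p)
  map_add' p q := by simp only [derivative_add, mul_add]
  map_smul' a p := by simp only [derivative_smul, mul_smul_comm, RingHom.id_apply]

theorem EP_apply (p : ℝ[X]) : EP p = X * (1 - X) * derivative (derivative p) := rfl

theorem eval_EP (p : ℝ[X]) (y : ℝ) :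
    (EP p).eval y = y * (1 - y) * (2 * (taylor y p).coeff 2) := by
  have := eval_iterate_derivative_eq p 2 y
  simp only [Function.iterate_succ, Function.iterate_zero, Function.comp, id] at this
  rw [EP_apply, eval_mul, this]
  simp [Nat.factorial]

theorem natDegree_EP {N : ℕ} {p : ℝ[X]} (hp : p.natDegree ≤ N) : (EP p).natDegree ≤ N := by
  rw [EP_apply]
  have h2 : (1 - X : ℝ[X]).natDegree ≤ 1 := by
    refine (natDegree_sub_le _ _).trans ?_
    simp
  have h4 : (X * (1 - X) : ℝ[X]).natDegree ≤ 2 :=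
    natDegree_mul_le.trans (by rw [natDegree_X]; omega)
  have h3 := natDegree_iterate_derivative p 2
  simp only [Function.iterate_succ, Function.iterate_zero, Function.comp, id] at h3
  rcases le_or_gt 2 p.natDegree with h | h
  · exact natDegree_mul_le.trans (by omega)
  · have : derivative (derivative p) = 0 := by
      have := iterate_derivative_eq_zero h
      simpa using this
    rw [this]; simp

theorem natDegree_EP_pow {N : ℕ} {p : ℝ[X]} (hp : p.natDegree ≤ N) (l : ℕ) :
    ((EP ^ l) p).natDegree ≤ N := by
  induction l with
  | zero => exact hp
  | succ l ih => rw [pow_succ', Module.End.mul_apply]; exact natDegree_EP ih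

/-- Intervals on which the Bernstein operator acts on polynomials of bounded degree as a small
perturbation; `b - a` is the length and `m (b - a) δ² = 1`. -/
structure GoodInterval (a b : ℝ) : Prop where
  lt : a < b
  sub : Icc a b ⊆ Icc (0 : ℝ) 1
  var_le : ∀ y ∈ Icc a b, y * (1 - y) ≤ b - a

theorem EP_bound (N : ℕ) : ∃ K : ℝ, 1 ≤ K ∧ ∀ (p : ℝ[X]) (a b B : ℝ), p.natDegree ≤ N →
    GoodInterval a b → (∀ t ∈ Icc a b, |p.eval t| ≤ B) →
    ∀ y ∈ Icc a b, |(EP p).eval y| ≤ K * (B / (b - a)) := by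
  obtain ⟨K, hK, H⟩ := markov_Icc N
  refine ⟨2 * K, by linarith, fun p a b B hp hI hB y hy => ?_⟩
  have h1 := H p a b B hp hI.lt hB y hy 2
  have hL : 0 < b - a := sub_pos.mpr hI.lt
  have hy0 : 0 ≤ y * (1 - y) := mul_nonneg (hI.sub hy).1 (by linarith [(hI.sub hy).2])
  rw [eval_EP, abs_mul, abs_of_nonneg hy0, abs_mul, abs_two]
  calc _ ≤ (b - a) * (2 * |(taylor y p).coeff 2|) := by gcongr; exact hI.var_le y hy
    _ = 2 * (|(taylor y p).coeff 2| * (b - a) ^ 2) / (b - a) := by field_simp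
    _ ≤ 2 * (K * B) / (b - a) := by gcongr
    _ = _ := by ring

theorem EP_pow_bound (N l : ℕ) : ∃ K : ℝ, 1 ≤ K ∧ ∀ (p : ℝ[X]) (a b B : ℝ), p.natDegree ≤ N →
    GoodInterval a b → (∀ t ∈ Icc a b, |p.eval t| ≤ B) →
    ∀ y ∈ Icc a b, |((EP ^ l) p).eval y| ≤ K * (B / (b - a) ^ l) := by
  induction l with
  | zero => exact ⟨1, le_rfl, fun p a b B _ _ hB y hy => by simpa using hB y hy⟩
  | succ l ih =>
    obtain ⟨K, hK, H⟩ := ih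
    obtain ⟨D, hD, G⟩ := EP_bound N
    refine ⟨D * K, one_le_mul_of_one_le_of_one_le hD hK, fun p a b B hp hI hB y hy => ?_⟩
    rw [pow_succ', Module.End.mul_apply]
    have hL : 0 < b - a := sub_pos.mpr hI.lt
    have := G _ a b _ (natDegree_EP_pow hp l) hI (H p a b B hp hI hB) y hy
    refine this.trans (le_of_eq ?_)
    rw [pow_succ]; field_simp

theorem eval_TP_expand {m N : ℕ} (hm : 1 ≤ m) {p : ℝ[X]} (hp : p.natDegree ≤ N + 2) (y : ℝ) :
    (TP m p).eval y = (-(1 / (2 * (m : ℝ)))) * (EP p).eval y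
      - ∑ i ∈ Finset.range N, (taylor y p).coeff (i + 3) * Bop m (fun z => (z - y) ^ (i + 3)) y := by
  have e : Bop m (fun z => p.eval z) y
      = ∑ i ∈ Finset.range (N + 2 + 1), (taylor y p).coeff i * Bop m (fun z => (z - y) ^ i) y := by
    unfold Bop
    simp_rw [Finset.mul_sum]
    rw [Finset.sum_comm]
    refine Finset.sum_congr rfl fun k _ => ?_
    rw [eval_eq_sum_taylor hp y, Finset.mul_sum]
    exact Finset.sum_congr rfl fun i _ => by ring
  rw [eval_TP, TopL_apply, Pi.sub_apply, e]
  rw [Finset.sum_range_succ', Finset.sum_range_succ', Finset.sum_range_succ', eval_EP]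
  have e0 : Bop m (fun z => (z - y) ^ 0) y = 1 := by simpa using Bop_const m 1 y
  have e1 : Bop m (fun z => (z - y) ^ (0 + 1)) y = 0 := by simpa using Bop_sub_self hm y
  have e2 : Bop m (fun z => (z - y) ^ (0 + 1 + 1)) y = y * (1 - y) / m := Bop_sub_self_sq hm y
  rw [e0, e1, e2, taylor_coeff_zero]
  have hm' : (m : ℝ) ≠ 0 := by positivity
  field_simp
  ring

theorem central_moment_bound (i : ℕ) : ∃ K : ℝ, 1 ≤ K ∧ ∀ (m : ℕ) (y ρ : ℝ), WeightOK m y ρ →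
    |Bop m (fun z => (z - y) ^ i) y| ≤ K * ρ ^ i := by
  obtain ⟨K, hK, H⟩ := Bop_weight_le i
  refine ⟨K, hK, fun m y ρ h => ?_⟩
  have h1 := H m y ρ y h.one_le h.mem h.pos h.var_le h.one_le_mul h.mem
  have h2 : |Bop m (fun z => (z - y) ^ i) y| ≤ Bop m (fun z => (ρ + |z - y|) ^ i) y := by
    refine abs_Bop_le (fun z _ => ?_) h.mem
    rw [abs_pow]
    gcongr
    linarith [h.pos]
  simpa using h2.trans h1

/-- The comparison of `I - B_m` with `-(1/(2m)) x(1-x) d²/dx²` on polynomials. -/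
theorem TP_compare (N : ℕ) : ∃ K : ℝ, 1 ≤ K ∧ ∀ (p : ℝ[X]) (m : ℕ) (a b B δ : ℝ),
    p.natDegree ≤ N → 1 ≤ m → GoodInterval a b → 0 < δ → δ ≤ 1 → m * (b - a) * δ ^ 2 = 1 →
    (∀ t ∈ Icc a b, |p.eval t| ≤ B) →
    ∀ y ∈ Icc a b,
      |(TP m p).eval y - ((-(1 / (2 * (m : ℝ)))) • EP p).eval y| ≤ K * (δ ^ 3 * B) := by
  obtain ⟨K, hK, H⟩ := markov_Icc (N + 2)
  choose M hM G using fun i => central_moment_bound i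
  have hS : 0 ≤ ∑ i ∈ Finset.range N, K * M (i + 3) :=
    Finset.sum_nonneg fun i _ => by nlinarith [hM (i + 3)]
  refine ⟨1 + ∑ i ∈ Finset.range N, K * M (i + 3), by linarith,
    fun p m a b B δ hp hm hI hδ hδ1 hmδ hB y hy => ?_⟩
  have hB0 : 0 ≤ B := (abs_nonneg _).trans (hB y hy)
  have hL : 0 < b - a := sub_pos.mpr hI.lt
  have hm0 : (0 : ℝ) < m := by positivity
  rw [eval_TP_expand hm (hp.trans (Nat.le_add_right N 2)) y, eval_smul, smul_eq_mul,
    sub_right_comm, sub_self, zero_sub, abs_neg]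
  have hw : WeightOK m y ((b - a) * δ) := by
    refine ⟨hm, hI.sub hy, by positivity, (hI.var_le y hy).trans (le_of_eq ?_), ?_⟩
    · calc b - a = (b - a) * (m * (b - a) * δ ^ 2) := by rw [hmδ, mul_one]
        _ = _ := by ring
    · have : m * (b - a) * δ ^ 2 ≤ m * ((b - a) * δ) := by
        have : (m : ℝ) * ((b - a) * δ) * δ ≤ m * ((b - a) * δ) * 1 := by gcongr
        nlinarith
      linarith
  calc _ ≤ ∑ i ∈ Finset.range N,
        |(taylor y p).coeff (i + 3) * Bop m (fun z => (z - y) ^ (i + 3)) y| :=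
        Finset.abs_sum_le_sum_abs _ _
    _ ≤ ∑ i ∈ Finset.range N, (K * M (i + 3)) * (δ ^ 3 * B) := by
        refine Finset.sum_le_sum fun i _ => ?_
        have h1 := H p a b B (hp.trans (Nat.le_add_right N 2)) hI.lt hB y hy (i + 3)
        have h2 := G (i + 3) m y _ hw
        have hMi := hM (i + 3)
        rw [abs_mul]
        calc _ ≤ |(taylor y p).coeff (i + 3)| * (M (i + 3) * ((b - a) * δ) ^ (i + 3)) := by gcongr
          _ = |(taylor y p).coeff (i + 3)| * (b - a) ^ (i + 3) * (M (i + 3) * δ ^ (i + 3)) := by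
              rw [mul_pow]; ring
          _ ≤ (K * B) * (M (i + 3) * δ ^ 3) := by
              gcongr ?_ * (_ * ?_)
              exact pow_le_pow_of_le_one hδ.le hδ1 (by omega)
          _ = _ := by ring
    _ = (∑ i ∈ Finset.range N, K * M (i + 3)) * (δ ^ 3 * B) := by rw [Finset.sum_mul]
    _ ≤ _ := by
        have : 0 ≤ δ ^ 3 * B := by positivity
        nlinarith

theorem smulEP_pow_bound (N l : ℕ) : ∃ K : ℝ, 1 ≤ K ∧ ∀ (p : ℝ[X]) (m : ℕ) (a b B δ : ℝ),
    p.natDegree ≤ N → 1 ≤ m → GoodInterval a b → m * (b - a) * δ ^ 2 = 1 →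
    (∀ t ∈ Icc a b, |p.eval t| ≤ B) →
    ∀ y ∈ Icc a b, |((((-(1 / (2 * (m : ℝ)))) • EP) ^ l) p).eval y| ≤ K * (δ ^ (2 * l) * B) := by
  obtain ⟨K, hK, H⟩ := EP_pow_bound N l
  refine ⟨K, hK, fun p m a b B δ hp hm hI hmδ hB y hy => ?_⟩
  have h1 := H p a b B hp hI hB y hy
  have hB0 : 0 ≤ B := (abs_nonneg _).trans (hB y hy)
  have hL : 0 < b - a := sub_pos.mpr hI.lt
  have hm0 : (0 : ℝ) < m := by positivity
  have hδ2 : δ ^ 2 = 1 / (m * (b - a)) := by field_simp; linarith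
  rw [_root_.smul_pow, LinearMap.smul_apply, eval_smul, smul_eq_mul, abs_mul, abs_pow, abs_neg,
    abs_of_pos (by positivity), pow_mul, hδ2]
  calc _ ≤ (1 / (2 * (m : ℝ))) ^ l * (K * (B / (b - a) ^ l)) := by gcongr
    _ ≤ (1 / (m : ℝ)) ^ l * (K * (B / (b - a) ^ l)) := by gcongr; linarith
    _ = _ := by rw [div_pow, div_pow, mul_pow, one_pow]; field_simp

theorem TP_bound (N : ℕ) : ∃ K : ℝ, 1 ≤ K ∧ ∀ (p : ℝ[X]) (m : ℕ) (a b B δ : ℝ),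
    p.natDegree ≤ N → 1 ≤ m → GoodInterval a b → 0 < δ → δ ≤ 1 → m * (b - a) * δ ^ 2 = 1 →
    (∀ t ∈ Icc a b, |p.eval t| ≤ B) →
    ∀ y ∈ Icc a b, |(TP m p).eval y| ≤ K * (δ ^ 2 * B) := by
  obtain ⟨K, hK, H⟩ := TP_compare N
  obtain ⟨D, hD, G⟩ := smulEP_pow_bound N 1
  refine ⟨K + D, by linarith, fun p m a b B δ hp hm hI hδ hδ1 hmδ hB y hy => ?_⟩
  have hB0 : 0 ≤ B := (abs_nonneg _).trans (hB y hy)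
  have h1 := H p m a b B δ hp hm hI hδ hδ1 hmδ hB y hy
  have h2 := G p m a b B δ hp hm hI hmδ hB y hy
  rw [pow_one, LinearMap.smul_apply, mul_one] at h2
  have h3 := abs_add_le ((TP m p).eval y - ((-(1 / (2 * (m : ℝ)))) • EP p).eval y)
    (((-(1 / (2 * (m : ℝ)))) • EP p).eval y)
  rw [sub_add_cancel] at h3
  have h4 : K * (δ ^ 3 * B) ≤ K * (δ ^ 2 * B) := by
    gcongr K * (?_ * B)
    exact pow_le_pow_of_le_one hδ.le hδ1 (by omega)
  linarith

theorem TP_pow_bound (N l : ℕ) : ∃ K : ℝ, 1 ≤ K ∧ ∀ (p : ℝ[X]) (m : ℕ) (a b B δ : ℝ),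
    p.natDegree ≤ N → 1 ≤ m → GoodInterval a b → 0 < δ → δ ≤ 1 → m * (b - a) * δ ^ 2 = 1 →
    (∀ t ∈ Icc a b, |p.eval t| ≤ B) →
    ∀ y ∈ Icc a b, |(((TP m) ^ l) p).eval y| ≤ K * (δ ^ (2 * l) * B) := by
  induction l with
  | zero => exact ⟨1, le_rfl, fun p m a b B δ _ _ _ _ _ _ hB y hy => by simpa using hB y hy⟩
  | succ l ih =>
    obtain ⟨K, hK, H⟩ := ih
    obtain ⟨D, hD, G⟩ := TP_bound N
    refine ⟨D * K, one_le_mul_of_one_le_of_one_le hD hK,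
      fun p m a b B δ hp hm hI hδ hδ1 hmδ hB y hy => ?_⟩
    rw [pow_succ', Module.End.mul_apply]
    refine (G _ m a b _ δ (natDegree_TP_pow hm hp l) hm hI hδ hδ1 hmδ
      (H p m a b B δ hp hm hI hδ hδ1 hmδ hB) y hy).trans (le_of_eq ?_)
    ring

theorem TP_pow_compare (N l : ℕ) : ∃ K : ℝ, 1 ≤ K ∧ ∀ (p : ℝ[X]) (m : ℕ) (a b B δ : ℝ),
    p.natDegree ≤ N → 1 ≤ m → GoodInterval a b → 0 < δ → δ ≤ 1 → m * (b - a) * δ ^ 2 = 1 →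
    (∀ t ∈ Icc a b, |p.eval t| ≤ B) →
    ∀ y ∈ Icc a b, |(((TP m) ^ l) p).eval y - ((((-(1 / (2 * (m : ℝ)))) • EP) ^ l) p).eval y|
      ≤ K * (δ ^ (2 * l + 1) * B) := by
  induction l with
  | zero =>
    refine ⟨1, le_rfl, fun p m a b B δ _ _ _ hδ _ _ hB y hy => ?_⟩
    have hB0 : 0 ≤ B := (abs_nonneg _).trans (hB y hy)
    simp
    positivity
  | succ l ih =>
    obtain ⟨K, hK, H⟩ := ih
    obtain ⟨D, hD, G⟩ := TP_bound N
    obtain ⟨D', hD', G'⟩ := TP_compare N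
    obtain ⟨F, hF, J⟩ := smulEP_pow_bound N l
    refine ⟨D * K + D' * F, by nlinarith,
      fun p m a b B δ hp hm hI hδ hδ1 hmδ hB y hy => ?_⟩
    set S : Module.End ℝ ℝ[X] := (-(1 / (2 * (m : ℝ)))) • EP with hS
    have hSdeg : ((S ^ l) p).natDegree ≤ N := by
      rw [hS, _root_.smul_pow, LinearMap.smul_apply]
      exact (natDegree_smul_le _ _).trans (natDegree_EP_pow hp l)
    have h1 := G (((TP m) ^ l) p - (S ^ l) p) m a b _ δ
      ((natDegree_sub_le _ _).trans (max_le (natDegree_TP_pow hm hp l) hSdeg)) hm hI hδ hδ1 hmδ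
      (fun t ht => by rw [eval_sub]; exact H p m a b B δ hp hm hI hδ hδ1 hmδ hB t ht) y hy
    have h2 := G' ((S ^ l) p) m a b _ δ hSdeg hm hI hδ hδ1 hmδ
      (J p m a b B δ hp hm hI hmδ hB) y hy
    rw [map_sub, eval_sub] at h1
    rw [← LinearMap.smul_apply, ← hS] at h2
    rw [pow_succ', Module.End.mul_apply, pow_succ', Module.End.mul_apply]
    have h3 := abs_add_le ((TP m (((TP m) ^ l) p)).eval y - (TP m ((S ^ l) p)).eval y)
      ((TP m ((S ^ l) p)).eval y - (S ((S ^ l) p)).eval y)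
    rw [sub_add_sub_cancel] at h3
    refine h3.trans ((add_le_add h1 h2).trans (le_of_eq ?_))
    ring

end Markov

section LocalPoly
open Polynomial

theorem goodInterval_unit : GoodInterval 0 1 where
  lt := one_pos
  sub := subset_rfl
  var_le y hy := by nlinarith [hy.1, hy.2]

theorem goodInterval_double {c : ℝ} (hc : 0 < c) (hc' : c ≤ 1 / 2) : GoodInterval 0 (2 * c) where
  lt := by linarith
  sub y hy := ⟨hy.1, by linarith [hy.2]⟩
  var_le y hy := by nlinarith [hy.1, hy.2]

theorem Bop_zero {m : ℕ} (u : ℝ → ℝ) : Bop m u 0 = u 0 := by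
  unfold Bop bern
  rw [Finset.sum_eq_single 0]
  · simp
  · intro k _ hk
    simp [hk]
  · simp

theorem TP_pow_eval_zero {m l : ℕ} (hl : 1 ≤ l) (p : ℝ[X]) : (((TP m) ^ l) p).eval 0 = 0 := by
  obtain ⟨k, rfl⟩ := Nat.exists_eq_add_of_le' hl
  rw [pow_succ', Module.End.mul_apply, eval_TP, TopL_apply, Pi.sub_apply, Bop_zero, sub_self]

theorem EP_pow_eval_zero {l : ℕ} (hl : 1 ≤ l) (p : ℝ[X]) : ((EP ^ l) p).eval 0 = 0 := by
  obtain ⟨k, rfl⟩ := Nat.exists_eq_add_of_le' hl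
  rw [pow_succ', Module.End.mul_apply, EP_apply]
  simp

theorem vanish_bound (N : ℕ) : ∃ K : ℝ, 1 ≤ K ∧ ∀ (q : ℝ[X]) (B : ℝ), q.natDegree ≤ N →
    q.eval 0 = 0 → (∀ t ∈ Icc (0 : ℝ) 1, |q.eval t| ≤ B) →
    ∀ x ∈ Icc (0 : ℝ) 1, |q.eval x| ≤ K * (B * x) := by
  obtain ⟨K, hK, H⟩ := markov_coeff (N + 1)
  refine ⟨(N + 1) * K, by nlinarith [Nat.cast_nonneg (α := ℝ) N], fun q B hq h0 hB x hx => ?_⟩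
  have hB0 : 0 ≤ B := (abs_nonneg _).trans (hB x hx)
  have hq' : q.natDegree ≤ N + 1 := hq.trans (Nat.le_succ N)
  have hc := H q 0 1 B hq' (by simpa using hB)
  rw [eval_eq_sum_taylor hq' 0 x, Finset.sum_range_succ', taylor_coeff_zero, h0, zero_mul, add_zero]
  refine (Finset.abs_sum_le_sum_abs _ _).trans ?_
  have : ∀ i ∈ Finset.range (N + 1), |(taylor 0 q).coeff (i + 1) * (x - 0) ^ (i + 1)| ≤
      K * (B * x) := by
    intro i _
    have h1 := hc (i + 1)
    rw [abs_one, one_pow, mul_one] at h1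
    rw [abs_mul, sub_zero, abs_of_nonneg (pow_nonneg hx.1 _), ← mul_assoc]
    refine mul_le_mul h1 ?_ (pow_nonneg hx.1 _) (by positivity)
    calc x ^ (i + 1) ≤ x ^ 1 := pow_le_pow_of_le_one hx.1 hx.2 (by omega)
      _ = x := pow_one x
  refine (Finset.sum_le_card_nsmul _ _ _ this).trans (le_of_eq ?_)
  simp only [Finset.card_range, nsmul_eq_mul]
  push_cast
  ring

theorem eval_sub_pow_le_unit {c : ℝ} (hc : c ∈ Icc (0 : ℝ) 1) (j : ℕ) :
    ∀ t ∈ Icc (0 : ℝ) 1, |((X - C c) ^ j : ℝ[X]).eval t| ≤ 1 := by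
  intro t ht
  simp only [eval_pow, eval_sub, eval_X, eval_C, abs_pow]
  exact pow_le_one₀ (abs_nonneg _) (abs_le.mpr ⟨by linarith [ht.1, hc.2], by linarith [ht.2, hc.1]⟩)

theorem eval_sub_pow_le_double (c : ℝ) (j : ℕ) :
    ∀ t ∈ Icc (0 : ℝ) (2 * c), |((X - C c) ^ j : ℝ[X]).eval t| ≤ c ^ j := by
  intro t ht
  simp only [eval_pow, eval_sub, eval_X, eval_C, abs_pow]
  exact pow_le_pow_left₀ (abs_nonneg _) (abs_le.mpr ⟨by linarith [ht.1], by linarith [ht.2]⟩) j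

theorem natDegree_sub_pow_le (c : ℝ) (j : ℕ) : ((X - C c) ^ j : ℝ[X]).natDegree ≤ j := by
  rw [natDegree_pow, natDegree_X_sub_C, mul_one]

/-- A linear functional of a polynomial is controlled by its values on shifted monomials. -/
theorem abs_functional_le {N : ℕ} (F : ℝ[X] →ₗ[ℝ] ℝ) (p : ℝ[X]) (c M : ℝ) (hp : p.natDegree ≤ N)
    (h : ∀ j ≤ N, |(taylor c p).coeff j| * |F ((X - C c) ^ j)| ≤ M) : |F p| ≤ (N + 1) * M := by
  conv_lhs => rw [poly_eq_sum_taylor hp c, map_sum]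
  refine (Finset.abs_sum_le_sum_abs _ _).trans ?_
  have : ∀ j ∈ Finset.range (N + 1), |F ((taylor c p).coeff j • (X - C c) ^ j)| ≤ M := by
    intro j hj
    rw [map_smul, smul_eq_mul, abs_mul]
    exact h j (Nat.lt_succ_iff.mp (Finset.mem_range.mp hj))
  refine (Finset.sum_le_card_nsmul _ _ _ this).trans (le_of_eq ?_)
  simp

theorem TP_pow_local (N l : ℕ) (hl : 1 ≤ l) : ∃ K : ℝ, 1 ≤ K ∧
    ∀ (p : ℝ[X]) (m : ℕ) (c s μ H x : ℝ), p.natDegree ≤ N → 1 ≤ m → 0 < s → c = s ^ 2 →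
    c ≤ 1 / 2 → 0 < μ → m * μ ^ 2 = 1 → μ ≤ s → 0 ≤ x → x ≤ c → 0 ≤ H →
    (∀ j ≤ l, |(taylor c p).coeff j| * c ≤ H) →
    (∀ j, l < j → |(taylor c p).coeff j| * c ^ j ≤ H * c ^ l) →
    |(((TP m) ^ l) p).eval x| ≤ K * (H * μ ^ (2 * l)) := by
  obtain ⟨K₁, hK₁, H₁⟩ := TP_pow_bound N l
  obtain ⟨K₂, hK₂, H₂⟩ := vanish_bound N
  refine ⟨(N + 1) * (K₂ * K₁), by
    nlinarith [Nat.cast_nonneg (α := ℝ) N, one_le_mul_of_one_le_of_one_le hK₂ hK₁], ?_⟩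
  intro p m c s μ H x hp hm hs hcs hc hμ hmμ hμs hx hxc hH hlow hhigh
  have hc0 : 0 < c := by rw [hcs]; positivity
  have hcI : c ∈ Icc (0 : ℝ) 1 := ⟨hc0.le, by linarith⟩
  have hxI : x ∈ Icc (0 : ℝ) 1 := ⟨hx, by linarith⟩
  have hμ1 : μ ≤ 1 := hμs.trans (by nlinarith)
  have hm0 : (0 : ℝ) < m := by positivity
  have hKK : K₁ ≤ K₂ * K₁ := by nlinarith
  have := abs_functional_le (N := N) ((leval x).comp ((TP m) ^ l)) p c
    (K₂ * K₁ * (H * μ ^ (2 * l))) hp ?_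
  · simpa [mul_assoc] using this
  intro j hj
  have hdeg : ((X - C c) ^ j : ℝ[X]).natDegree ≤ N := (natDegree_sub_pow_le c j).trans hj
  simp only [LinearMap.comp_apply, leval_apply]
  rcases le_or_gt j l with hjl | hjl
  · have h1 := H₁ _ m 0 1 1 μ hdeg hm goodInterval_unit hμ hμ1 (by simpa using hmμ)
      (eval_sub_pow_le_unit hcI j)
    have h2 := H₂ _ _ (natDegree_TP_pow hm hdeg l) (TP_pow_eval_zero hl _) h1 x hxI
    calc _ ≤ |(taylor c p).coeff j| * (K₂ * (K₁ * (μ ^ (2 * l) * 1) * c)) := by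
          refine mul_le_mul_of_nonneg_left (h2.trans ?_) (abs_nonneg _)
          gcongr
      _ = K₂ * K₁ * ((|(taylor c p).coeff j| * c) * μ ^ (2 * l)) := by ring
      _ ≤ _ := by gcongr; exact hlow j hjl
  · set η := μ / s / Real.sqrt 2 with hη
    have h2 : Real.sqrt 2 ^ 2 = 2 := Real.sq_sqrt (by norm_num)
    have hsq : 0 < Real.sqrt 2 := by positivity
    have hη2 : η ^ 2 = μ ^ 2 / (2 * c) := by
      rw [hη, div_pow, div_pow, h2, ← hcs]; field_simp
    have hη1 : η ≤ 1 := by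
      have h3 : η ^ 2 ≤ 1 := by
        rw [hη2, div_le_one (by positivity), hcs]
        nlinarith
      have : 0 < η := by positivity
      nlinarith
    have h1 := H₁ _ m 0 (2 * c) (c ^ j) η hdeg hm (goodInterval_double hc0 hc) (by positivity) hη1
      (by rw [hη2, sub_zero]; field_simp; linarith) (eval_sub_pow_le_double c j) x ⟨hx, by linarith⟩
    rw [pow_mul, hη2] at h1
    calc _ ≤ |(taylor c p).coeff j| * (K₁ * ((μ ^ 2 / c) ^ l * c ^ j)) := by
          refine mul_le_mul_of_nonneg_left (h1.trans ?_) (abs_nonneg _)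
          gcongr
          linarith
      _ = K₁ * ((μ ^ 2 / c) ^ l * (|(taylor c p).coeff j| * c ^ j)) := by ring
      _ ≤ K₁ * ((μ ^ 2 / c) ^ l * (H * c ^ l)) := by gcongr K₁ * (_ * ?_); exact hhigh j hjl
      _ = K₁ * (H * μ ^ (2 * l)) := by rw [pow_mul, div_pow]; field_simp
      _ ≤ _ := by gcongr

theorem TP_pow_compare_local (N l : ℕ) : ∃ K : ℝ, 1 ≤ K ∧
    ∀ (p : ℝ[X]) (m : ℕ) (c s μ H : ℝ), p.natDegree ≤ N → 1 ≤ m → 0 < s → c = s ^ 2 →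
    c ≤ 1 / 2 → 0 < μ → m * μ ^ 2 = 1 → μ ≤ s → 0 ≤ H →
    (∀ j ≤ l, |(taylor c p).coeff j| ≤ H) →
    (∀ j, l < j → |(taylor c p).coeff j| * c ^ j ≤ H * (c ^ l * s)) →
    |(((TP m) ^ l) p).eval c - ((((-(1 / (2 * (m : ℝ)))) • EP) ^ l) p).eval c|
      ≤ K * (H * μ ^ (2 * l + 1)) := by
  obtain ⟨K₁, hK₁, H₁⟩ := TP_pow_compare N l
  refine ⟨(N + 1) * K₁, by nlinarith [Nat.cast_nonneg (α := ℝ) N], ?_⟩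
  intro p m c s μ H hp hm hs hcs hc hμ hmμ hμs hH hlow hhigh
  have hc0 : 0 < c := by rw [hcs]; positivity
  have hcI : c ∈ Icc (0 : ℝ) 1 := ⟨hc0.le, by linarith⟩
  have hμ1 : μ ≤ 1 := hμs.trans (by nlinarith)
  have hm0 : (0 : ℝ) < m := by positivity
  have := abs_functional_le (N := N)
    ((leval c).comp ((TP m) ^ l - ((-(1 / (2 * (m : ℝ)))) • EP) ^ l)) p c
    (K₁ * (H * μ ^ (2 * l + 1))) hp ?_
  · simp only [LinearMap.comp_apply, leval_apply, LinearMap.sub_apply, eval_sub] at this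
    rwa [← mul_assoc] at this
  intro j hj
  have hdeg : ((X - C c) ^ j : ℝ[X]).natDegree ≤ N := (natDegree_sub_pow_le c j).trans hj
  simp only [LinearMap.comp_apply, leval_apply, LinearMap.sub_apply, eval_sub]
  rcases le_or_gt j l with hjl | hjl
  · have h1 := H₁ _ m 0 1 1 μ hdeg hm goodInterval_unit hμ hμ1 (by simpa using hmμ)
      (eval_sub_pow_le_unit hcI j) c hcI
    calc _ ≤ H * (K₁ * (μ ^ (2 * l + 1) * 1)) := by
          gcongr
          exact hlow j hjl
      _ = _ := by ring
  · set η := μ / s / Real.sqrt 2 with hη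
    have h2 : Real.sqrt 2 ^ 2 = 2 := Real.sq_sqrt (by norm_num)
    have hsq : 1 ≤ Real.sqrt 2 := by rw [Real.one_le_sqrt]; norm_num
    have hη2 : η ^ 2 = μ ^ 2 / (2 * c) := by
      rw [hη, div_pow, div_pow, h2, ← hcs]; field_simp
    have hηs : η ≤ μ / s := div_le_self (by positivity) hsq
    have hη1 : η ≤ 1 := hηs.trans ((div_le_one hs).mpr hμs)
    have hη0 : 0 < η := by positivity
    have h1 := H₁ _ m 0 (2 * c) (c ^ j) η hdeg hm (goodInterval_double hc0 hc) hη0 hη1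
      (by rw [hη2, sub_zero]; field_simp; linarith) (eval_sub_pow_le_double c j) c ⟨hc0.le, by linarith⟩
    calc _ ≤ |(taylor c p).coeff j| * (K₁ * ((μ / s) ^ (2 * l + 1) * c ^ j)) := by
          refine mul_le_mul_of_nonneg_left (h1.trans ?_) (abs_nonneg _)
          gcongr
      _ = K₁ * ((μ / s) ^ (2 * l + 1) * (|(taylor c p).coeff j| * c ^ j)) := by ring
      _ ≤ K₁ * ((μ / s) ^ (2 * l + 1) * (H * (c ^ l * s))) := by
          gcongr K₁ * (_ * ?_); exact hhigh j hjl
      _ = K₁ * (H * μ ^ (2 * l + 1)) := by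
          rw [hcs, ← pow_mul, ← pow_succ, div_pow]; field_simp

theorem EP_pow_local (N l : ℕ) (hl : 1 ≤ l) : ∃ K : ℝ, 1 ≤ K ∧
    ∀ (p : ℝ[X]) (c s H : ℝ), p.natDegree ≤ N → 0 < s → c = s ^ 2 → c ≤ 1 / 2 → 0 ≤ H →
    (∀ j ≤ l, |(taylor c p).coeff j| ≤ H) →
    (∀ j, l < j → |(taylor c p).coeff j| * c ^ j ≤ H * (c ^ l * s)) →
    |((EP ^ l) p).eval c| ≤ K * (H * s) := by
  obtain ⟨K₁, hK₁, H₁⟩ := EP_pow_bound N l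
  obtain ⟨K₂, hK₂, H₂⟩ := vanish_bound N
  refine ⟨(N + 1) * (K₂ * K₁), by
    nlinarith [Nat.cast_nonneg (α := ℝ) N, one_le_mul_of_one_le_of_one_le hK₂ hK₁], ?_⟩
  intro p c s H hp hs hcs hc hH hlow hhigh
  have hc0 : 0 < c := by rw [hcs]; positivity
  have hcI : c ∈ Icc (0 : ℝ) 1 := ⟨hc0.le, by linarith⟩
  have hs1 : s ≤ 1 := by nlinarith
  have hKK : K₁ ≤ K₂ * K₁ := by nlinarith
  have := abs_functional_le (N := N) ((leval c).comp (EP ^ l)) p c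
    (K₂ * K₁ * (H * s)) hp ?_
  · simpa [mul_assoc] using this
  intro j hj
  have hdeg : ((X - C c) ^ j : ℝ[X]).natDegree ≤ N := (natDegree_sub_pow_le c j).trans hj
  simp only [LinearMap.comp_apply, leval_apply]
  rcases le_or_gt j l with hjl | hjl
  · have h1 := H₁ _ 0 1 1 hdeg goodInterval_unit (eval_sub_pow_le_unit hcI j)
    have h2 := H₂ _ _ (natDegree_EP_pow hdeg l) (EP_pow_eval_zero hl _) h1 c hcI
    simp only [sub_zero, one_pow, div_one, mul_one] at h2
    calc _ ≤ H * (K₂ * (K₁ * c)) := by gcongr; exact hlow j hjl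
      _ = K₂ * K₁ * (H * (s * s)) := by rw [hcs]; ring
      _ ≤ K₂ * K₁ * (H * (s * 1)) := by gcongr
      _ = _ := by ring
  · have h1 := H₁ _ 0 (2 * c) (c ^ j) hdeg (goodInterval_double hc0 hc)
      (eval_sub_pow_le_double c j) c ⟨hc0.le, by linarith⟩
    rw [sub_zero] at h1
    calc _ ≤ |(taylor c p).coeff j| * (K₁ * (c ^ j / c ^ l)) := by
          refine mul_le_mul_of_nonneg_left (h1.trans ?_) (abs_nonneg _)
          gcongr
          linarith
      _ = K₁ * ((|(taylor c p).coeff j| * c ^ j) / c ^ l) := by ring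
      _ ≤ K₁ * ((H * (c ^ l * s)) / c ^ l) := by gcongr K₁ * (?_ / _); exact hhigh j hjl
      _ = K₁ * (H * s) := by field_simp
      _ ≤ _ := by gcongr

end LocalPoly

section Whitney
open Polynomial

/-- Steklov mean `∫₀¹ f (x + h t) dt`. -/
noncomputable def steklov (h : ℝ) (f : ℝ → ℝ) : ℝ → ℝ := fun x => ∫ t in (0 : ℝ)..1, f (x + h * t)

theorem steklov_zero (f : ℝ → ℝ) : steklov 0 f = f := by
  funext x
  simp [steklov]

theorem hasDerivAt_steklov {h : ℝ} (hh : h ≠ 0) {f : ℝ → ℝ} (hf : Continuous f) (x : ℝ) :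
    HasDerivAt (steklov h f) (h⁻¹ * (f (x + h) - f x)) x := by
  have e : steklov h f = fun x => h⁻¹ * ((∫ t in (0 : ℝ)..(x + h), f t) - ∫ t in (0 : ℝ)..x, f t) := by
    funext y
    rw [steklov, intervalIntegral.integral_comp_add_mul f hh, smul_eq_mul,
      intervalIntegral.integral_interval_sub_left (hf.intervalIntegrable _ _)
        (hf.intervalIntegrable _ _)]
    simp
  rw [e]
  have h1 := (hf.integral_hasStrictDerivAt 0 x).hasDerivAt
  have h2 := (hf.integral_hasStrictDerivAt 0 (x + h)).hasDerivAt.comp_add_const x h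
  exact (h2.sub h1).const_mul _

theorem continuous_steklov {h : ℝ} {f : ℝ → ℝ} (hf : Continuous f) : Continuous (steklov h f) := by
  rcases eq_or_ne h 0 with rfl | hh
  · rwa [steklov_zero]
  · exact continuous_iff_continuousAt.mpr fun x => (hasDerivAt_steklov hh hf x).continuousAt

theorem continuous_steklov_iterate {h : ℝ} {f : ℝ → ℝ} (hf : Continuous f) (j : ℕ) :
    Continuous ((steklov h)^[j] f) := by
  induction j with
  | zero => exact hf
  | succ j ih => rw [Function.iterate_succ_apply']; exact continuous_steklov ih

theorem steklov_combination_bound {n : ℕ} {f : ℝ → ℝ} (hf : Continuous f) (a : ℕ → ℝ) {h B : ℝ}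
    (hh : 0 ≤ h) (x : ℝ) (j : ℕ) (w : ℝ)
    (H : ∀ u ∈ Icc w (w + j * h), |∑ k ∈ Finset.range n, a k * f (x + k * u)| ≤ B) :
    |∑ k ∈ Finset.range n, a k * ((steklov (k * h))^[j] f) (x + k * w)| ≤ B := by
  induction j generalizing w with
  | zero => simpa using H w (by simp)
  | succ j ih =>
    have hint : ∀ k ∈ Finset.range n, IntervalIntegrable
        (fun t => a k * ((steklov (k * h))^[j] f) (x + k * w + k * h * t)) volume 0 1 := by
      intro k _
      apply Continuous.intervalIntegrable
      have := continuous_steklov_iterate (h := k * h) hf j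
      fun_prop
    have e : ∑ k ∈ Finset.range n, a k * ((steklov (k * h))^[j + 1] f) (x + k * w)
        = ∫ t in (0 : ℝ)..1, ∑ k ∈ Finset.range n,
            a k * ((steklov (k * h))^[j] f) (x + k * w + k * h * t) := by
      rw [intervalIntegral.integral_finsetSum hint]
      refine Finset.sum_congr rfl fun k _ => ?_
      rw [Function.iterate_succ_apply', intervalIntegral.integral_const_mul]
      rfl
    rw [e, ← Real.norm_eq_abs]
    have := intervalIntegral.norm_integral_le_of_norm_le_const (a := 0) (b := 1) (C := B)
      (f := fun t => ∑ k ∈ Finset.range n,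
            a k * ((steklov (k * h))^[j] f) (x + k * w + k * h * t)) ?_
    · simpa using this
    intro t ht
    rw [uIoc_of_le zero_le_one] at ht
    have hw := ih (w + h * t) ?_
    · rw [Real.norm_eq_abs]
      have e2 : ∀ k : ℕ, x + k * w + k * h * t = x + k * (w + h * t) := fun k => by ring
      simp only [e2]
      exact hw
    · intro u hu
      apply H
      push_cast
      have : 0 ≤ h * t := mul_nonneg hh ht.1.le
      have : h * t ≤ h * 1 := mul_le_mul_of_nonneg_left ht.2 hh
      exact ⟨by linarith [hu.1], by linarith [hu.2]⟩

theorem hasDerivAt_fwdDiff_iter {F F' : ℝ → ℝ} (h : ℝ) (hF : ∀ x, HasDerivAt F (F' x) x) (i : ℕ)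
    (x : ℝ) : HasDerivAt ((fwdDiff h)^[i] F) ((fwdDiff h)^[i] F' x) x := by
  induction i generalizing F F' with
  | zero => exact hF x
  | succ i ih =>
    rw [Function.iterate_succ_apply, Function.iterate_succ_apply]
    exact ih fun y => ((hF (y + h)).comp_add_const y h).sub (hF y)

/-- Alternating binomial sum of the values of `f` on an arithmetic progression. -/
noncomputable def altSum (r : ℕ) (f : ℝ → ℝ) (y u : ℝ) : ℝ :=
  ∑ k ∈ Finset.range (r + 1), (-1 : ℝ) ^ k * (r.choose k : ℝ) * f (y + k * u)

theorem fwdDiff_iter_eq_altSum (r : ℕ) (f : ℝ → ℝ) (y u : ℝ) :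
    (fwdDiff u)^[r] f y = (-1) ^ r * altSum r f y u := by
  rw [fwdDiff_iter_eq_sum_shift, altSum, Finset.mul_sum]
  refine Finset.sum_congr rfl fun k hk => ?_
  have hk' : k ≤ r := Nat.lt_succ_iff.mp (Finset.mem_range.mp hk)
  have : (-1 : ℝ) ^ r * (-1) ^ k = (-1) ^ (r - k) := by
    obtain ⟨j, rfl⟩ := Nat.exists_eq_add_of_le hk'
    rw [Nat.add_sub_cancel_left, pow_add, mul_right_comm, ← mul_pow]
    norm_num
  simp only [nsmul_eq_mul, zsmul_eq_mul]
  push_cast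
  rw [← this]
  ring

theorem abs_fwdDiff_iter (r : ℕ) (f : ℝ → ℝ) (y u : ℝ) :
    |(fwdDiff u)^[r] f y| = |altSum r f y u| := by
  rw [fwdDiff_iter_eq_altSum, abs_mul, abs_pow, abs_neg, abs_one, one_pow, one_mul]

theorem altSum_reflect (r : ℕ) (f : ℝ → ℝ) (y u : ℝ) :
    |altSum r (fun t => f (1 - t)) y u| = |altSum r f (1 - y - r * u) u| := by
  have : altSum r (fun t => f (1 - t)) y u = (-1) ^ r * altSum r f (1 - y - r * u) u := by
    rw [altSum, altSum, ← Finset.sum_range_reflect, Finset.mul_sum]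
    refine Finset.sum_congr rfl fun k hk => ?_
    have hk' : k ≤ r := Nat.lt_succ_iff.mp (Finset.mem_range.mp hk)
    have e : r + 1 - 1 - k = r - k := by omega
    rw [e, Nat.choose_symm hk', Nat.cast_sub hk']
    have : (-1 : ℝ) ^ r * (-1) ^ k = (-1) ^ (r - k) := by
      obtain ⟨j, rfl⟩ := Nat.exists_eq_add_of_le hk'
      rw [Nat.add_sub_cancel_left, pow_add, mul_right_comm, ← mul_pow]
      norm_num
    rw [← this]
    have e2 : 1 - (y + ((r : ℝ) - k) * u) = 1 - y - r * u + k * u := by ring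
    rw [e2]
    ring
  rw [this, abs_mul, abs_pow, abs_neg, abs_one, one_pow, one_mul]

theorem exists_antiderivative {n : ℕ} (p : ℝ[X]) (hp : p.natDegree ≤ n) :
    ∃ q : ℝ[X], q.natDegree ≤ n + 1 ∧ derivative q = p := by
  refine ⟨∑ i ∈ Finset.range (n + 1), C (p.coeff i / (i + 1)) * X ^ (i + 1), ?_, ?_⟩
  · refine natDegree_sum_le_of_forall_le _ _ fun i hi => ?_
    exact (natDegree_C_mul_X_pow_le _ _).trans (by have := Finset.mem_range.mp hi; omega)
  · rw [derivative_sum]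
    conv_rhs => rw [p.as_sum_range_C_mul_X_pow' (Nat.lt_succ_of_le hp)]
    refine Finset.sum_congr rfl fun i _ => ?_
    rw [derivative_C_mul_X_pow]
    congr 2
    push_cast
    field_simp

/-- A function with an `(s+1)`-st derivative bounded by `B` on `[0,b] ⊆ [0,1]` is within `B` of a
polynomial of degree at most `s`. -/
theorem exists_poly_of_deriv_chain {b B : ℝ} (hb0 : 0 ≤ b) (hb : b ≤ 1) (s : ℕ) (G : ℕ → ℝ → ℝ)
    (hG : ∀ i ≤ s, ∀ x, HasDerivAt (G i) (G (i + 1) x) x)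
    (hB : ∀ x ∈ Icc 0 b, |G (s + 1) x| ≤ B) :
    ∃ P : ℝ[X], P.natDegree ≤ s ∧ ∀ x ∈ Icc 0 b, |G 0 x - P.eval x| ≤ B := by
  have key : ∀ (Q : ℝ[X]) (F F' : ℝ → ℝ), (∀ x, HasDerivAt F (F' x) x) →
      (∀ x ∈ Icc 0 b, |F' x - (derivative Q).eval x| ≤ B) →
      ∀ x ∈ Icc 0 b, |F x - (Q + C (F 0 - Q.eval 0)).eval x| ≤ B := by
    intro Q F F' hF hF' x hx
    have h1 : ∀ y ∈ Icc (0 : ℝ) b, HasDerivWithinAt (fun z => F z - Q.eval z)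
        (F' y - (derivative Q).eval y) (Icc 0 b) y :=
      fun y _ => ((hF y).sub (Q.hasDerivAt y)).hasDerivWithinAt
    have h2 := (convex_Icc (0 : ℝ) b).norm_image_sub_le_of_norm_hasDerivWithin_le h1
      (C := B) (fun y hy => by rw [Real.norm_eq_abs]; exact hF' y hy) (left_mem_Icc.mpr hb0) hx
    rw [Real.norm_eq_abs, Real.norm_eq_abs, sub_zero, abs_of_nonneg hx.1] at h2
    have hB0 : 0 ≤ B := (abs_nonneg _).trans (hF' x hx)
    have e : F x - (Q + C (F 0 - Q.eval 0)).eval x = F x - Q.eval x - (F 0 - Q.eval 0) := by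
      simp; ring
    rw [e]
    exact h2.trans (mul_le_of_le_one_right hB0 (hx.2.trans hb))
  induction s generalizing G with
  | zero =>
    refine ⟨0 + C (G 0 0 - (0 : ℝ[X]).eval 0), by simp, ?_⟩
    exact key 0 (G 0) (G 1) (hG 0 le_rfl) (by simpa using hB)
  | succ s ih =>
    obtain ⟨P, hP, hPB⟩ := ih (fun i => G (i + 1)) (fun i hi => hG (i + 1) (by omega)) hB
    obtain ⟨Q, hQ, rfl⟩ := exists_antiderivative P hP
    refine ⟨Q + C (G 0 0 - Q.eval 0), ?_, key Q (G 0) (G 1) (hG 0 (Nat.zero_le _)) hPB⟩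
    exact (natDegree_add_le _ _).trans (by simp [hQ])

theorem whitney_left (s : ℕ) : ∃ K : ℝ, 1 ≤ K ∧ ∀ (f : ℝ → ℝ) (B : ℝ), Continuous f →
    (∀ y u, 0 < u → 0 ≤ y → y + ((s + 1 : ℕ) : ℝ) * u ≤ 1 → |altSum (s + 1) f y u| ≤ B) →
    ∃ P : ℝ[X], P.natDegree ≤ s ∧ ∀ y ∈ Icc (0 : ℝ) (3 / 4), |f y - P.eval y| ≤ K * B := by
  set r : ℕ := s + 1 with hr
  have hr0 : (0 : ℝ) < r := by rw [hr]; positivity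
  set h : ℝ := 1 / (4 * r ^ 2) with hh
  have hh0 : 0 < h := by positivity
  have hrh : (r : ℝ) * (r * h) = 1 / 4 := by rw [hh]; field_simp
  set a : ℕ → ℝ := fun k => (-1 : ℝ) ^ k * (r.choose k : ℝ) with ha
  set D : ℝ := ∑ k ∈ Finset.range r, |a (k + 1)| * ((((k + 1 : ℕ) : ℝ) * h)⁻¹) ^ r with hD
  have hD0 : 0 ≤ D := by positivity
  refine ⟨D + 1, by linarith, fun f B hf H => ?_⟩
  have hB0 : 0 ≤ B := (abs_nonneg _).trans (H 0 (1 / r) (by positivity) le_rfl (by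
    rw [zero_add, mul_one_div, div_self hr0.ne']))
  set G : ℕ → ℝ → ℝ := fun i x => ∑ k ∈ Finset.range r, (-a (k + 1)) *
    (((((k + 1 : ℕ) : ℝ) * h)⁻¹) ^ i *
      ((fwdDiff (((k + 1 : ℕ) : ℝ) * h))^[i] ((steklov (((k + 1 : ℕ) : ℝ) * h))^[r - i] f)) x) with hG
  have hderiv : ∀ i ≤ s, ∀ x, HasDerivAt (G i) (G (i + 1) x) x := by
    intro i hi x
    apply HasDerivAt.fun_sum
    intro k _
    apply HasDerivAt.const_mul
    set η : ℝ := ((k + 1 : ℕ) : ℝ) * h with hη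
    have hη0 : η ≠ 0 := by positivity
    obtain ⟨j, hj⟩ : ∃ j, r - i = j + 1 := ⟨r - i - 1, by omega⟩
    have hj' : r - (i + 1) = j := by omega
    rw [hj, hj']
    have h1 := fun x => hasDerivAt_steklov hη0 (continuous_steklov_iterate (h := η) hf j) x
    have h2 := hasDerivAt_fwdDiff_iter η h1 i x
    rw [← Function.iterate_succ_apply' (steklov η)] at h2
    have h3 := h2.const_mul (η⁻¹ ^ i)
    have e : (fwdDiff η)^[i] (fun x => η⁻¹ * ((steklov η)^[j] f (x + η) - (steklov η)^[j] f x)) x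
        = η⁻¹ * (fwdDiff η)^[i + 1] ((steklov η)^[j] f) x := by
      rw [Function.iterate_succ_apply]
      exact congrFun (fwdDiff_iter_const_smul η η⁻¹ (fwdDiff η ((steklov η)^[j] f)) i) x
    rw [e] at h3
    rw [pow_succ, mul_assoc]
    exact h3
  have hbound : ∀ x ∈ Icc (0 : ℝ) (3 / 4), |G (s + 1) x| ≤ D * B := by
    intro x hx
    rw [hD, Finset.sum_mul]
    refine (Finset.abs_sum_le_sum_abs _ _).trans (Finset.sum_le_sum fun k hk => ?_)
    have hk' : ((k + 1 : ℕ) : ℝ) ≤ r := by exact_mod_cast Finset.mem_range.mp hk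
    have hη0 : 0 < ((k + 1 : ℕ) : ℝ) * h := by positivity
    have hη1 : 0 ≤ (((k + 1 : ℕ) : ℝ) * h)⁻¹ ^ r := by positivity
    rw [← hr, abs_mul, abs_neg, abs_mul (_ ^ r), abs_of_nonneg hη1, mul_assoc, Nat.sub_self]
    refine mul_le_mul_of_nonneg_left (mul_le_mul_of_nonneg_left ?_ hη1) (abs_nonneg _)
    rw [Function.iterate_zero, id, abs_fwdDiff_iter]
    refine H x _ hη0 hx.1 ?_
    have : (r : ℝ) * (((k + 1 : ℕ) : ℝ) * h) ≤ r * (r * h) := by gcongr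
    linarith [hx.2]
  obtain ⟨P, hP, hPB⟩ := exists_poly_of_deriv_chain (by norm_num) (by norm_num) s G hderiv hbound
  refine ⟨P, hP, fun y hy => ?_⟩
  have hfG : |f y - G 0 y| ≤ B := by
    have := steklov_combination_bound (n := r + 1) hf a hh0.le y r 0 (B := B) ?_
    · convert this using 2
      rw [Finset.sum_range_succ']
      simp only [hG, ha]
      simp [Function.iterate_fixed (steklov_zero f)]
      rw [add_comm]
    · intro u hu
      rw [zero_add] at hu
      rcases hu.1.eq_or_lt with h0 | h0
      · rw [← h0]
        simp only [mul_zero, add_zero, ← Finset.sum_mul]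
        have : ∑ k ∈ Finset.range (r + 1), a k = 0 := by
          have := Int.alternating_sum_range_choose_of_ne (n := r) (by omega)
          have h' := congrArg (Int.cast : ℤ → ℝ) this
          push_cast at h'
          exact h'
        rw [this, zero_mul, abs_zero]
        exact hB0
      · refine H y u h0 hy.1 ?_
        have : (r : ℝ) * u ≤ r * (r * h) := by gcongr; exact hu.2
        linarith [hy.2]
  have h1 := abs_add_le (f y - G 0 y) (G 0 y - P.eval y)
  rw [sub_add_sub_cancel] at h1
  linarith [hPB y hy]

theorem whitney_unit (s : ℕ) : ∃ K : ℝ, 1 ≤ K ∧ ∀ (f : ℝ → ℝ) (B : ℝ), Continuous f →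
    (∀ y u, 0 < u → 0 ≤ y → y + ((s + 1 : ℕ) : ℝ) * u ≤ 1 → |altSum (s + 1) f y u| ≤ B) →
    ∃ P : ℝ[X], P.natDegree ≤ s ∧ ∀ y ∈ Icc (0 : ℝ) 1, |f y - P.eval y| ≤ K * B := by
  obtain ⟨K, hK, H⟩ := whitney_left s
  obtain ⟨D, hD, J⟩ := markov_growth s
  refine ⟨K + D * (2 * K) * 3 ^ s, by
    have : 0 ≤ D * (2 * K) * 3 ^ s := by positivity
    linarith, fun f B hf hB => ?_⟩
  have hB0 : 0 ≤ B := (abs_nonneg _).trans (hB 0 (1 / (s + 1 : ℕ)) (by positivity) le_rfl (by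
    rw [zero_add, mul_one_div, div_self (by positivity)]))
  obtain ⟨P, hP, hPB⟩ := H f B hf hB
  obtain ⟨Q, hQ, hQB⟩ := H (fun t => f (1 - t)) B (by fun_prop) (fun y u hu hy hyu => by
    rw [altSum_reflect]
    exact hB _ u hu (by linarith) (by linarith))
  set Q' := Q.comp (1 - X) with hQ'
  have hQ'deg : Q'.natDegree ≤ s := by
    refine natDegree_comp_le.trans ?_
    have : (1 - X : ℝ[X]).natDegree ≤ 1 := (natDegree_sub_le _ _).trans (by simp)
    calc _ ≤ s * 1 := Nat.mul_le_mul hQ this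
      _ = s := mul_one s
  have hQ'B : ∀ y ∈ Icc (1 / 4 : ℝ) 1, |f y - Q'.eval y| ≤ K * B := by
    intro y hy
    have := hQB (1 - y) ⟨by linarith [hy.2], by linarith [hy.1]⟩
    simpa [hQ'] using this
  refine ⟨P, hP, fun y hy => ?_⟩
  have hKB : 0 ≤ K * B := by positivity
  rcases le_total y (3 / 4) with h | h
  · refine (hPB y ⟨hy.1, h⟩).trans ?_
    have : 0 ≤ D * (2 * K) * 3 ^ s * B := by positivity
    nlinarith
  · have h1 := J (Q' - P) (1 / 4) (1 / 2) (2 * K * B)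
      ((natDegree_sub_le _ _).trans (max_le hQ'deg hP)) (by norm_num) (fun t ht => by
        have ha := hPB (1 / 4 + 1 / 2 * t) ⟨by linarith [ht.1], by linarith [ht.2]⟩
        have hb := hQ'B (1 / 4 + 1 / 2 * t) ⟨by linarith [ht.1], by linarith [ht.2]⟩
        rw [eval_sub]
        rw [abs_le] at ha hb ⊢
        constructor <;> linarith [ha.1, ha.2, hb.1, hb.2]) y
    have h2 : (1 + |y - 1 / 4| / |(1 / 2 : ℝ)|) ^ s ≤ 3 ^ s := by
      gcongr
      rw [abs_of_nonneg (by linarith), abs_of_nonneg (by norm_num)]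
      linarith [hy.2]
    have h3 := hQ'B y ⟨by linarith, hy.2⟩
    have h4 := abs_add_le (f y - Q'.eval y) ((Q' - P).eval y)
    rw [eval_sub, sub_add_sub_cancel, ← eval_sub] at h4
    calc _ ≤ K * B + D * (2 * K * B) * 3 ^ s := by
          refine h4.trans (add_le_add h3 (h1.trans ?_))
          gcongr
      _ = _ := by ring

/-- Whitney's theorem on an arbitrary interval. -/
theorem whitney (s : ℕ) : ∃ K : ℝ, 1 ≤ K ∧ ∀ (f : ℝ → ℝ) (a b B : ℝ), a < b →
    ContinuousOn f (Icc a b) →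
    (∀ y u, 0 < u → a ≤ y → y + ((s + 1 : ℕ) : ℝ) * u ≤ b → |altSum (s + 1) f y u| ≤ B) →
    ∃ P : ℝ[X], P.natDegree ≤ s ∧ ∀ y ∈ Icc a b, |f y - P.eval y| ≤ K * B := by
  obtain ⟨K, hK, H⟩ := whitney_unit s
  refine ⟨K, hK, fun f a b B hab hf hB => ?_⟩
  have hL : 0 < b - a := sub_pos.mpr hab
  have hmem : ∀ t ∈ Icc (0 : ℝ) 1, a + (b - a) * t ∈ Icc a b := fun t ht =>
    ⟨by nlinarith [ht.1], by nlinarith [ht.2]⟩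
  have hc : ContinuousOn (fun t => f (a + (b - a) * t)) (Icc 0 1) :=
    hf.comp (by fun_prop) hmem
  set F : ℝ → ℝ := IccExtend (zero_le_one (α := ℝ)) ((Icc (0 : ℝ) 1).domRestrict
    fun t => f (a + (b - a) * t)) with hF
  have hFc : Continuous F := (continuousOn_iff_continuous_domRestrict.mp hc).Icc_extend'
  have hFe : ∀ t ∈ Icc (0 : ℝ) 1, F t = f (a + (b - a) * t) := fun t ht => by
    rw [hF, IccExtend_of_mem _ _ ht]; rfl
  obtain ⟨P, hP, hPB⟩ := H F B hFc (fun y u hu hy hyu => by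
    have e : altSum (s + 1) F y u = altSum (s + 1) f (a + (b - a) * y) ((b - a) * u) := by
      unfold altSum
      refine Finset.sum_congr rfl fun k hk => ?_
      have hk' : (k : ℝ) ≤ ((s + 1 : ℕ) : ℝ) := by
        exact_mod_cast Nat.lt_succ_iff.mp (Finset.mem_range.mp hk)
      rw [hFe _ ⟨by positivity, (by gcongr : y + k * u ≤ y + ((s + 1 : ℕ) : ℝ) * u).trans hyu⟩]
      congr 2
      ring
    rw [e]
    refine hB _ _ (by positivity) (by nlinarith) ?_
    have := mul_le_mul_of_nonneg_left hyu hL.le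
    linarith)
  refine ⟨P.comp (C (b - a)⁻¹ * (X - C a)), ?_, fun y hy => ?_⟩
  · refine natDegree_comp_le.trans ?_
    have : (C (b - a)⁻¹ * (X - C a)).natDegree ≤ 1 :=
      (natDegree_C_mul_le _ _).trans (natDegree_X_sub_C a).le
    calc _ ≤ s * 1 := Nat.mul_le_mul hP this
      _ = s := mul_one s
  · have ht : (b - a)⁻¹ * (y - a) ∈ Icc (0 : ℝ) 1 := by
      refine ⟨mul_nonneg (by positivity) (by linarith [hy.1]), ?_⟩
      rw [inv_mul_le_one₀ hL]
      linarith [hy.2]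
    have := hPB _ ht
    rw [hFe _ ht] at this
    have e : a + (b - a) * ((b - a)⁻¹ * (y - a)) = y := by field_simp; ring
    rw [e] at this
    simpa using this

end Whitney

section Direct
open Polynomial

/-- The local scale `min (L, L²/c)`. -/
noncomputable def scale (c L : ℝ) : ℝ := min L (L ^ 2 / c)

theorem scale_nonneg {c L : ℝ} (hc : 0 < c) (hL : 0 ≤ L) : 0 ≤ scale c L :=
  le_min hL (by positivity)

theorem scale_le_left (c L : ℝ) : scale c L ≤ L := min_le_left _ _

theorem scale_le_right (c L : ℝ) : scale c L ≤ L ^ 2 / c := min_le_right _ _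

theorem scale_mono {c L L' : ℝ} (hc : 0 < c) (hL : 0 ≤ L) (h : L ≤ L') :
    scale c L ≤ scale c L' := by
  unfold scale
  gcongr

theorem scale_pow_mul_le {c L : ℝ} (hc : 0 < c) (hL : 0 < L) (hL1 : L ≤ 1) {j l : ℕ} (hl : 1 ≤ l)
    (hj : j ≤ l) : scale c L ^ l * c ≤ L * L ^ j := by
  obtain ⟨k, rfl⟩ := Nat.exists_eq_add_of_le' hl
  have h0 := scale_nonneg hc hL.le
  calc scale c L ^ (k + 1) * c = scale c L ^ k * (scale c L * c) := by ring
    _ ≤ L ^ k * (L ^ 2 / c * c) := by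
        gcongr
        · exact scale_le_left c L
        · exact scale_le_right c L
    _ = L * L ^ (k + 1) := by field_simp; ring
    _ ≤ L * L ^ j := by
        gcongr ?_ * ?_
        exact pow_le_pow_of_le_one hL.le hL1 hj

theorem scale_pow_mul_pow_le {c L : ℝ} (hc : 0 < c) (hL : 0 < L) {j l : ℕ}
    (hj : l < j) (hj2 : j < 2 * l) : scale c L ^ l * c ^ (j - l) ≤
      L ^ j * (6 * (L / (L + c) - (L / 2) / (L / 2 + c))) := by
  obtain ⟨e, rfl⟩ := Nat.exists_eq_add_of_lt hj
  obtain ⟨g, rfl⟩ : ∃ g, l = e + g + 2 := ⟨l - e - 2, by omega⟩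
  have e1 : e + g + 2 + e + 1 - (e + g + 2) = e + 1 := by omega
  rw [e1]
  have h0 := scale_nonneg hc hL.le
  have key : L / (L + c) - (L / 2) / (L / 2 + c) = c * L / ((L + c) * (L + 2 * c)) := by
    field_simp
    ring
  rw [key]
  rcases le_total L c with h | h
  · have h1 : L / c ≤ 1 := (div_le_one hc).mpr h
    calc scale c L ^ (e + g + 2) * c ^ (e + 1) ≤ (L ^ 2 / c) ^ (e + g + 2) * c ^ (e + 1) := by
          gcongr
          exact scale_le_right c L
      _ = L ^ (e + g + 2 + e + 1) * ((L / c) * (L / c) ^ g) := by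
          rw [div_pow, div_pow]
          field_simp
          ring
      _ ≤ L ^ (e + g + 2 + e + 1) * (L / c * 1) := by
          gcongr
          exact pow_le_one₀ (by positivity) h1
      _ ≤ _ := by
          rw [mul_one]
          gcongr L ^ (e + g + 2 + e + 1) * ?_
          rw [← mul_div_assoc, div_le_div_iff₀ hc (by positivity)]
          have : (L + c) * (L + 2 * c) ≤ 6 * c ^ 2 := by nlinarith
          calc L * ((L + c) * (L + 2 * c)) ≤ L * (6 * c ^ 2) := by gcongr
            _ = _ := by ring
  · have h1 : c / L ≤ 1 := (div_le_one hL).mpr h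
    calc scale c L ^ (e + g + 2) * c ^ (e + 1) ≤ L ^ (e + g + 2) * c ^ (e + 1) := by
          gcongr
          exact scale_le_left c L
      _ = L ^ (e + g + 2 + e + 1) * ((c / L) * (c / L) ^ e) := by
          rw [div_pow]
          field_simp
          ring
      _ ≤ L ^ (e + g + 2 + e + 1) * (c / L * 1) := by
          gcongr
          exact pow_le_one₀ (by positivity) h1
      _ ≤ _ := by
          rw [mul_one]
          gcongr L ^ (e + g + 2 + e + 1) * ?_
          rw [← mul_div_assoc, div_le_div_iff₀ hL (by positivity)]
          have : (L + c) * (L + 2 * c) ≤ 6 * L ^ 2 := by nlinarith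
          calc c * ((L + c) * (L + 2 * c)) ≤ c * (6 * L ^ 2) := by gcongr
            _ = _ := by ring

/-- Telescoping: increments controlled by decrements of a potential. -/
theorem le_of_increments {a ψ : ℕ → ℝ} {A B : ℝ} {i k : ℕ} (hik : i ≤ k) (h0 : |a i| ≤ A)
    (h : ∀ n, i ≤ n → n < k → |a (n + 1) - a n| ≤ B * (ψ n - ψ (n + 1))) :
    |a k| ≤ A + B * (ψ i - ψ k) := by
  induction k, hik using Nat.le_induction with
  | base => simpa using h0
  | succ k hik ih =>
    have h1 := ih fun n hn hnk => h n hn (by omega)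
    have h2 := h k hik (by omega)
    have h3 := abs_add_le (a (k + 1) - a k) (a k)
    rw [sub_add_cancel] at h3
    linarith

/-- Whitney polynomials on a dyadic family of intervals about `c` produce a polynomial that is close
to `f` at the scale `ρ` and has controlled Taylor coefficients. -/
theorem exists_local_poly (l : ℕ) (hl : 1 ≤ l) : ∃ K : ℝ, 1 ≤ K ∧
    ∀ (f : ℝ → ℝ) (c ρ κ : ℝ), 0 < c → c ≤ 1 / 2 → 0 < ρ → ρ ≤ 1 →
    ContinuousOn f (Icc 0 1) → (∀ y ∈ Icc (0 : ℝ) 1, |f y| ≤ κ) →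
    (∀ L y u, ρ ≤ L → L ≤ 1 → 0 < u → max 0 (c - L) ≤ y → y + ((2 * l : ℕ) : ℝ) * u ≤ min 1 (c + L) →
      |altSum (2 * l) f y u| ≤ κ * scale c L ^ l) →
    ∃ P : ℝ[X], P.natDegree ≤ 2 * l ∧ (∀ j ≤ l, |(taylor c P).coeff j| * c ≤ K * κ) ∧
      (∀ j, l < j → |(taylor c P).coeff j| * c ^ j ≤ K * κ * c ^ l) ∧
      ∀ y ∈ Icc (0 : ℝ) 1, |f y - P.eval y| ≤ K * κ / c ^ l * (ρ + |y - c|) ^ (2 * l) := by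
  obtain ⟨s, hs⟩ : ∃ s, 2 * l = s + 1 := ⟨2 * l - 1, by omega⟩
  obtain ⟨K₁, hK₁, W⟩ := whitney s
  obtain ⟨K₂, hK₂, M⟩ := markov_coeff s
  set A : ℝ := 2 ^ s * (2 * (K₂ * K₁)) with hA
  have hA1 : K₂ * K₁ ≤ A := by
    have : (1 : ℝ) ≤ 2 ^ s := one_le_pow₀ (by norm_num)
    have : 0 ≤ K₂ * K₁ := by positivity
    rw [hA]; nlinarith
  have hA0 : 1 ≤ A := (one_le_mul_of_one_le_of_one_le hK₂ hK₁).trans hA1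
  have hK₁A : K₁ ≤ A := by nlinarith
  set K : ℝ := (A + (s + 1) * A * 2) * 2 ^ (2 * l) + 8 * A with hK
  have hp2 : (1 : ℝ) ≤ 2 ^ (2 * l) := one_le_pow₀ (by norm_num)
  have hs0 : (0 : ℝ) ≤ s := Nat.cast_nonneg s
  have hKA : 8 * A ≤ K := by
    have : 0 ≤ (A + (s + 1) * A * 2) * 2 ^ (2 * l) := by positivity
    linarith
  have hKG : (A + (s + 1) * A * 2) * 2 ^ (2 * l) ≤ K := by linarith
  refine ⟨K, by linarith, ?_⟩
  intro f c ρ κ hc hc2 hρ hρ1 hf hfκ hmod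
  have hκ : 0 ≤ κ := (abs_nonneg _).trans (hfκ 0 (by simp))
  set L : ℕ → ℝ := fun i => (1 / 2) ^ i with hLdef
  have hL0 : ∀ i, 0 < L i := fun i => by simp only [hLdef]; positivity
  have hL1 : ∀ i, L i ≤ 1 := fun i => pow_le_one₀ (by norm_num) (by norm_num)
  have hLs : ∀ i, L (i + 1) = L i / 2 := fun i => by simp only [hLdef]; rw [pow_succ]; ring
  have hLanti : ∀ {i k}, i ≤ k → L k ≤ L i := fun h =>
    pow_le_pow_of_le_one (by norm_num) (by norm_num) h
  have hex : ∀ i, ∃ P : ℝ[X], P.natDegree ≤ s ∧ (ρ ≤ L i → ∀ y ∈ Icc (0 : ℝ) 1, |y - c| ≤ L i →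
      |f y - P.eval y| ≤ K₁ * (κ * scale c (L i) ^ l)) := by
    intro i
    by_cases hi : ρ ≤ L i
    · have hab : max 0 (c - L i) < min 1 (c + L i) := by
        rw [max_lt_iff, lt_min_iff, lt_min_iff]
        have := hL0 i
        exact ⟨⟨by norm_num, by linarith⟩, by linarith, by linarith⟩
      obtain ⟨P, hP, hPB⟩ := W f _ _ (κ * scale c (L i) ^ l) hab
        (hf.mono (Icc_subset_Icc (le_max_left _ _) (min_le_left _ _)))
        (fun y u hu hy hyu => by
          rw [← hs]
          rw [← hs] at hyu
          exact hmod (L i) y u hi (hL1 i) hu hy hyu)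
      refine ⟨P, hP, fun _ y hy hyc => hPB y ?_⟩
      rw [abs_le] at hyc
      exact ⟨max_le hy.1 (by linarith [hyc.1]), le_min hy.2 (by linarith [hyc.2])⟩
    · exact ⟨0, by simp, fun h => absurd h hi⟩
  choose P hPdeg hPB using hex
  have hb0 : ∀ i, 0 ≤ scale c (L i) ^ l := fun i => pow_nonneg (scale_nonneg hc (hL0 i).le) l
  have hinc : ∀ i, ρ ≤ L (i + 1) → ∀ j, j ≤ s →
      |(taylor c (P (i + 1))).coeff j - (taylor c (P i)).coeff j| * L i ^ j
        ≤ A * κ * scale c (L i) ^ l := by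
    intro i hi j hj
    have hi' : ρ ≤ L i := hi.trans (hLanti (Nat.le_succ i))
    have h1 := M (P (i + 1) - P i) c (L (i + 1)) (2 * (K₁ * (κ * scale c (L i) ^ l)))
      ((natDegree_sub_le _ _).trans (max_le (hPdeg _) (hPdeg _))) (fun t ht => by
        have h0 := hL0 (i + 1)
        have hLi := hL1 i
        have hh := hLs i
        have h2 : 0 ≤ L (i + 1) * t := mul_nonneg h0.le ht.1
        have h3 : L (i + 1) * t ≤ L (i + 1) := mul_le_of_le_one_right h0.le ht.2
        have hy : c + L (i + 1) * t ∈ Icc (0 : ℝ) 1 := ⟨by linarith, by linarith⟩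
        have hd : |c + L (i + 1) * t - c| ≤ L (i + 1) := by
          rw [add_sub_cancel_left, abs_of_nonneg h2]; exact h3
        have ha := hPB (i + 1) hi _ hy hd
        have hb := hPB i hi' _ hy (hd.trans (hLanti (Nat.le_succ i)))
        have hm : K₁ * (κ * scale c (L (i + 1)) ^ l) ≤ K₁ * (κ * scale c (L i) ^ l) := by
          gcongr
          · exact scale_nonneg hc h0.le
          · exact scale_mono hc h0.le (hLanti (Nat.le_succ i))
        rw [eval_sub]
        rw [abs_le] at ha hb ⊢
        constructor <;> linarith [ha.1, ha.2, hb.1, hb.2]) j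
    rw [map_sub, coeff_sub, abs_of_pos (hL0 (i + 1)), hLs] at h1
    calc _ = |(taylor c (P (i + 1))).coeff j - (taylor c (P i)).coeff j| * (L i / 2) ^ j * 2 ^ j := by
          rw [div_pow]; field_simp
      _ ≤ K₂ * (2 * (K₁ * (κ * scale c (L i) ^ l))) * 2 ^ s := by
          have := hb0 i
          gcongr
          norm_num
      _ = _ := by rw [hA]; ring
  have hcoef0 : ∀ j, j ≤ s → |(taylor c (P 0)).coeff j| ≤ 2 * A * κ := by
    intro j hj
    have hL00 : L 0 = 1 := by simp [hLdef]
    have h1 := M (P 0) c (1 / 2) (2 * (K₁ * κ)) (hPdeg 0) (fun t ht => by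
        have hy : c + 1 / 2 * t ∈ Icc (0 : ℝ) 1 := ⟨by linarith [ht.1], by linarith [ht.2]⟩
        have ha := hPB 0 (by rw [hL00]; exact hρ1) _ hy (by
          rw [hL00, add_sub_cancel_left, abs_of_nonneg (by linarith [ht.1])]; linarith [ht.2])
        have hb := hfκ _ hy
        have hm : K₁ * (κ * scale c (L 0) ^ l) ≤ K₁ * (κ * 1) := by
          gcongr
          exact pow_le_one₀ (scale_nonneg hc (hL0 0).le) ((scale_le_left _ _).trans (hL1 0))
        have hκK : κ ≤ K₁ * κ := by nlinarith
        rw [mul_one] at hm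
        replace ha := ha.trans hm
        rw [abs_le] at ha hb ⊢
        constructor <;> linarith [ha.1, ha.2, hb.1, hb.2]) j
    rw [abs_of_pos (by norm_num : (0 : ℝ) < 1 / 2)] at h1
    calc _ = |(taylor c (P 0)).coeff j| * (1 / 2) ^ j * 2 ^ j := by
          rw [mul_assoc, ← mul_pow]; norm_num
      _ ≤ K₂ * (2 * (K₁ * κ)) * 2 ^ s := by
          gcongr
          norm_num
      _ = A * κ := by rw [hA]; ring
      _ ≤ _ := by nlinarith [mul_nonneg (zero_le_one.trans hA0) hκ]
  obtain ⟨N, hN1, hN2⟩ := exists_nat_pow_near_of_lt_one hρ hρ1 (y := (1 / 2 : ℝ)) (by norm_num)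
    (by norm_num)
  have hNρ : ρ ≤ L N := hN2
  have hle : ∀ {n}, n < N → ρ ≤ L (n + 1) := fun h => hNρ.trans (hLanti h)
  have hAκ : 0 ≤ A * κ := by positivity
  refine ⟨P N, (hPdeg N).trans (by omega), ?_, ?_, ?_⟩
  · intro j hj
    have hjs : j ≤ s := by omega
    have h1 := le_of_increments (a := fun n => (taylor c (P n)).coeff j * c) (ψ := L)
      (A := 2 * A * κ) (B := 2 * (A * κ)) (Nat.zero_le N) (by
        rw [abs_mul, abs_of_pos hc]
        exact (mul_le_of_le_one_right (abs_nonneg _) (by linarith)).trans (hcoef0 j hjs))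
      (fun n _ hn => by
        have hLn := hL0 n
        have h2 := hinc n (hle hn) j hjs
        have h3 := scale_pow_mul_le hc (hL0 n) (hL1 n) hl hj
        rw [← sub_mul, abs_mul, abs_of_pos hc, hLs]
        have h4 : 0 < L n ^ j := pow_pos (hL0 n) j
        refine le_of_mul_le_mul_right ?_ h4
        calc _ = |(taylor c (P (n + 1))).coeff j - (taylor c (P n)).coeff j| * L n ^ j * c := by ring
          _ ≤ A * κ * scale c (L n) ^ l * c := by gcongr
          _ = A * κ * (scale c (L n) ^ l * c) := by ring
          _ ≤ A * κ * (L n * L n ^ j) := by gcongr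
          _ = _ := by ring)
    rw [abs_mul, abs_of_pos hc] at h1
    have h5 : 2 * (A * κ) * (L 0 - L N) ≤ 2 * (A * κ) * 1 := by
      gcongr
      linarith [hL1 0, hL0 N]
    have h6 : 8 * A * κ ≤ K * κ := by gcongr
    linarith
  · intro j hj
    have hcoef : |(taylor c (P N)).coeff j| * c ^ (j - l) ≤ K * κ := by
      rcases le_or_gt j s with hjs | hjs
      · have hcj : c ^ (j - l) ≤ 1 := pow_le_one₀ hc.le (by linarith)
        have hcj0 : 0 < c ^ (j - l) := pow_pos hc _
        have h1 := le_of_increments (a := fun n => (taylor c (P n)).coeff j * c ^ (j - l))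
          (ψ := fun n => L n / (L n + c))
          (A := 2 * A * κ) (B := 6 * (A * κ)) (Nat.zero_le N) (by
            rw [abs_mul, abs_of_pos hcj0]
            exact (mul_le_of_le_one_right (abs_nonneg _) hcj).trans (hcoef0 j hjs))
          (fun n _ hn => by
            have hLn := hL0 n
            have h2 := hinc n (hle hn) j hjs
            have h3 := scale_pow_mul_pow_le hc (hL0 n) hj (by omega : j < 2 * l)
            rw [← sub_mul, abs_mul, abs_of_pos hcj0]
            simp only [hLs]
            have h4 : 0 < L n ^ j := pow_pos (hL0 n) j
            refine le_of_mul_le_mul_right ?_ h4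
            calc _ = |(taylor c (P (n + 1))).coeff j - (taylor c (P n)).coeff j| * L n ^ j
                  * c ^ (j - l) := by ring
              _ ≤ A * κ * scale c (L n) ^ l * c ^ (j - l) := by gcongr
              _ = A * κ * (scale c (L n) ^ l * c ^ (j - l)) := by ring
              _ ≤ A * κ * (L n ^ j * (6 * (L n / (L n + c) - L n / 2 / (L n / 2 + c)))) := by gcongr
              _ = _ := by ring)
        rw [abs_mul, abs_of_pos hcj0] at h1
        have h5 : 6 * (A * κ) * (L 0 / (L 0 + c) - L N / (L N + c)) ≤ 6 * (A * κ) * 1 := by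
          have := hL0 0
          have := hL0 N
          have h7 : L 0 / (L 0 + c) ≤ 1 := (div_le_one (by positivity)).mpr (by linarith)
          have h8 : 0 ≤ L N / (L N + c) := by positivity
          gcongr
          linarith
        have h6 : 8 * A * κ ≤ K * κ := by gcongr
        linarith
      · rw [coeff_eq_zero_of_natDegree_lt (by rw [natDegree_taylor]; exact (hPdeg N).trans_lt hjs)]
        rw [abs_zero, zero_mul]
        positivity
    calc _ = |(taylor c (P N)).coeff j| * c ^ (j - l) * c ^ l := by
          rw [mul_assoc, ← pow_add, Nat.sub_add_cancel hj.le]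
      _ ≤ _ := by gcongr
  · intro y hy
    set d := |y - c| with hd
    have hd1 : d ≤ 1 := by
      rw [hd, abs_le]; exact ⟨by linarith [hy.1], by linarith [hy.2]⟩
    obtain ⟨i, hi1, hi2⟩ := exists_nat_pow_near_of_lt_one (x := max ρ d) (lt_max_of_lt_left hρ)
      (max_le hρ1 hd1) (y := (1 / 2 : ℝ)) (by norm_num) (by norm_num)
    have hρi : ρ ≤ L i := (le_max_left _ _).trans hi2
    have hdi : d ≤ L i := (le_max_right _ _).trans hi2
    have hLi : L i ≤ 2 * (ρ + d) := by
      have h1 : L (i + 1) < max ρ d := hi1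
      rw [hLs] at h1
      have : max ρ d ≤ ρ + d := max_le (by linarith [abs_nonneg (y - c)]) (by linarith)
      linarith
    have hiN : i ≤ N := by
      by_contra h
      have h1 : L i ≤ L (N + 1) := hLanti (by omega)
      have h2 : L (N + 1) < ρ := hN1
      linarith
    have hLi0 := hL0 i
    have hb : ∀ n, scale c (L n) ^ l ≤ L n ^ (2 * l) / c ^ l := fun n => by
      rw [pow_mul, ← div_pow]
      exact pow_le_pow_left₀ (scale_nonneg hc (hL0 n).le) (scale_le_right _ _) l
    have h1 := le_of_increments (a := fun n => f y - (P n).eval y) (ψ := L)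
      (A := A * κ * (L i ^ (2 * l) / c ^ l))
      (B := (s + 1) * A * κ * (L i ^ s / c ^ l) * 2) hiN (by
        refine (hPB i hρi y hy hdi).trans ?_
        rw [← mul_assoc]
        exact mul_le_mul (mul_le_mul_of_nonneg_right hK₁A hκ) (hb i) (hb0 i) hAκ)
      (fun n hin hn => by
        have hLn := hL0 n
        have e1 : f y - (P (n + 1)).eval y - (f y - (P n).eval y) = -((P (n + 1) - P n).eval y) := by
          rw [eval_sub]; ring
        rw [e1, abs_neg, eval_eq_sum_taylor ((natDegree_sub_le _ _).trans
          (max_le (hPdeg (n + 1)) (hPdeg n))) c y, hLs]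
        refine (Finset.abs_sum_le_sum_abs _ _).trans ?_
        have e2 : ∀ j ∈ Finset.range (s + 1),
            |(taylor c (P (n + 1) - P n)).coeff j * (y - c) ^ j|
              ≤ A * κ * (L i ^ s / c ^ l) * L n := by
          intro j hj
          have hjs : j ≤ s := Nat.lt_succ_iff.mp (Finset.mem_range.mp hj)
          have h2 := hinc n (hle hn) j hjs
          rw [map_sub, coeff_sub, abs_mul, abs_pow, ← hd]
          have hr : 1 ≤ L i / L n := (one_le_div hLn).mpr (hLanti hin)
          calc _ = |(taylor c (P (n + 1))).coeff j - (taylor c (P n)).coeff j| * L n ^ j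
                * (d / L n) ^ j := by rw [div_pow]; field_simp
            _ ≤ A * κ * scale c (L n) ^ l * (L i / L n) ^ j := by
                have := hb0 n
                gcongr
            _ ≤ A * κ * (L n ^ (2 * l) / c ^ l) * (L i / L n) ^ s := by
                gcongr
                exact hb n
            _ = _ := by
                rw [hs, div_pow, pow_succ]
                field_simp
        refine (Finset.sum_le_card_nsmul _ _ _ e2).trans (le_of_eq ?_)
        rw [Finset.card_range, nsmul_eq_mul]
        push_cast
        ring)
    have hLN := hL0 N
    calc _ ≤ A * κ * (L i ^ (2 * l) / c ^ l) + (s + 1) * A * κ * (L i ^ s / c ^ l) * 2 * (L i - L N) := h1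
      _ ≤ A * κ * (L i ^ (2 * l) / c ^ l) + (s + 1) * A * κ * (L i ^ s / c ^ l) * 2 * L i := by
          gcongr
          linarith
      _ = (A + (s + 1) * A * 2) * κ / c ^ l * L i ^ (2 * l) := by
          rw [hs, pow_succ]
          ring
      _ ≤ (A + (s + 1) * A * 2) * κ / c ^ l * (2 * (ρ + d)) ^ (2 * l) := by gcongr
      _ = ((A + (s + 1) * A * 2) * 2 ^ (2 * l)) * κ / c ^ l * (ρ + d) ^ (2 * l) := by
          rw [mul_pow]; ring
      _ ≤ _ := by gcongr

end Direct

section DirectEstimate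
open Polynomial

/-- The weighted smoothness condition expressed through arithmetic progressions. -/
def ModHyp (l : ℕ) (lam C : ℝ) (f : ℝ → ℝ) : Prop :=
  ∀ y u h : ℝ, 0 < u → 0 ≤ y → y + ((2 * l : ℕ) : ℝ) * u ≤ 1 → 0 < h →
    h ^ 2 * ((y + l * u) * (1 - (y + l * u))) = u ^ 2 → |altSum (2 * l) f y u| ≤ C * h ^ lam

theorem modHyp_reflect {l : ℕ} {lam C : ℝ} {f : ℝ → ℝ} (H : ModHyp l lam C f) :
    ModHyp l lam C (fun t => f (1 - t)) := by
  intro y u h hu hy hyu hh heq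
  rw [altSum_reflect]
  push_cast at hyu
  refine H _ u h hu (by push_cast; linarith) (by push_cast; linarith) hh ?_
  rw [← heq]
  push_cast
  ring

theorem sq_le_of_progression {l : ℕ} (hl : 1 ≤ l) {y u h : ℝ} (hu : 0 < u) (hy : 0 ≤ y)
    (hyu : y + 2 * l * u ≤ 1) (heq : h ^ 2 * ((y + l * u) * (1 - (y + l * u))) = u ^ 2) :
    h ^ 2 * l ≤ 2 * u := by
  have hl' : (1 : ℝ) ≤ l := by exact_mod_cast hl
  have hlu : u ≤ l * u := by nlinarith
  have h1 : l * u / 2 ≤ (y + l * u) * (1 - (y + l * u)) := by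
    rcases le_total (y + l * u) (1 / 2) with h | h <;> nlinarith
  have h2 : h ^ 2 * (l * u / 2) ≤ u ^ 2 := by
    rw [← heq]; gcongr
  have h3 : h ^ 2 * l * u ≤ 2 * u * u := by nlinarith
  exact le_of_mul_le_mul_right h3 hu

theorem sq_le_scale {l : ℕ} (hl : 1 ≤ l) {y u h c L : ℝ} (hc : 0 < c) (hc2 : c ≤ 1 / 2)
    (hL : 0 < L) (hu : 0 < u) (hy : 0 ≤ y) (hyu : y + 2 * l * u ≤ 1) (hyc : c - L ≤ y)
    (hyuc : y + 2 * l * u ≤ c + L)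
    (heq : h ^ 2 * ((y + l * u) * (1 - (y + l * u))) = u ^ 2) : h ^ 2 ≤ 8 * scale c L := by
  have hl' : (1 : ℝ) ≤ l := by exact_mod_cast hl
  have hlu : u ≤ l * u := by nlinarith
  have huL : u ≤ L := by nlinarith
  have h1 : h ^ 2 ≤ 2 * L := by
    have := sq_le_of_progression hl hu hy hyu heq
    nlinarith [sq_nonneg h]
  have h2 : h ^ 2 ≤ 8 * (L ^ 2 / c) := by
    rw [← mul_div_assoc, le_div_iff₀ hc]
    rcases le_total (c / 2) L with hcL | hcL
    · nlinarith [sq_nonneg h]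
    · have h3 : c / 8 ≤ (y + l * u) * (1 - (y + l * u)) := by nlinarith
      have h4 := mul_le_mul_of_nonneg_left h3 (sq_nonneg h)
      have h5 : u ^ 2 ≤ L ^ 2 := by gcongr
      linarith
  rw [scale, mul_min_of_nonneg _ _ (by norm_num)]
  exact le_min (by linarith) h2

theorem rpow_le_scale {l : ℕ} {lam h w m : ℝ} (hlam : 0 < lam) (hlam2 : lam ≤ 2 * l) (hm : 0 < m)
    (hh : 0 < h) (hw : 1 / m ≤ w) (hhw : h ^ 2 ≤ 8 * w) :
    h ^ lam ≤ 8 ^ l * m ^ ((l : ℝ) - lam / 2) * w ^ l := by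
  have hw0 : 0 < w := lt_of_lt_of_le (by positivity) hw
  calc h ^ lam = (h ^ 2) ^ (lam / 2) := by
        rw [← Real.rpow_natCast, ← Real.rpow_mul hh.le]; congr 1; push_cast; ring
    _ ≤ (8 * w) ^ (lam / 2) := by gcongr
    _ = 8 ^ (lam / 2) * (w ^ (lam / 2 - l) * w ^ l) := by
        rw [Real.mul_rpow (by norm_num) hw0.le, ← Real.rpow_natCast w, ← Real.rpow_add hw0]
        congr 2
        ring
    _ ≤ 8 ^ (l : ℝ) * ((1 / m) ^ (lam / 2 - l) * w ^ l) := by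
        gcongr ?_ * (?_ * w ^ l)
        · exact Real.rpow_le_rpow_of_exponent_le (by norm_num) (by linarith)
        · exact Real.rpow_le_rpow_of_nonpos (by positivity) hw (by linarith)
    _ = _ := by
        rw [Real.rpow_natCast, one_div, Real.inv_rpow hm.le, ← Real.rpow_neg hm.le, neg_sub]
        ring

theorem direct_half (l : ℕ) (hl : 1 ≤ l) : ∃ K : ℝ, 1 ≤ K ∧ ∀ (f : ℝ → ℝ) (lam C M : ℝ) (m : ℕ) (x : ℝ),
    0 < lam → lam ≤ 2 * l → 0 ≤ C → ContinuousOn f (Icc 0 1) → (∀ y ∈ Icc (0 : ℝ) 1, |f y| ≤ M) →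
    ModHyp l lam C f → 2 ≤ m → 0 ≤ x → x ≤ 1 / 2 →
    |((TopL m) ^ l) f x| ≤ K * (C + M) * (m : ℝ) ^ (-(lam / 2)) := by
  obtain ⟨K₁, hK₁, E⟩ := exists_local_poly l hl
  obtain ⟨K₂, hK₂, T⟩ := TP_pow_local (2 * l) l hl
  obtain ⟨K₃, hK₃, R⟩ := cone_TopL_pow (2 * l) l
  have h8 : (1 : ℝ) ≤ 8 ^ l := one_le_pow₀ (by norm_num)
  have h4 : (1 : ℝ) ≤ 2 ^ (2 * l) := one_le_pow₀ (by norm_num)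
  refine ⟨(K₂ * K₁ + K₃ * K₁ * 2 ^ (2 * l)) * 8 ^ l, ?_, ?_⟩
  · have h1 := one_le_mul_of_one_le_of_one_le hK₂ hK₁
    have h2 : 0 ≤ K₃ * K₁ * 2 ^ (2 * l) := by positivity
    exact one_le_mul_of_one_le_of_one_le (by linarith) h8
  intro f lam C M m x hlam hlam2 hC hf hM hmod hm hx hx2
  have hm0 : (0 : ℝ) < m := by positivity
  have hm2 : (2 : ℝ) ≤ m := by exact_mod_cast hm
  have hM0 : 0 ≤ M := (abs_nonneg _).trans (hM 0 (by simp))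
  set H : ℝ := (m : ℝ) ^ ((l : ℝ) - lam / 2) with hH
  have hH1 : 1 ≤ H := Real.one_le_rpow (by linarith) (by linarith)
  set κ : ℝ := 8 ^ l * (C + M) * H with hκ
  have hκ0 : 0 ≤ κ := by positivity
  set c : ℝ := max x (1 / m) with hcdef
  have hmc : 1 / (m : ℝ) ≤ c := le_max_right _ _
  have hmc0 : 0 < 1 / (m : ℝ) := by positivity
  have hc0 : 0 < c := hmc0.trans_le hmc
  have hxc : x ≤ c := le_max_left _ _
  have hc2 : c ≤ 1 / 2 := max_le hx2 (by gcongr)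
  set s : ℝ := Real.sqrt c with hs
  have hs0 : 0 < s := Real.sqrt_pos.mpr hc0
  have hs2 : s ^ 2 = c := Real.sq_sqrt hc0.le
  set μ : ℝ := Real.sqrt (1 / m) with hμ
  have hμ0 : 0 < μ := Real.sqrt_pos.mpr hmc0
  have hμ2 : μ ^ 2 = 1 / m := Real.sq_sqrt hmc0.le
  have hμs : μ ≤ s := Real.sqrt_le_sqrt hmc
  have hs1 : s ≤ 1 := by nlinarith
  set ρ : ℝ := s * μ with hρ
  have hρ0 : 0 < ρ := by positivity
  have hρm : 1 / m ≤ ρ := by rw [← hμ2, hρ, sq]; gcongr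
  have hρ2 : ρ ^ 2 = c / m := by rw [hρ, mul_pow, hs2, hμ2, mul_one_div]
  have hρ1 : ρ ≤ 1 := by nlinarith
  obtain ⟨P, hPdeg, hP1, hP2, hP3⟩ := E f c ρ κ hc0 hc2 hρ0 hρ1 hf
    (fun y hy => (hM y hy).trans (by
      have : M ≤ C + M := by linarith
      rw [hκ]
      calc M ≤ 1 * (C + M) * 1 := by linarith
        _ ≤ _ := by gcongr)) (fun L y u hρL hL1 hu hy hyu => by
      have hL0 := hρ0.trans_le hρL
      have hy0 : 0 ≤ y := (le_max_left _ _).trans hy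
      have hyu1 := hyu.trans (min_le_left _ _)
      have hlu : 0 < (l : ℝ) * u := by positivity
      push_cast at hyu1
      have hv : 0 < (y + l * u) * (1 - (y + l * u)) := mul_pos (by linarith) (by linarith)
      set h : ℝ := u / Real.sqrt ((y + l * u) * (1 - (y + l * u))) with hh
      have hsv := Real.sqrt_pos.mpr hv
      have hh0 : 0 < h := by positivity
      have heq : h ^ 2 * ((y + l * u) * (1 - (y + l * u))) = u ^ 2 := by
        rw [hh, div_pow, Real.sq_sqrt hv.le, div_mul_cancel₀ _ hv.ne']
      have hb := hmod y u h hu hy0 (hyu.trans (min_le_left _ _)) hh0 heq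
      have hsc := sq_le_scale hl hc0 hc2 hL0 hu hy0 hyu1 ((le_max_right _ _).trans hy)
        (by have := hyu.trans (min_le_right _ _); push_cast at this; exact this) heq
      have hw : 1 / (m : ℝ) ≤ scale c L := le_min (hρm.trans hρL) (by
        rw [le_div_iff₀ hc0]
        calc 1 / (m : ℝ) * c = ρ ^ 2 := by rw [hρ2]; ring
          _ ≤ L ^ 2 := by gcongr)
      have hr := rpow_le_scale hlam hlam2 hm0 hh0 hw hsc
      have hw0 := scale_nonneg hc0 hL0.le
      calc _ ≤ C * (8 ^ l * H * scale c L ^ l) := hb.trans (by gcongr)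
        _ = 8 ^ l * C * H * scale c L ^ l := by ring
        _ ≤ _ := by rw [hκ]; gcongr; linarith)
  have hxI : x ∈ Icc (0 : ℝ) 1 := ⟨hx, by linarith⟩
  have h1 := T P m c s μ (K₁ * κ) x hPdeg (by omega) hs0 hs2.symm hc2 hμ0
    (by rw [hμ2]; field_simp) hμs hx hxc (by positivity) hP1 hP2
  have hW : WeightOK m c ρ := by
    refine ⟨by omega, ⟨hc0.le, by linarith⟩, hρ0, ?_, ?_⟩
    · rw [hρ2, mul_div_cancel₀ _ hm0.ne']
      nlinarith
    · rw [div_le_iff₀ hm0] at hρm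
      linarith
  have h2 := R m c ρ (K₁ * κ / c ^ l) (fun y => f y - P.eval y) hW hP3 x hxI
  have e1 : ((TopL m) ^ l) f x
      = ((TopL m) ^ l) (fun y => f y - P.eval y) x + (((TP m) ^ l) P).eval x := by
    rw [eval_TP_pow, ← Pi.add_apply, ← map_add]
    have e2 : (fun y => f y - P.eval y) + (fun y => P.eval y) = f := by
      funext y
      simp
    rw [e2]
  have hxρ : |x - c| ≤ ρ := by
    rcases max_cases x (1 / (m : ℝ)) with ⟨h, _⟩ | ⟨h, h'⟩
    · rw [hcdef, h]; simpa using hρ0.le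
    · rw [hcdef, h, abs_sub_comm, abs_of_pos (by linarith)]; linarith
  have h3 : K₃ * (K₁ * κ / c ^ l) * (ρ + |x - c|) ^ (2 * l)
      ≤ K₃ * K₁ * 2 ^ (2 * l) * (κ * μ ^ (2 * l)) := by
    calc _ ≤ K₃ * (K₁ * κ / c ^ l) * (ρ + ρ) ^ (2 * l) := by gcongr
      _ = K₃ * (K₁ * κ / c ^ l) * (2 ^ (2 * l) * (s ^ 2) ^ l * μ ^ (2 * l)) := by
          rw [← two_mul, hρ, mul_pow, mul_pow, ← pow_mul s]; ring
      _ = _ := by rw [hs2]; field_simp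
  have h5 : κ * μ ^ (2 * l) = 8 ^ l * (C + M) * (m : ℝ) ^ (-(lam / 2)) := by
    rw [pow_mul, hμ2, hκ, hH, one_div, inv_pow, ← Real.rpow_natCast (m : ℝ), ← Real.rpow_neg hm0.le, mul_assoc,
      ← Real.rpow_add hm0]
    congr 2
    ring
  rw [e1]
  refine (abs_add_le _ _).trans ?_
  calc _ ≤ K₃ * K₁ * 2 ^ (2 * l) * (κ * μ ^ (2 * l)) + K₂ * (K₁ * κ * μ ^ (2 * l)) :=
        add_le_add (h2.trans h3) h1
    _ = (K₂ * K₁ + K₃ * K₁ * 2 ^ (2 * l)) * (κ * μ ^ (2 * l)) := by ring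
    _ = _ := by rw [h5]; ring

theorem direct_estimate (l : ℕ) (hl : 1 ≤ l) {f : ℝ → ℝ} {lam C : ℝ} (hlam : 0 < lam)
    (hlam2 : lam ≤ 2 * l) (hC : 0 ≤ C) (hf : ContinuousOn f (Icc 0 1)) (hmod : ModHyp l lam C f) :
    ∃ C' : ℝ, ∀ m : ℕ, 1 ≤ m → ∀ x ∈ Icc (0 : ℝ) 1,
      |((TopL m) ^ l) f x| ≤ C' * (m : ℝ) ^ (-(lam / 2)) := by
  obtain ⟨K, hK, D⟩ := direct_half l hl
  obtain ⟨K₀, hK₀, B⟩ := TopL_pow_bound l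
  obtain ⟨M, hM⟩ := isCompact_Icc.exists_bound_of_continuousOn hf
  simp only [Real.norm_eq_abs] at hM
  have hM0 : 0 ≤ M := (abs_nonneg _).trans (hM 0 (by simp))
  refine ⟨K * (C + M) + K₀ * M, fun m hm x hx => ?_⟩
  rcases hm.eq_or_lt with rfl | hm
  · have h1 := B 1 M f le_rfl hM x hx
    have h2 : 0 ≤ K * (C + M) := by positivity
    simp only [Nat.cast_one, Real.one_rpow, mul_one]
    linarith
  · have hp : 0 ≤ (m : ℝ) ^ (-(lam / 2)) := by positivity
    have hh : K * (C + M) * (m : ℝ) ^ (-(lam / 2)) ≤ (K * (C + M) + K₀ * M) * (m : ℝ) ^ (-(lam / 2)) := by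
      gcongr
      have : 0 ≤ K₀ * M := by positivity
      linarith
    refine le_trans ?_ hh
    rcases le_total x (1 / 2) with h | h
    · exact D f lam C M m x hlam hlam2 hC hf hM hmod hm hx.1 h
    · have := D (fun t => f (1 - t)) lam C M m (1 - x) hlam hlam2 hC
        (hf.comp (by fun_prop) fun y hy => ⟨by linarith [hy.2], by linarith [hy.1]⟩)
        (fun y hy => hM _ ⟨by linarith [hy.2], by linarith [hy.1]⟩) (modHyp_reflect hmod) hm
        (by linarith [hx.2]) (by linarith)
      rwa [TopL_pow_reflect (by omega), sub_sub_cancel] at this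

theorem dtDiff_eq_altSum (l : ℕ) (h : ℝ) (f : ℝ → ℝ) (x : ℝ) :
    dtDiff (2 * l) h f x = altSum (2 * l) f (x - l * (h * phiDT x)) (h * phiDT x) := by
  rw [altSum, ← Finset.sum_range_reflect, dtDiff]
  refine Finset.sum_congr rfl fun k hk => ?_
  have hk' : k ≤ 2 * l := Nat.lt_succ_iff.mp (Finset.mem_range.mp hk)
  have e : 2 * l + 1 - 1 - k = 2 * l - k := by omega
  rw [e, Nat.choose_symm hk', Nat.cast_sub hk']
  have e1 : (-1 : ℝ) ^ (2 * l - k) = (-1) ^ k := by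
    have : (-1 : ℝ) ^ (2 * l - k) * (-1) ^ k = (-1) ^ k * (-1) ^ k := by
      rw [← pow_add, Nat.sub_add_cancel hk', ← mul_pow, pow_mul]
      norm_num
    exact mul_right_cancel₀ (pow_ne_zero k (by norm_num)) this
  rw [e1]
  congr 2
  push_cast
  ring

theorem modHyp_of_dtDiff {l : ℕ} (hl : 1 ≤ l) {lam C : ℝ} {f : ℝ → ℝ}
    (H : ∀ h x, 0 < h → h ≤ 1 → dtAdmissible (2 * l) h x → |dtDiff (2 * l) h f x| ≤ C * h ^ lam) :
    ModHyp l lam C f := by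
  intro y u h hu hy hyu hh heq
  have hl' : (1 : ℝ) ≤ l := by exact_mod_cast hl
  have hyu' : y + 2 * l * u ≤ 1 := by push_cast at hyu; exact hyu
  have hlu : 0 < (l : ℝ) * u := by positivity
  set x : ℝ := y + l * u with hx
  have hv : 0 < x * (1 - x) := mul_pos (by linarith) (by linarith)
  have hφ : h * phiDT x = u := by
    have h1 : 0 ≤ phiDT x := Real.sqrt_nonneg _
    have h2 : (h * phiDT x) ^ 2 = u ^ 2 := by
      rw [mul_pow, phiDT, Real.sq_sqrt hv.le]; exact heq
    exact (pow_left_inj₀ (by positivity) hu.le (by norm_num)).mp h2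
  have hh1 : h ≤ 1 := by
    have h1 := sq_le_of_progression hl hu hy hyu' heq
    have h2 : u ≤ 1 / 2 := by nlinarith
    nlinarith
  have := H h x hh hh1 ?_
  · rw [dtDiff_eq_altSum, hφ] at this
    rwa [hx, add_sub_cancel_right] at this
  · refine ⟨⟨by linarith, by linarith⟩, fun k hk => ?_⟩
    have e : x + (((2 * l : ℕ) : ℝ) - 2 * k) * (h / 2) * phiDT x = y + (2 * l - k) * u := by
      push_cast
      linear_combination (2 * l - k) * hφ + hx - l * hφ
    have hk' : (k : ℝ) ≤ 2 * l := by exact_mod_cast hk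
    rw [e]
    constructor
    · have : 0 ≤ (2 * (l : ℝ) - k) * u := mul_nonneg (by linarith) hu.le
      linarith
    · nlinarith [Nat.cast_nonneg (α := ℝ) k]

end DirectEstimate

section Cauchy
open Polynomial

theorem iteratedDeriv_eval_complex (p : ℂ[X]) (s : ℕ) :
    iteratedDeriv s (fun z => p.eval z) = fun z => (derivative^[s] p).eval z := by
  induction s with
  | zero => simp
  | succ s ih =>
    rw [iteratedDeriv_succ, ih, Function.iterate_succ_apply']
    funext z
    exact Polynomial.deriv _

/-- Cauchy's estimate for a real polynomial bounded on a complex circle about a real point. -/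
theorem cauchy_poly (p : ℝ[X]) (s : ℕ) {x r B : ℝ} (hr : 0 < r)
    (hB : ∀ z : ℂ, ‖z - x‖ = r → ‖(p.map Complex.ofRealHom).eval z‖ ≤ B) :
    |(derivative^[s] p).eval x| * r ^ s ≤ s.factorial * B := by
  have h1 := Complex.norm_iteratedDeriv_le_of_forall_mem_sphere_norm_le (c := (x : ℂ))
    (f := fun z => (p.map Complex.ofRealHom).eval z) s hr
    (Differentiable.diffContOnCl (Polynomial.differentiable _))
    (fun z hz => hB z (by simpa [dist_eq_norm] using hz))
  rw [iteratedDeriv_eval_complex, iterate_derivative_map, le_div_iff₀ (by positivity)] at h1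
  have e : ((derivative^[s] p).map Complex.ofRealHom).eval (x : ℂ)
      = ((derivative^[s] p).eval x : ℝ) := by
    rw [show (x : ℂ) = Complex.ofRealHom x from rfl, eval_map_apply]
    rfl
  simp only [e, Complex.norm_real, Real.norm_eq_abs] at h1
  exact h1

theorem norm_eval_BPoly_le (n : ℕ) (u : ℝ → ℝ) (z : ℂ) :
    ‖((BPoly n u).map Complex.ofRealHom).eval z‖ ≤
      (‖z‖ + ‖1 - z‖) ^ n * Bop n (fun y => |u y|) (‖z‖ / (‖z‖ + ‖1 - z‖)) := by
  set S : ℝ := ‖z‖ + ‖1 - z‖ with hS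
  have hS1 : 1 ≤ S := by
    have := norm_add_le z (1 - z)
    simpa using this
  have hS0 : S ≠ 0 := by positivity
  have e1 : ‖1 - z‖ / S = 1 - ‖z‖ / S := by
    rw [eq_sub_iff_add_eq, ← add_div, add_comm, ← hS, div_self hS0]
  have e : ((BPoly n u).map Complex.ofRealHom).eval z
      = ∑ k ∈ Finset.range (n + 1), (n.choose k : ℂ) * z ^ k * (1 - z) ^ (n - k)
        * (u ((k : ℝ) / n) : ℂ) := by
    simp [BPoly, Polynomial.map_sum, eval_finsetSum]
    refine Finset.sum_congr rfl fun k _ => ?_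
    ring
  rw [e, Bop, Finset.mul_sum]
  refine (norm_sum_le _ _).trans (Finset.sum_le_sum fun k hk => le_of_eq ?_)
  have hk' : k ≤ n := Nat.lt_succ_iff.mp (Finset.mem_range.mp hk)
  rw [bern, ← e1, norm_mul, norm_mul, norm_mul, norm_pow, norm_pow, Complex.norm_real,
    Complex.norm_natCast, Real.norm_eq_abs, div_pow, div_pow]
  have : S ^ n = S ^ k * S ^ (n - k) := by rw [← pow_add, Nat.add_sub_cancel' hk']
  rw [this]
  field_simp

theorem norm_le_add_sq_div {z : ℂ} {p : ℝ} (hp : 0 < p) (hz : p / 2 ≤ z.re) :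
    ‖z‖ ≤ z.re + z.im ^ 2 / p := by
  have h0 : 0 ≤ z.im ^ 2 / p := by positivity
  have h1 : ‖z‖ ^ 2 = z.re ^ 2 + z.im ^ 2 := by
    rw [Complex.sq_norm, Complex.normSq_apply]; ring
  have h2 : z.im ^ 2 / p * p = z.im ^ 2 := div_mul_cancel₀ _ hp.ne'
  refine le_of_sq_le_sq ?_ (by linarith)
  rw [h1]
  nlinarith

theorem norm_add_norm_le {n : ℕ} (hn : 2 ≤ n) {x c ρ : ℝ} (hx : 0 ≤ x) (hx2 : x ≤ 1 / 2)
    (hc : c = max x (1 / n)) (hρ : 0 < ρ) (hρ2 : ρ ^ 2 = c / n) {z : ℂ} (hz : ‖z - x‖ = ρ / 2) :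
    ‖z‖ + ‖1 - z‖ ≤ 1 + 1 / n := by
  have hn0 : (0 : ℝ) < n := by positivity
  have hmc0 : 0 < 1 / (n : ℝ) := by positivity
  rcases max_cases x (1 / (n : ℝ)) with ⟨h, h'⟩ | ⟨h, h'⟩
  · rw [h] at hc
    subst hc
    have hc0 : 0 < c := hmc0.trans_le h'
    have hρc : ρ ≤ c := by
      refine le_of_sq_le_sq ?_ hc0.le
      rw [hρ2, div_eq_mul_one_div, sq]
      gcongr
    have hre : |(z - c).re| ≤ ρ / 2 := hz ▸ Complex.abs_re_le_norm _
    have him : |(z - c).im| ≤ ρ / 2 := hz ▸ Complex.abs_im_le_norm _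
    simp only [Complex.sub_re, Complex.ofReal_re, Complex.sub_im, Complex.ofReal_im, sub_zero] at hre him
    have him2 : z.im ^ 2 ≤ c / n / 4 := by
      rw [← hρ2, ← sq_abs]
      nlinarith [abs_nonneg z.im]
    rw [abs_le] at hre
    have h1 := norm_le_add_sq_div (z := z) hc0 (by linarith)
    have h2 := norm_le_add_sq_div (z := 1 - z) (p := 1 / 2) (by norm_num) (by
      simp only [Complex.sub_re, Complex.one_re]; linarith)
    simp only [Complex.sub_re, Complex.one_re, Complex.sub_im, Complex.one_im, zero_sub, neg_sq] at h2
    have h3 : z.im ^ 2 / c ≤ 1 / n / 4 := by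
      rw [div_le_iff₀ hc0]
      linarith [show 1 / (n : ℝ) / 4 * c = c / n / 4 by ring]
    have h4 : z.im ^ 2 / (1 / 2) ≤ 1 / n / 4 := by
      have : c / n ≤ 1 / 2 / n := by gcongr
      have e : 1 / 2 / (n : ℝ) = 1 / n / 2 := by ring
      linarith
    linarith
  · rw [h] at hc
    have hρn : ρ = 1 / n := by
      refine (pow_left_inj₀ hρ.le hmc0.le (by norm_num : (2 : ℕ) ≠ 0)).mp ?_
      rw [hρ2, hc]; ring
    have h1 : ‖z‖ ≤ ‖z - x‖ + ‖(x : ℂ)‖ := by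
      simpa using norm_add_le (z - x) (x : ℂ)
    have h2 : ‖1 - z‖ ≤ ‖((1 - x : ℝ) : ℂ)‖ + ‖z - x‖ := by
      have e : (1 : ℂ) - z = ((1 - x : ℝ) : ℂ) - (z - x) := by push_cast; ring
      rw [e]
      exact norm_sub_le _ _
    rw [Complex.norm_real, Real.norm_eq_abs, abs_of_nonneg (by linarith)] at h1 h2
    linarith

theorem cauchy_bernstein (a s : ℕ) : ∃ C : ℝ, 1 ≤ C ∧
    ∀ (n : ℕ) (x c ρ κ : ℝ) (u : ℝ → ℝ), 2 ≤ n → 0 ≤ x → x ≤ 1 / 2 → c = max x (1 / n) → 0 < ρ →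
    ρ ^ 2 = c / n → (∀ y ∈ Icc (0 : ℝ) 1, |u y| ≤ κ * (ρ + |y - c|) ^ a) →
    |(derivative^[s] (BPoly n u)).eval x| * ρ ^ s ≤ C * κ * ρ ^ a := by
  obtain ⟨C, hC, H⟩ := cone_Bop a
  refine ⟨2 ^ s * s.factorial * (Real.exp 1 * C * 4 ^ a), ?_, ?_⟩
  · have h1 : (1 : ℝ) ≤ 2 ^ s := one_le_pow₀ (by norm_num)
    have h2 : (1 : ℝ) ≤ s.factorial := by exact_mod_cast Nat.one_le_iff_ne_zero.mpr s.factorial_ne_zero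
    have h3 : (1 : ℝ) ≤ 4 ^ a := one_le_pow₀ (by norm_num)
    have h4 : (1 : ℝ) ≤ Real.exp 1 := Real.one_le_exp (by norm_num)
    exact one_le_mul_of_one_le_of_one_le (one_le_mul_of_one_le_of_one_le h1 h2)
      (one_le_mul_of_one_le_of_one_le (one_le_mul_of_one_le_of_one_le h4 hC) h3)
  intro n x c ρ κ u hn hx hx2 hc hρ hρ2 hu
  have hn0 : (0 : ℝ) < n := by positivity
  have hmc0 : 0 < 1 / (n : ℝ) := by positivity
  have hmc : 1 / (n : ℝ) ≤ c := hc ▸ le_max_right _ _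
  have hn2 : 1 / (n : ℝ) ≤ 1 / 2 :=
    one_div_le_one_div_of_le (by norm_num) (by exact_mod_cast hn)
  have hc2 : c ≤ 1 / 2 := hc ▸ max_le hx2 hn2
  have hc0 : 0 < c := hmc0.trans_le hmc
  have hρn : 1 / (n : ℝ) ≤ ρ := by
    refine le_of_sq_le_sq ?_ hρ.le
    rw [hρ2, show c / n = c * (1 / n) by ring, sq]
    gcongr
  have hW : WeightOK n c ρ := by
    refine ⟨by omega, ⟨hc0.le, by linarith⟩, hρ, ?_, ?_⟩
    · rw [hρ2, mul_div_cancel₀ _ hn0.ne']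
      nlinarith
    · rw [div_le_iff₀ hn0] at hρn
      linarith
  have hκ : 0 ≤ κ := by
    have h1 := (abs_nonneg _).trans (hu 0 (by simp))
    exact nonneg_of_mul_nonneg_left h1 (by positivity)
  have hxρ : |x - c| ≤ ρ := by
    rcases max_cases x (1 / (n : ℝ)) with ⟨h, _⟩ | ⟨h, h'⟩
    · rw [hc, h]; simpa using hρ.le
    · rw [hc, h, abs_sub_comm, abs_of_pos (by linarith)]; linarith
  have key := cauchy_poly (BPoly n u) s (x := x) (r := ρ / 2)
    (B := Real.exp 1 * (C * κ * (4 * ρ) ^ a)) (by positivity) (fun z hz => by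
      refine (norm_eval_BPoly_le n u z).trans ?_
      have hS := norm_add_norm_le hn hx hx2 hc hρ hρ2 hz
      set S : ℝ := ‖z‖ + ‖1 - z‖ with hSdef
      have hS1 : 1 ≤ S := by
        have := norm_add_le z (1 - z)
        simpa using this
      have hz0 := norm_nonneg z
      have hx'1 : ‖z‖ / S ≤ 1 := (div_le_one (by linarith)).mpr (by linarith [norm_nonneg (1 - z)])
      have hx'I : ‖z‖ / S ∈ Icc (0 : ℝ) 1 := ⟨by positivity, hx'1⟩
      have h1 := H n c ρ κ u hW hu _ hx'I
      have hzx : |‖z‖ - x| ≤ ρ / 2 := by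
        have := abs_norm_sub_norm_le z (x : ℂ)
        rwa [hz, Complex.norm_real, Real.norm_eq_abs, abs_of_nonneg hx] at this
      have hzS : ‖z‖ = ‖z‖ / S * S := by field_simp
      have hx'x : |‖z‖ / S - c| ≤ 3 * ρ := by
        rw [abs_le] at hzx hxρ ⊢
        constructor <;> nlinarith [hx'I.1]
      have h2 : S ^ n ≤ Real.exp 1 := by
        calc S ^ n ≤ (Real.exp (1 / n)) ^ n := by
              gcongr
              linarith [Real.add_one_le_exp (1 / (n : ℝ))]
          _ = Real.exp 1 := by
              rw [← Real.exp_nat_mul]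
              congr 1
              field_simp
      have h3 : C * κ * (ρ + |‖z‖ / S - c|) ^ a ≤ C * κ * (4 * ρ) ^ a := by
        gcongr
        linarith
      exact mul_le_mul h2 (h1.trans h3) ((abs_nonneg _).trans (abs_Bop_le (fun y _ => by rw [abs_abs])
        hx'I)) (Real.exp_pos 1).le)
  rw [div_pow, ← mul_div_assoc, div_le_iff₀ (by positivity)] at key
  refine key.trans (le_of_eq ?_)
  rw [mul_pow]
  ring

end Cauchy

section WeightedTaylor
open Polynomial

theorem phiDT_nonneg (x : ℝ) : 0 ≤ phiDT x := Real.sqrt_nonneg _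

theorem phiDT_sq {x : ℝ} (hx : x ∈ Icc (0 : ℝ) 1) : phiDT x ^ 2 = x * (1 - x) :=
  Real.sq_sqrt (mul_nonneg hx.1 (by linarith [hx.2]))

theorem phiDT_reflect (x : ℝ) : phiDT (1 - x) = phiDT x := by
  unfold phiDT
  congr 1
  ring

/-- The weighted derivative bound `φ^k |g^(k)| ≤ M` on `[0,1]`. -/
def WBound (k : ℕ) (M : ℝ) (g : ℝ[X]) : Prop :=
  ∀ x ∈ Icc (0 : ℝ) 1, phiDT x ^ k * |(derivative^[k] g).eval x| ≤ M

theorem WBound.nonneg {k : ℕ} {M : ℝ} {g : ℝ[X]} (h : WBound k M g) : 0 ≤ M :=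
  (mul_nonneg (pow_nonneg (phiDT_nonneg _) _) (abs_nonneg _)).trans (h 0 (by simp))

theorem abs_eval_derivative_comp_one_sub (k : ℕ) (g : ℝ[X]) (x : ℝ) :
    |(derivative^[k] (g.comp (1 - X))).eval x| = |(derivative^[k] g).eval (1 - x)| := by
  rw [Polynomial.iterate_derivative_comp_one_sub_X]
  simp [eval_comp, abs_mul]

theorem one_sub_mem_Icc {x : ℝ} (hx : x ∈ Icc (0 : ℝ) 1) : 1 - x ∈ Icc (0 : ℝ) 1 :=
  ⟨by linarith [hx.2], by linarith [hx.1]⟩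

theorem WBound.reflect {k : ℕ} {M : ℝ} {g : ℝ[X]} (h : WBound k M g) :
    WBound k M (g.comp (1 - X)) := by
  intro x hx
  rw [abs_eval_derivative_comp_one_sub, ← phiDT_reflect]
  exact h _ (one_sub_mem_Icc hx)

theorem BPoly_reflect {n : ℕ} (hn : 1 ≤ n) (u : ℝ → ℝ) :
    (BPoly n u).comp (1 - X) = BPoly n (fun y => u (1 - y)) := by
  refine Polynomial.funext fun x => ?_
  simp [eval_comp, Bop_reflect hn]

/-- The Taylor polynomial of `g` at `x` of degree less than `s`. -/
noncomputable def taylorTrunc (x : ℝ) (s : ℕ) (g : ℝ[X]) : ℝ[X] :=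
  ∑ j ∈ Finset.range s, C ((taylor x g).coeff j) * (X - C x) ^ j

theorem eval_taylorTrunc (x : ℝ) (s : ℕ) (g : ℝ[X]) (y : ℝ) :
    (taylorTrunc x s g).eval y
      = ∑ j ∈ Finset.range s, (taylor x g).coeff j * (y - x) ^ j := by
  simp [taylorTrunc, eval_finsetSum]

theorem natDegree_taylorTrunc (x : ℝ) (s : ℕ) (g : ℝ[X]) :
    (taylorTrunc x s g).natDegree ≤ s - 1 := by
  refine natDegree_sum_le_of_forall_le _ _ fun j hj => ?_
  refine (natDegree_C_mul_le _ _).trans ?_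
  refine (natDegree_sub_pow_le x j).trans ?_
  have := Finset.mem_range.mp hj
  omega

theorem coeff_taylor_taylorTrunc (x : ℝ) (s : ℕ) (g : ℝ[X]) (i : ℕ) :
    (taylor x (taylorTrunc x s g)).coeff i = if i < s then (taylor x g).coeff i else 0 := by
  have : taylor x (taylorTrunc x s g)
      = ∑ j ∈ Finset.range s, C ((taylor x g).coeff j) * X ^ j := by
    simp [taylorTrunc, map_sum, taylor_mul, taylor_pow]
  rw [this, finsetSum_coeff]
  simp [coeff_C_mul, coeff_X_pow]

theorem pow_dvd_sub_taylorTrunc (x : ℝ) (s : ℕ) (g : ℝ[X]) :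
    (X - C x) ^ s ∣ g - taylorTrunc x s g := by
  have h := poly_eq_sum_taylor (p := g) (N := g.natDegree + s) (by omega) x
  have : g - taylorTrunc x s g
      = ∑ j ∈ Finset.Ico s (g.natDegree + s + 1), C ((taylor x g).coeff j) * (X - C x) ^ j := by
    rw [Finset.sum_Ico_eq_sub _ (by omega), taylorTrunc]
    simp only [← smul_eq_C_mul]
    rw [← h]
  rw [this]
  exact Finset.dvd_sum fun j hj =>
    Dvd.dvd.mul_left (pow_dvd_pow _ (Finset.mem_Ico.mp hj).1) _

theorem hasDerivAt_taylor_sum (g : ℝ[X]) (y u : ℝ) (k : ℕ) :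
    HasDerivAt (fun u => ∑ j ∈ Finset.range (k + 1),
        (derivative^[j] g).eval u / j.factorial * (y - u) ^ j)
      ((derivative^[k + 1] g).eval u / k.factorial * (y - u) ^ k) u := by
  induction k with
  | zero => simpa using g.hasDerivAt u
  | succ k ih =>
    simp only [Finset.sum_range_succ _ (k + 1)]
    have h1 := ((derivative^[k + 1] g).hasDerivAt u).div_const ((k + 1).factorial : ℝ)
    have h2 := ((hasDerivAt_id u).const_sub y).pow (k + 1)
    refine (ih.add (h1.mul h2)).congr_deriv ?_
    rw [Function.iterate_succ_apply' derivative (k + 1) g, Nat.factorial_succ]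
    have : (k.factorial : ℝ) ≠ 0 := by positivity
    push_cast
    simp
    field_simp
    ring

/-- Weighted Taylor remainder estimate. -/
theorem WBound.taylor {s : ℕ} (hs : 2 ≤ s) {M : ℝ} {g : ℝ[X]} (h : WBound s M g) {x y : ℝ}
    (hx : x ∈ Icc (0 : ℝ) 1) (hy : y ∈ Icc (0 : ℝ) 1) :
    phiDT x ^ s * |g.eval y - (taylorTrunc x s g).eval y| ≤ M * |y - x| ^ s := by
  obtain ⟨k, rfl⟩ : ∃ k, s = k + 1 := ⟨s - 1, by omega⟩
  set ψ : ℝ → ℝ := fun u => ∑ j ∈ Finset.range (k + 1),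
        (derivative^[j] g).eval u / j.factorial * (y - u) ^ j with hψ
  have hd : ∀ τ : ℝ, HasDerivAt (fun τ => ψ (x + τ * (y - x)))
      ((derivative^[k + 1] g).eval (x + τ * (y - x)) / k.factorial
        * (y - (x + τ * (y - x))) ^ k * (y - x)) τ := fun τ => by
    have h1 : HasDerivAt (fun τ : ℝ => x + τ * (y - x)) (y - x) τ := by
      simpa using ((hasDerivAt_id τ).mul_const (y - x)).const_add x
    exact (hasDerivAt_taylor_sum g y _ k).comp τ h1
  obtain ⟨τ, hτ, he⟩ := exists_hasDerivAt_eq_slope (fun τ => ψ (x + τ * (y - x))) _ zero_lt_one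
    (fun τ _ => (hd τ).continuousAt.continuousWithinAt) (fun τ _ => hd τ)
  have hψx : ψ x = (taylorTrunc x (k + 1) g).eval y := by
    rw [eval_taylorTrunc]
    refine Finset.sum_congr rfl fun j _ => ?_
    rw [eval_iterate_derivative_eq, mul_div_cancel_left₀ _ (by positivity)]
  have hψy : ψ y = g.eval y := by
    simp [hψ, Finset.sum_range_succ']
  simp only [one_mul, zero_mul, add_zero, sub_zero, div_one, add_sub_cancel, hψx, hψy] at he
  rw [← he]
  set u := x + τ * (y - x) with hu
  have huI : u ∈ Icc (0 : ℝ) 1 :=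
    ⟨by nlinarith [hx.1, hy.1, hτ.1, hτ.2], by nlinarith [hx.2, hy.2, hτ.1, hτ.2]⟩
  have hyu : y - u = (1 - τ) * (y - x) := by rw [hu]; ring
  set q := Real.sqrt (1 - τ) with hq
  have hq2 : q ^ 2 = 1 - τ := Real.sq_sqrt (by linarith [hτ.2])
  have hq0 : 0 ≤ q := Real.sqrt_nonneg _
  have hq1 : q ≤ 1 := by
    nlinarith [hτ.1]
  have hqφ : phiDT x * q ≤ phiDT u := by
    refine le_of_sq_le_sq ?_ (phiDT_nonneg _)
    rw [mul_pow, phiDT_sq hx, phiDT_sq huI, hq2, hu]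
    have h1 : 0 ≤ τ * (y * (1 - y)) :=
      mul_nonneg hτ.1.le (mul_nonneg hy.1 (by linarith [hy.2]))
    have h2 : 0 ≤ τ * (1 - τ) * (x - y) ^ 2 :=
      mul_nonneg (mul_nonneg hτ.1.le (by linarith [hτ.2])) (sq_nonneg _)
    linear_combination h1 + h2
  have hk : (1 - τ) ^ k ≤ q ^ (k + 1) := by
    rw [← hq2, ← pow_mul]
    exact pow_le_pow_of_le_one hq0 hq1 (by omega)
  have hfac : (1 : ℝ) ≤ k.factorial := by exact_mod_cast Nat.one_le_iff_ne_zero.mpr k.factorial_ne_zero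
  have hτ0 : 0 ≤ (1 - τ) := by linarith [hτ.2]
  rw [hyu, abs_mul, abs_mul, abs_div, mul_pow, abs_mul, abs_of_nonneg (pow_nonneg hτ0 k),
    abs_of_pos (by positivity : (0 : ℝ) < k.factorial), abs_pow]
  calc phiDT x ^ (k + 1) * (|(derivative^[k + 1] g).eval u| / k.factorial
        * ((1 - τ) ^ k * |y - x| ^ k) * |y - x|)
      ≤ phiDT x ^ (k + 1) * (|(derivative^[k + 1] g).eval u| / 1
        * (q ^ (k + 1) * |y - x| ^ k) * |y - x|) := by
        have := phiDT_nonneg x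
        gcongr
    _ = ((phiDT x * q) ^ (k + 1) * |(derivative^[k + 1] g).eval u|) * |y - x| ^ (k + 1) := by
        rw [mul_pow]; ring
    _ ≤ (phiDT u ^ (k + 1) * |(derivative^[k + 1] g).eval u|) * |y - x| ^ (k + 1) := by
        have := mul_nonneg (phiDT_nonneg x) hq0
        gcongr
    _ ≤ M * |y - x| ^ (k + 1) := by
        gcongr
        exact h u huI

end WeightedTaylor

section Smoothing
open Polynomial

theorem WBound.of_half {k : ℕ} {M : ℝ} {g : ℝ[X]}
    (h : ∀ x : ℝ, 0 ≤ x → x ≤ 1 / 2 → phiDT x ^ k * |(derivative^[k] g).eval x| ≤ M)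
    (h' : ∀ x : ℝ, 0 ≤ x → x ≤ 1 / 2 →
      phiDT x ^ k * |(derivative^[k] (g.comp (1 - X))).eval x| ≤ M) : WBound k M g := by
  intro x hx
  rcases le_total x (1 / 2) with hx2 | hx2
  · exact h x hx.1 hx2
  · have := h' (1 - x) (by linarith [hx.2]) (by linarith)
    rwa [abs_eval_derivative_comp_one_sub, phiDT_reflect, sub_sub_cancel] at this

/-- The natural scale `ρ = √(c/n)` at `c = max x (1/n)`. -/
theorem exists_scale {n : ℕ} (hn : 2 ≤ n) {x : ℝ} (hx : 0 ≤ x) (hx2 : x ≤ 1 / 2) :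
    ∃ c ρ : ℝ, c = max x (1 / n) ∧ 0 < ρ ∧ ρ ^ 2 = c / n ∧ 0 < c ∧ c ≤ 1 / 2 ∧
      phiDT x ^ 2 ≤ c ∧ phiDT x ≤ √n * ρ ∧ WeightOK n c ρ := by
  have hn0 : (0 : ℝ) < n := by positivity
  have hmc0 : 0 < 1 / (n : ℝ) := by positivity
  have hn2 : 1 / (n : ℝ) ≤ 1 / 2 := one_div_le_one_div_of_le (by norm_num) (by exact_mod_cast hn)
  have hc2 : max x (1 / (n : ℝ)) ≤ 1 / 2 := max_le hx2 hn2
  have hmc : 1 / (n : ℝ) ≤ max x (1 / (n : ℝ)) := le_max_right _ _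
  have hxc : x ≤ max x (1 / (n : ℝ)) := le_max_left _ _
  refine ⟨max x (1 / n), √(max x (1 / n) / n), rfl, ?_⟩
  generalize max x (1 / (n : ℝ)) = c at *
  have hc0 : 0 < c := hmc0.trans_le hmc
  have hρ2 : √(c / n) ^ 2 = c / n := Real.sq_sqrt (by positivity)
  have hρ : 0 < √(c / n) := Real.sqrt_pos.mpr (by positivity)
  generalize √(c / n) = ρ at *
  have hφ : phiDT x ^ 2 ≤ c := by
    rw [phiDT_sq ⟨hx, by linarith⟩]
    nlinarith
  refine ⟨hρ, hρ2, hc0, hc2, hφ, ?_, ⟨by omega, ⟨hc0.le, by linarith⟩, hρ, ?_, ?_⟩⟩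
  · refine le_of_sq_le_sq ?_ (by positivity)
    rw [mul_pow, Real.sq_sqrt hn0.le, hρ2, mul_div_cancel₀ _ hn0.ne']
    exact hφ
  · rw [hρ2, mul_div_cancel₀ _ hn0.ne']
    nlinarith
  · have hρn : 1 / (n : ℝ) ≤ ρ := by
      refine le_of_sq_le_sq ?_ hρ.le
      rw [hρ2, show c / n = c * (1 / n) by ring, sq]
      gcongr
    rw [div_le_iff₀ hn0] at hρn
    linarith

/-- Bernstein-type inequality `φ^k |(B_n u)^(k)| ≤ C n^(k/2) ‖u‖`. -/
theorem WBound_BPoly (k : ℕ) : ∃ C : ℝ, 1 ≤ C ∧ ∀ (n : ℕ) (κ : ℝ) (u : ℝ → ℝ), 2 ≤ n →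
    (∀ y ∈ Icc (0 : ℝ) 1, |u y| ≤ κ) → WBound k (C * √n ^ k * κ) (BPoly n u) := by
  obtain ⟨C, hC, H⟩ := cauchy_bernstein 0 k
  have half : ∀ (n : ℕ) (κ : ℝ) (u : ℝ → ℝ), 2 ≤ n → (∀ y ∈ Icc (0 : ℝ) 1, |u y| ≤ κ) →
      ∀ x : ℝ, 0 ≤ x → x ≤ 1 / 2 →
        phiDT x ^ k * |(derivative^[k] (BPoly n u)).eval x| ≤ C * √n ^ k * κ := by
    intro n κ u hn hu x hx hx2
    obtain ⟨c, ρ, hc, hρ, hρ2, -, -, -, hφ, -⟩ := exists_scale hn hx hx2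
    have h1 := H n x c ρ κ u hn hx hx2 hc hρ hρ2 (by simpa using hu)
    rw [pow_zero, mul_one] at h1
    have := phiDT_nonneg x
    calc phiDT x ^ k * |(derivative^[k] (BPoly n u)).eval x|
        ≤ (√n * ρ) ^ k * |(derivative^[k] (BPoly n u)).eval x| := by gcongr
      _ = √n ^ k * (|(derivative^[k] (BPoly n u)).eval x| * ρ ^ k) := by rw [mul_pow]; ring
      _ ≤ √n ^ k * (C * κ) := by gcongr
      _ = _ := by ring
  refine ⟨C, hC, fun n κ u hn hu => WBound.of_half (half n κ u hn hu) ?_⟩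
  rw [BPoly_reflect (by omega)]
  exact half n κ _ hn fun y hy => hu _ (one_sub_mem_Icc hy)

theorem BPoly_Qop_eval (n l : ℕ) (p : ℝ[X]) :
    BPoly n (Qop n l (fun y => p.eval y)) = p - ((TP n) ^ l) p := by
  refine Polynomial.funext fun x => ?_
  rw [eval_BPoly, Bop_Qop, eval_sub, eval_TP_pow]
  rfl

theorem TP_pow_reflect {n : ℕ} (hn : 1 ≤ n) (l : ℕ) (p : ℝ[X]) :
    (((TP n) ^ l) p).comp (1 - X) = ((TP n) ^ l) (p.comp (1 - X)) := by
  refine Polynomial.funext fun x => ?_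
  have := TopL_pow_reflect hn l (fun y => p.eval y) x
  simp only [eval_comp, eval_TP_pow, eval_sub, eval_one, eval_X]
  exact this.symm

/-- A bound on `φ^(2l) h^(2l)` controls the next weighted derivative of the generalized Bernstein
polynomial of `h`. -/
theorem WBound_genBernstein (l : ℕ) (hl : 1 ≤ l) : ∃ C : ℝ, 1 ≤ C ∧ ∀ (n : ℕ) (M : ℝ) (h : ℝ[X]),
    2 ≤ n → WBound (2 * l) M h → WBound (2 * l + 1) (C * √n * M) (h - ((TP n) ^ l) h) := by
  obtain ⟨C, hC, H⟩ := cauchy_bernstein (2 * l) (2 * l + 1)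
  obtain ⟨C', hC', H'⟩ := cone_Qop (2 * l) l
  have half : ∀ (n : ℕ) (M : ℝ) (h : ℝ[X]), 2 ≤ n → WBound (2 * l) M h →
      ∀ x : ℝ, 0 ≤ x → x ≤ 1 / 2 →
        phiDT x ^ (2 * l + 1) * |(derivative^[2 * l + 1] (h - ((TP n) ^ l) h)).eval x|
          ≤ (C * C' * 2 ^ l) * √n * M := by
    intro n M h hn hh x hx hx2
    obtain ⟨c, ρ, hc, hρ, hρ2, hc0, hc2, hφc, hφ, hW⟩ := exists_scale hn hx hx2
    set P := taylorTrunc c (2 * l) h with hP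
    have hM := hh.nonneg
    have hcI : c ∈ Icc (0 : ℝ) 1 := ⟨hc0.le, by linarith⟩
    have hu : ∀ y ∈ Icc (0 : ℝ) 1, |(h - P).eval y| ≤ (2 ^ l / c ^ l * M) * (ρ + |y - c|) ^ (2 * l) := by
      intro y hy
      have h1 := hh.taylor (by omega) hcI hy
      have h2 : (c / 2) ^ l ≤ phiDT c ^ (2 * l) := by
        rw [pow_mul, phiDT_sq hcI]
        gcongr
        nlinarith
      have h3 : (c / 2) ^ l * |(h - P).eval y| ≤ M * |y - c| ^ (2 * l) := by
        rw [eval_sub]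
        exact (mul_le_mul_of_nonneg_right h2 (abs_nonneg _)).trans h1
      have h4 : |(h - P).eval y| ≤ (2 ^ l / c ^ l * M) * |y - c| ^ (2 * l) := by
        calc |(h - P).eval y| = 2 ^ l / c ^ l * ((c / 2) ^ l * |(h - P).eval y|) := by
              rw [div_pow]; field_simp
          _ ≤ 2 ^ l / c ^ l * (M * |y - c| ^ (2 * l)) := by gcongr
          _ = _ := by ring
      refine h4.trans ?_
      gcongr
      linarith
    have h1 := H n x c ρ _ _ hn hx hx2 hc hρ hρ2 (H' n c ρ _ _ hW hu)
    rw [BPoly_Qop_eval] at h1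
    have hdeg : derivative^[2 * l + 1] (P - ((TP n) ^ l) P) = 0 := by
      refine iterate_derivative_eq_zero ?_
      have hPd : P.natDegree ≤ 2 * l - 1 := natDegree_taylorTrunc _ _ _
      have := natDegree_sub_le_of_le hPd (natDegree_TP_pow (m := n) (by omega) hPd l)
      rw [max_self] at this
      omega
    have hsplit : h - ((TP n) ^ l) h
        = (h - P - ((TP n) ^ l) (h - P)) + (P - ((TP n) ^ l) P) := by
      rw [map_sub]; ring
    rw [hsplit, iterate_map_add, hdeg, add_zero]
    set D := |(derivative^[2 * l + 1] (h - P - ((TP n) ^ l) (h - P))).eval x| with hD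
    have h2 : D * ρ ≤ C * (C' * (2 ^ l / c ^ l * M)) := by
      rw [pow_succ' ρ, ← mul_assoc] at h1
      exact le_of_mul_le_mul_right h1 (by positivity)
    have hφ0 := phiDT_nonneg x
    have hD0 : 0 ≤ D := abs_nonneg _
    calc phiDT x ^ (2 * l + 1) * D = (phiDT x ^ 2) ^ l * phiDT x * D := by
          rw [← pow_mul, pow_succ]
      _ ≤ c ^ l * (√n * ρ) * D := by gcongr
      _ = c ^ l * √n * (D * ρ) := by ring
      _ ≤ c ^ l * √n * (C * (C' * (2 ^ l / c ^ l * M))) := by gcongr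
      _ = _ := by field_simp
  refine ⟨C * C' * 2 ^ l, ?_, fun n M h hn hh => WBound.of_half (half n M h hn hh) ?_⟩
  · exact one_le_mul_of_one_le_of_one_le (one_le_mul_of_one_le_of_one_le hC hC')
      (one_le_pow₀ (by norm_num))
  · rw [sub_comp, TP_pow_reflect (by omega)]
    exact half n M _ hn hh.reflect

end Smoothing

section Quotient
open Polynomial

theorem iterate_derivative_X_mul_eval (k : ℕ) (a : ℝ[X]) (x : ℝ) :
    (derivative^[k + 1] (X * a)).eval x
      = x * (derivative^[k + 1] a).eval x + (k + 1) * (derivative^[k] a).eval x := by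
  have : derivative^[k + 1] (X * a) = X * derivative^[k + 1] a + (k + 1) • derivative^[k] a := by
    induction k with
    | zero => simp [add_comm]
    | succ k ih =>
      rw [Function.iterate_succ_apply', ih, Function.iterate_succ_apply' derivative (k + 1),
        Function.iterate_succ_apply' derivative k]
      simp only [derivative_add, derivative_mul, derivative_X, derivative_smul, one_mul]
      simp only [nsmul_eq_mul]
      push_cast
      ring
  rw [this]
  simp

/-- If `v = X a`, weighted bounds on `v^(k+1)` pass to `a^(k)`, with `k + 1 = 2j`. -/
theorem weighted_factor_lower {j k : ℕ} (hj : k + 1 = 2 * j) {M : ℝ} {a : ℝ[X]}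
    (h : WBound (2 * j) M (X * a)) {x : ℝ} (hx : x ∈ Icc (0 : ℝ) 1) :
    phiDT x ^ (2 * j) * |(derivative^[k] a).eval x| ≤ M := by
  have hM := h.nonneg
  rcases eq_or_lt_of_le hx.1 with h0 | h0
  · rw [← h0]
    have : phiDT 0 = 0 := by simp [phiDT]
    rw [this, zero_pow (by omega), zero_mul]
    exact hM
  have hd : ∀ u : ℝ, HasDerivAt (fun u => u ^ (k + 1) * (derivative^[k] a).eval u)
      (u ^ k * (derivative^[k + 1] (X * a)).eval u) u := fun u => by
    refine ((hasDerivAt_pow (k + 1) u).mul ((derivative^[k] a).hasDerivAt u)).congr_deriv ?_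
    rw [iterate_derivative_X_mul_eval, Function.iterate_succ_apply']
    push_cast
    ring
  obtain ⟨u, hu, he⟩ := exists_hasDerivAt_eq_slope _ _ h0
    (fun τ _ => (hd τ).continuousAt.continuousWithinAt) (fun τ _ => hd τ)
  obtain ⟨i, rfl⟩ : ∃ i, j = i + 1 := ⟨j - 1, by omega⟩
  obtain rfl : k = 2 * i + 1 := by omega
  have huI : u ∈ Icc (0 : ℝ) 1 := ⟨hu.1.le, hu.2.le.trans hx.2⟩
  have hv := h u huI
  rw [pow_mul, phiDT_sq huI, mul_pow] at hv
  rw [pow_mul, phiDT_sq hx, mul_pow]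
  rw [eq_div_iff (by linarith)] at he
  simp only [zero_pow (Nat.succ_ne_zero _), zero_mul, sub_zero] at he
  rw [show 2 * i + 1 + 1 = 2 * (i + 1) by ring] at he
  set V := (derivative^[2 * (i + 1)] (X * a)).eval u with hV
  set A := (derivative^[2 * i + 1] a).eval x with hA
  have he' : x ^ (2 * (i + 1)) * |A| = u ^ (2 * i + 1) * |V| * x := by
    have := congrArg abs he
    rw [abs_mul, abs_mul, abs_mul, abs_of_pos h0, abs_of_pos (pow_pos hu.1 _),
      abs_of_pos (pow_pos h0 _)] at this
    exact this.symm
  have hx1 : 0 ≤ 1 - x := by linarith [hx.2]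
  have hu0 := hu.1
  refine le_of_mul_le_mul_left ?_ (pow_pos h0 (i + 1))
  calc x ^ (i + 1) * (x ^ (i + 1) * (1 - x) ^ (i + 1) * |A|)
      = (1 - x) ^ (i + 1) * (x ^ (2 * (i + 1)) * |A|) := by ring
    _ = x * u ^ i * (u ^ (i + 1) * (1 - x) ^ (i + 1) * |V|) := by rw [he']; ring
    _ ≤ x * x ^ i * (u ^ (i + 1) * (1 - u) ^ (i + 1) * |V|) := by
        gcongr
        · exact hu.2.le
        · exact hu.2.le
    _ ≤ x * x ^ i * M := by gcongr
    _ = _ := by ring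

theorem weighted_factor (j : ℕ) {M : ℝ} {a : ℝ[X]} (h : WBound (2 * j) M (X * a)) {x : ℝ}
    (hx : x ∈ Icc (0 : ℝ) 1) :
    phiDT x ^ (2 * j + 2) * |(derivative^[2 * j] a).eval x| ≤ (1 + 2 * j) * M := by
  have hM := h.nonneg
  have hφ := phiDT_nonneg x
  have hx1 : 0 ≤ 1 - x := by linarith [hx.2]
  have key : phiDT x ^ (2 * j) * (x * |(derivative^[2 * j] a).eval x|) ≤ (1 + 2 * j) * M := by
    rcases Nat.eq_zero_or_pos j with rfl | hj
    · simpa [abs_mul, abs_of_nonneg hx.1] using h x hx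
    · obtain ⟨k, hk⟩ : ∃ k, k + 1 = 2 * j := ⟨2 * j - 1, by omega⟩
      have h1 := weighted_factor_lower hk h hx
      have h2 := h x hx
      have e := iterate_derivative_X_mul_eval k a x
      have hkR : (k : ℝ) + 1 = 2 * j := by exact_mod_cast hk
      rw [hk, hkR] at e
      have h3 : x * |(derivative^[2 * j] a).eval x|
          ≤ |(derivative^[2 * j] (X * a)).eval x| + 2 * j * |(derivative^[k] a).eval x| := by
        rw [← abs_of_nonneg hx.1, ← abs_mul, abs_of_nonneg hx.1]
        have : x * (derivative^[2 * j] a).eval x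
          = (derivative^[2 * j] (X * a)).eval x - 2 * j * (derivative^[k] a).eval x := by
          rw [e]; ring
        rw [this]
        refine (abs_sub _ _).trans (le_of_eq ?_)
        rw [abs_mul, abs_of_nonneg (by positivity : (0 : ℝ) ≤ 2 * j)]
      calc phiDT x ^ (2 * j) * (x * |(derivative^[2 * j] a).eval x|)
          ≤ phiDT x ^ (2 * j) * (|(derivative^[2 * j] (X * a)).eval x|
            + 2 * j * |(derivative^[k] a).eval x|) := by gcongr
        _ = phiDT x ^ (2 * j) * |(derivative^[2 * j] (X * a)).eval x|
            + 2 * j * (phiDT x ^ (2 * j) * |(derivative^[k] a).eval x|) := by ring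
        _ ≤ M + 2 * j * M := by gcongr
        _ = _ := by ring
  refine le_trans ?_ key
  rw [pow_add, phiDT_sq hx, mul_assoc]
  gcongr
  nlinarith [hx.1]

theorem weighted_quotient (j : ℕ) {M : ℝ} {q : ℝ[X]} (h : WBound (2 * j) M (X * (1 - X) * q))
    {x : ℝ} (hx : x ∈ Icc (0 : ℝ) 1) :
    phiDT x ^ (2 * j + 2) * |(derivative^[2 * j] q).eval x| ≤ 2 * (1 + 2 * j) * M := by
  have h1 := weighted_factor j (a := (1 - X) * q) (by rwa [← mul_assoc]) hx
  have h2 := weighted_factor j (a := (1 - X) * q.comp (1 - X)) (M := M) (by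
    have := h.reflect
    convert this using 1
    simp only [mul_comp, sub_comp, X_comp, one_comp]
    ring) (one_sub_mem_Icc hx)
  have e : (1 - X) * q.comp (1 - X) = (X * q).comp (1 - X) := by simp [mul_comp]
  rw [phiDT_reflect, e, abs_eval_derivative_comp_one_sub, sub_sub_cancel] at h2
  have e2 : q = (1 - X) * q + X * q := by ring
  have h3 : |(derivative^[2 * j] q).eval x| ≤ |(derivative^[2 * j] ((1 - X) * q)).eval x|
      + |(derivative^[2 * j] (X * q)).eval x| := by
    conv_lhs => rw [e2, iterate_map_add, eval_add]
    exact abs_add_le _ _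
  have hφ := phiDT_nonneg x
  calc phiDT x ^ (2 * j + 2) * |(derivative^[2 * j] q).eval x|
      ≤ phiDT x ^ (2 * j + 2) * (|(derivative^[2 * j] ((1 - X) * q)).eval x|
      + |(derivative^[2 * j] (X * q)).eval x|) := by gcongr
    _ ≤ _ := by rw [mul_add]; linarith

theorem WBound_of_EP_pow (l : ℕ) : ∀ j : ℕ, ∃ C : ℝ, 1 ≤ C ∧ ∀ (M : ℝ) (g : ℝ[X]),
    WBound (2 * j) M ((EP ^ l) g) → WBound (2 * (j + l)) (C * M) g := by
  induction l with
  | zero => exact fun j => ⟨1, le_rfl, fun M g h => by simpa using h⟩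
  | succ l ih =>
    intro j
    obtain ⟨C, hC, H⟩ := ih (j + 1)
    refine ⟨C * (2 * (1 + 2 * j)), one_le_mul_of_one_le_of_one_le hC ?_, fun M g h => ?_⟩
    · have : (0 : ℝ) ≤ j := by positivity
      linarith
    · rw [pow_succ', Module.End.mul_apply, EP_apply] at h
      have : WBound (2 * (j + 1)) (2 * (1 + 2 * j) * M) ((EP ^ l) g) := fun x hx => by
        have := weighted_quotient j h hx
        rwa [← Function.iterate_succ_apply, ← Function.iterate_succ_apply] at this
      have := H _ g this
      rwa [show j + 1 + l = j + (l + 1) by ring, ← mul_assoc] at this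

end Quotient

section Voronovskaya
open Polynomial

/-- Integrating a derivative bound with singularity `σ^(-w')`, `σ² = x`, down from `x = 1/2`. -/
theorem singular_step {w w' : ℕ} (hw : (w' = w + 2 ∧ 1 ≤ w) ∨ (w' ≤ 1 ∧ w = 0)) {A : ℝ} {p : ℝ[X]}
    (h0 : |p.eval (1 / 2)| ≤ A)
    (h : ∀ σ : ℝ, 0 < σ → σ ^ 2 ≤ 1 / 2 → σ ^ w' * |(derivative p).eval (σ ^ 2)| ≤ A) {σ : ℝ}
    (hσ : 0 < σ) (hσ2 : σ ^ 2 ≤ 1 / 2) : σ ^ w * |p.eval (σ ^ 2)| ≤ 3 * A := by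
  have hA : 0 ≤ A := (abs_nonneg _).trans h0
  have hσ1 : σ ≤ 1 := by nlinarith
  have hσw : σ ^ w ≤ 1 := pow_le_one₀ hσ.le hσ1
  suffices hs : σ ^ w * |p.eval (σ ^ 2) - p.eval (1 / 2)| ≤ 2 * A by
    have h1 : |p.eval (σ ^ 2)| ≤ |p.eval (σ ^ 2) - p.eval (1 / 2)| + |p.eval (1 / 2)| := by
      have := abs_add_le (p.eval (σ ^ 2) - p.eval (1 / 2)) (p.eval (1 / 2))
      rwa [sub_add_cancel] at this
    have h2 : σ ^ w * |p.eval (1 / 2)| ≤ 1 * A :=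
      mul_le_mul hσw h0 (abs_nonneg _) zero_le_one
    nlinarith [mul_le_mul_of_nonneg_left h1 (pow_pos hσ w).le]
  set b := √(1 / 2 : ℝ) with hb
  have hb2 : b ^ 2 = 1 / 2 := Real.sq_sqrt (by norm_num)
  have hb0 : 0 ≤ b := Real.sqrt_nonneg _
  have hσb : σ ≤ b := le_of_sq_le_sq (by rw [hb2]; exact hσ2) hb0
  rcases eq_or_lt_of_le hσb with he | hlt
  · rw [he, hb2]
    simpa using hA
  have hd : ∀ τ : ℝ, HasDerivAt (fun τ => p.eval (τ ^ 2))
      ((derivative p).eval (τ ^ 2) * (2 * τ)) τ := fun τ => by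
    have := (p.hasDerivAt (τ ^ 2)).comp τ (hasDerivAt_pow 2 τ)
    refine this.congr_deriv ?_
    simp
  rcases hw with ⟨rfl, hwpos⟩ | ⟨hw1, rfl⟩
  · have hi : ∀ τ ∈ Icc σ b, HasDerivAt (fun τ : ℝ => τ⁻¹) (-(τ ^ 2)⁻¹) τ := fun τ hτ =>
      hasDerivAt_inv (hσ.trans_le hτ.1).ne'
    obtain ⟨u, hu, he⟩ := exists_ratio_hasDerivAt_eq_ratio_slope (fun τ => p.eval (τ ^ 2)) _ hlt
      (fun τ _ => (hd τ).continuousAt.continuousWithinAt) (fun τ _ => hd τ) (fun τ : ℝ => τ⁻¹)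
      (fun τ => -(τ ^ 2)⁻¹) (fun τ hτ => (hi τ hτ).continuousAt.continuousWithinAt)
      (fun τ hτ => hi τ ⟨hτ.1.le, hτ.2.le⟩)
    have hu0 : 0 < u := hσ.trans hu.1
    have hub : u ^ 2 ≤ 1 / 2 := by rw [← hb2]; gcongr; exact hu.2.le
    have hA' := h u hu0 hub
    have hb0' : 0 < b := hσ.trans hlt
    have hinv : 0 ≤ σ⁻¹ - b⁻¹ := sub_nonneg.mpr (inv_anti₀ hσ hσb)
    have hinv' : σ⁻¹ - b⁻¹ ≤ σ⁻¹ := by linarith [inv_pos.mpr hb0']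
    have e : p.eval (σ ^ 2) - p.eval (1 / 2)
        = -(u ^ 2 * (σ⁻¹ - b⁻¹) * ((derivative p).eval (u ^ 2) * (2 * u))) := by
      simp only [hb2] at he
      have : (p.eval (σ ^ 2) - p.eval (1 / 2)) = u ^ 2 * ((p.eval (1 / 2) - p.eval (σ ^ 2)) * -(u ^ 2)⁻¹) := by
        field_simp
        ring
      rw [this, ← he]
      ring
    have hu3 : |p.eval (σ ^ 2) - p.eval (1 / 2)|
        ≤ u ^ 2 * σ⁻¹ * (|(derivative p).eval (u ^ 2)| * (2 * u)) := by
      rw [e, abs_neg, abs_mul, abs_mul, abs_mul, abs_of_nonneg hinv, abs_of_pos (pow_pos hu0 2),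
        abs_of_pos (by positivity : 0 < 2 * u)]
      gcongr
    obtain ⟨i, rfl⟩ : ∃ i, w = i + 1 := ⟨w - 1, by omega⟩
    calc σ ^ (i + 1) * |p.eval (σ ^ 2) - p.eval (1 / 2)|
          ≤ σ ^ (i + 1) * (u ^ 2 * σ⁻¹ * (|(derivative p).eval (u ^ 2)| * (2 * u))) := by gcongr
        _ = σ ^ i * (2 * (u ^ 3 * |(derivative p).eval (u ^ 2)|)) := by field_simp; ring
        _ ≤ u ^ i * (2 * (u ^ 3 * |(derivative p).eval (u ^ 2)|)) := by
            gcongr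
            exact hu.1.le
        _ = 2 * (u ^ (i + 1 + 2) * |(derivative p).eval (u ^ 2)|) := by ring
        _ ≤ 2 * A := by gcongr
  · obtain ⟨u, hu, he⟩ := exists_hasDerivAt_eq_slope _ _ hlt
      (fun τ _ => (hd τ).continuousAt.continuousWithinAt) (fun τ _ => hd τ)
    have hu0 : 0 < u := hσ.trans hu.1
    have hub : u ^ 2 ≤ 1 / 2 := by rw [← hb2]; gcongr; exact hu.2.le
    have hA' := h u hu0 hub
    have hu1 : u ≤ 1 := by nlinarith
    have hA'' : u * |(derivative p).eval (u ^ 2)| ≤ A := by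
      refine le_trans ?_ hA'
      gcongr
      calc u = u ^ 1 := (pow_one u).symm
        _ ≤ u ^ w' := pow_le_pow_of_le_one hu0.le hu1 hw1
    rw [eq_div_iff (by linarith), hb2] at he
    rw [abs_sub_comm, ← he, pow_zero, one_mul, abs_mul, abs_mul, abs_of_pos (by positivity : 0 < 2 * u),
      abs_of_pos (by linarith : 0 < b - σ)]
    have hb1 : b ≤ 1 := by nlinarith
    calc |(derivative p).eval (u ^ 2)| * (2 * u) * (b - σ)
        ≤ |(derivative p).eval (u ^ 2)| * (2 * u) * 1 := by gcongr; linarith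
      _ = 2 * (u * |(derivative p).eval (u ^ 2)|) := by ring
      _ ≤ 2 * A := by gcongr

end Voronovskaya

section VoronovskayaBounds
open Polynomial

theorem derivative_bound_mid (l : ℕ) (hl : 1 ≤ l) : ∃ K : ℝ, 1 ≤ K ∧ ∀ (g : ℝ[X]) (G M : ℝ),
    (∀ y ∈ Icc (0 : ℝ) 1, |g.eval y| ≤ G) → WBound (2 * l + 1) M g →
    ∀ j ≤ 2 * l, |(derivative^[j] g).eval (1 / 2)| ≤ K * (G + M) := by
  obtain ⟨K, hK, H⟩ := markov_Icc (2 * l)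
  have hfac : (1 : ℝ) ≤ (2 * l).factorial := by
    exact_mod_cast Nat.one_le_iff_ne_zero.mpr (2 * l).factorial_ne_zero
  refine ⟨(2 * l).factorial * K, one_le_mul_of_one_le_of_one_le hfac hK, fun g G M hG hM j hj => ?_⟩
  have hI : (1 / 2 : ℝ) ∈ Icc (0 : ℝ) 1 := ⟨by norm_num, by norm_num⟩
  have hφ : phiDT (1 / 2) = 1 / 2 := by
    refine (pow_left_inj₀ (phiDT_nonneg _) (by norm_num) (by norm_num : (2 : ℕ) ≠ 0)).mp ?_
    rw [phiDT_sq hI]; norm_num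
  have hM0 := hM.nonneg
  have hP : ∀ y ∈ Icc (0 : ℝ) 1, |(taylorTrunc (1 / 2) (2 * l + 1) g).eval y| ≤ G + M := by
    intro y hy
    have h1 := hM.taylor (by omega) hI hy
    rw [hφ] at h1
    have h2 : |y - 1 / 2| ≤ 1 / 2 := by
      rw [abs_le]; constructor <;> linarith [hy.1, hy.2]
    have h3 : M * |y - 1 / 2| ^ (2 * l + 1) ≤ M * (1 / 2) ^ (2 * l + 1) := by gcongr
    have h4 : |g.eval y - (taylorTrunc (1 / 2) (2 * l + 1) g).eval y| ≤ M := by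
      refine le_of_mul_le_mul_left ?_ (by positivity : (0 : ℝ) < (1 / 2) ^ (2 * l + 1))
      linarith
    have h5 := hG y hy
    rw [abs_le] at h4 h5 ⊢
    constructor <;> linarith
  have h1 := H _ 0 1 (G + M) (natDegree_taylorTrunc (1 / 2) (2 * l + 1) g) zero_lt_one hP (1 / 2) hI j
  rw [coeff_taylor_taylorTrunc, if_pos (by omega), sub_zero, one_pow, mul_one] at h1
  have h0 : 0 ≤ K * (G + M) := (abs_nonneg _).trans h1
  rw [eval_iterate_derivative_eq, abs_mul, abs_of_nonneg (by positivity), mul_assoc]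
  have hjf : (j.factorial : ℝ) ≤ (2 * l).factorial := by exact_mod_cast Nat.factorial_le hj
  exact mul_le_mul hjf h1 (abs_nonneg _) (by positivity)

theorem derivative_bound (l : ℕ) (hl : 1 ≤ l) : ∃ K : ℝ, 1 ≤ K ∧ ∀ (g : ℝ[X]) (G M : ℝ),
    (∀ y ∈ Icc (0 : ℝ) 1, |g.eval y| ≤ G) → WBound (2 * l + 1) M g →
    ∀ j ≤ 2 * l + 1, ∀ σ : ℝ, 0 < σ → σ ^ 2 ≤ 1 / 2 →
      σ ^ (2 * (j - l) - 1) * |(derivative^[j] g).eval (σ ^ 2)| ≤ K * (G + M) := by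
  obtain ⟨K₀, hK₀, H₀⟩ := derivative_bound_mid l hl
  have key : ∀ i : ℕ, ∃ K : ℝ, 1 ≤ K ∧ ∀ (g : ℝ[X]) (G M : ℝ),
    (∀ y ∈ Icc (0 : ℝ) 1, |g.eval y| ≤ G) → WBound (2 * l + 1) M g →
    ∀ j ≤ 2 * l + 1, 2 * l + 1 ≤ j + i → ∀ σ : ℝ, 0 < σ → σ ^ 2 ≤ 1 / 2 →
      σ ^ (2 * (j - l) - 1) * |(derivative^[j] g).eval (σ ^ 2)| ≤ K * (G + M) := by
    intro i
    induction i with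
    | zero =>
      refine ⟨2 ^ (2 * l + 1), one_le_pow₀ (by norm_num), fun g G M hG hM j hj hji σ hσ hσ2 => ?_⟩
      obtain rfl : j = 2 * l + 1 := by omega
      have hG0 : 0 ≤ G := (abs_nonneg _).trans (hG 0 (by simp))
      have hI : σ ^ 2 ∈ Icc (0 : ℝ) 1 := ⟨by positivity, by linarith⟩
      have h1 := hM _ hI
      have h2 : σ ≤ 2 * phiDT (σ ^ 2) := by
        refine le_of_sq_le_sq ?_ (mul_nonneg zero_le_two (phiDT_nonneg _))
        rw [mul_pow, phiDT_sq hI]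
        nlinarith [sq_nonneg σ]
      rw [show 2 * (2 * l + 1 - l) - 1 = 2 * l + 1 by omega]
      calc σ ^ (2 * l + 1) * |(derivative^[2 * l + 1] g).eval (σ ^ 2)|
          ≤ (2 * phiDT (σ ^ 2)) ^ (2 * l + 1) * |(derivative^[2 * l + 1] g).eval (σ ^ 2)| := by gcongr
        _ = 2 ^ (2 * l + 1) * (phiDT (σ ^ 2) ^ (2 * l + 1)
            * |(derivative^[2 * l + 1] g).eval (σ ^ 2)|) := by rw [mul_pow]; ring
        _ ≤ 2 ^ (2 * l + 1) * (G + M) := by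
            gcongr
            linarith
    | succ i ih =>
      obtain ⟨K, hK, H⟩ := ih
      refine ⟨3 * (K * K₀), by linarith [one_le_mul_of_one_le_of_one_le hK hK₀],
        fun g G M hG hM j hj hji σ hσ hσ2 => ?_⟩
      have hG0 : 0 ≤ G := (abs_nonneg _).trans (hG 0 (by simp))
      have hM0 := hM.nonneg
      have hle1 : K * (G + M) ≤ K * K₀ * (G + M) := by
        gcongr
        exact le_mul_of_one_le_right (by linarith) hK₀
      have hle2 : K₀ * (G + M) ≤ K * K₀ * (G + M) := by
        gcongr
        exact le_mul_of_one_le_left (by linarith) hK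
      rcases Nat.lt_or_ge (j + i) (2 * l + 1) with hlt | hge
      · have hw : (2 * (j + 1 - l) - 1 = 2 * (j - l) - 1 + 2 ∧ 1 ≤ 2 * (j - l) - 1) ∨
            (2 * (j + 1 - l) - 1 ≤ 1 ∧ 2 * (j - l) - 1 = 0) := by omega
        rcases Nat.lt_or_ge j (2 * l + 1) with hj' | hj'
        · rw [mul_assoc]
          refine singular_step hw ((H₀ g G M hG hM j (by omega)).trans hle2) (fun τ hτ hτ2 => ?_) hσ hσ2
          have := H g G M hG hM (j + 1) (by omega) (by omega) τ hτ hτ2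
          rw [Function.iterate_succ_apply'] at this
          exact this.trans hle1
        · omega
      · refine (H g G M hG hM j hj hge σ hσ hσ2).trans (hle1.trans ?_)
        have : 0 ≤ K * K₀ * (G + M) := by positivity
        linarith
  obtain ⟨K, hK, H⟩ := key (2 * l + 1)
  exact ⟨K, hK, fun g G M hG hM j hj => H g G M hG hM j hj (by omega)⟩

theorem taylorTrunc_coeff_bound (l : ℕ) (hl : 1 ≤ l) : ∃ K : ℝ, 1 ≤ K ∧
    ∀ (g : ℝ[X]) (G M c s : ℝ), (∀ y ∈ Icc (0 : ℝ) 1, |g.eval y| ≤ G) → WBound (2 * l + 1) M g →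
    0 < s → c = s ^ 2 → c ≤ 1 / 2 →
    (∀ j ≤ l, |(taylor c (taylorTrunc c (2 * l + 1) g)).coeff j| ≤ K * (G + M)) ∧
    (∀ j, l < j → |(taylor c (taylorTrunc c (2 * l + 1) g)).coeff j| * c ^ j
      ≤ K * (G + M) * (c ^ l * s)) := by
  obtain ⟨K, hK, H⟩ := derivative_bound l hl
  refine ⟨K, hK, fun g G M c s hG hM hs hc hc2 => ?_⟩
  have hG0 : 0 ≤ G := (abs_nonneg _).trans (hG 0 (by simp))
  have hM0 := hM.nonneg
  have hcoeff : ∀ j ≤ 2 * l + 1, s ^ (2 * (j - l) - 1) * |(taylor c g).coeff j| ≤ K * (G + M) := by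
    intro j hj
    refine le_trans ?_ (H g G M hG hM j hj s hs (hc ▸ hc2))
    rw [← hc, eval_iterate_derivative_eq, abs_mul]
    gcongr
    refine le_mul_of_one_le_left (abs_nonneg _) ?_
    rw [Nat.abs_cast]
    exact_mod_cast Nat.one_le_iff_ne_zero.mpr j.factorial_ne_zero
  constructor
  · intro j hj
    have := hcoeff j (by omega)
    rw [show 2 * (j - l) - 1 = 0 by omega, pow_zero, one_mul] at this
    rwa [coeff_taylor_taylorTrunc, if_pos (by omega)]
  · intro j hj
    rw [coeff_taylor_taylorTrunc]
    split_ifs with hj2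
    · have h1 := mul_le_mul_of_nonneg_right (hcoeff j (by omega)) (by positivity : 0 ≤ s ^ (2 * l + 1))
      have e : 2 * j = 2 * (j - l) - 1 + (2 * l + 1) := by omega
      calc |(taylor c g).coeff j| * c ^ j
          = s ^ (2 * (j - l) - 1) * |(taylor c g).coeff j| * s ^ (2 * l + 1) := by
            rw [hc, ← pow_mul, e, pow_add]; ring
        _ ≤ K * (G + M) * s ^ (2 * l + 1) := h1
        _ = _ := by rw [hc, ← pow_mul, pow_succ]
    · rw [abs_zero, zero_mul, hc]
      positivity

theorem pow_dvd_EP {c : ℝ} {k : ℕ} {p : ℝ[X]} (h : (X - C c) ^ (k + 2) ∣ p) :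
    (X - C c) ^ k ∣ EP p := by
  rw [EP_apply]
  refine Dvd.dvd.mul_left ?_ _
  have h1 := pow_sub_one_dvd_derivative_of_pow_dvd h
  have h2 := pow_sub_one_dvd_derivative_of_pow_dvd h1
  exact h2

theorem EP_pow_eval_eq_zero {c : ℝ} (l : ℕ) : ∀ {p : ℝ[X]}, (X - C c) ^ (2 * l + 1) ∣ p →
    ((EP ^ l) p).eval c = 0 := by
  induction l with
  | zero =>
    intro p h
    rw [mul_zero, zero_add, pow_one] at h
    simpa using dvd_iff_isRoot.mp h
  | succ l ih =>
    intro p h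
    rw [pow_succ, Module.End.mul_apply]
    exact ih (pow_dvd_EP (by rwa [show 2 * l + 1 + 2 = 2 * (l + 1) + 1 by ring]))

theorem EP_pow_eval_taylorTrunc (l : ℕ) (c : ℝ) (g : ℝ[X]) :
    ((EP ^ l) g).eval c = ((EP ^ l) (taylorTrunc c (2 * l + 1) g)).eval c := by
  have := EP_pow_eval_eq_zero l (pow_dvd_sub_taylorTrunc c (2 * l + 1) g)
  rw [map_sub, eval_sub] at this
  linarith

end VoronovskayaBounds

section InverseStep
open Polynomial

theorem TP_pow_remainder (l : ℕ) : ∃ K : ℝ, 1 ≤ K ∧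
    ∀ (g : ℝ[X]) (M c s μ : ℝ) (m : ℕ), WBound (2 * l + 1) M g → 1 ≤ l → 1 ≤ m → 0 < s → c = s ^ 2 →
    c ≤ 1 / 2 → 0 < μ → m * μ ^ 2 = 1 → μ ≤ s →
    |(((TP m) ^ l) (g - taylorTrunc c (2 * l + 1) g)).eval c| ≤ K * (M * μ ^ (2 * l + 1)) := by
  obtain ⟨K, hK, H⟩ := cone_TopL_pow (2 * l + 1) l
  refine ⟨K * 2 ^ (2 * l + 1), one_le_mul_of_one_le_of_one_le hK (one_le_pow₀ (by norm_num)),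
    fun g M c s μ m hM hl hm hs hc hc2 hμ hmμ hμs => ?_⟩
  have hM0 := hM.nonneg
  have hc0 : 0 < c := by rw [hc]; positivity
  have hcI : c ∈ Icc (0 : ℝ) 1 := ⟨hc0.le, by linarith⟩
  have hm0 : (0 : ℝ) < m := by positivity
  have hW : WeightOK m c (s * μ) := by
    refine ⟨hm, hcI, by positivity, ?_, ?_⟩
    · rw [mul_pow, mul_left_comm, hmμ, mul_one, ← hc]
      nlinarith
    · rw [← hmμ, sq]
      gcongr
  have hφ : s ≤ 2 * phiDT c := by
    refine le_of_sq_le_sq ?_ (mul_nonneg zero_le_two (phiDT_nonneg _))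
    rw [mul_pow, phiDT_sq hcI, ← hc]
    nlinarith
  have hu : ∀ y ∈ Icc (0 : ℝ) 1, |(g - taylorTrunc c (2 * l + 1) g).eval y|
      ≤ (2 ^ (2 * l + 1) / s ^ (2 * l + 1) * M) * (s * μ + |y - c|) ^ (2 * l + 1) := by
    intro y hy
    have h1 := hM.taylor (by omega) hcI hy
    rw [← eval_sub] at h1
    set D := |(g - taylorTrunc c (2 * l + 1) g).eval y| with hD
    have hD0 : 0 ≤ D := abs_nonneg _
    have h2 : s ^ (2 * l + 1) * D ≤ 2 ^ (2 * l + 1) * (M * (s * μ + |y - c|) ^ (2 * l + 1)) := by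
      calc s ^ (2 * l + 1) * D ≤ (2 * phiDT c) ^ (2 * l + 1) * D := by gcongr
        _ = 2 ^ (2 * l + 1) * (phiDT c ^ (2 * l + 1) * D) := by rw [mul_pow]; ring
        _ ≤ 2 ^ (2 * l + 1) * (M * |y - c| ^ (2 * l + 1)) := by gcongr
        _ ≤ _ := by
            gcongr
            linarith [mul_pos hs hμ]
    rw [show 2 ^ (2 * l + 1) / s ^ (2 * l + 1) * M * (s * μ + |y - c|) ^ (2 * l + 1)
      = 2 ^ (2 * l + 1) * (M * (s * μ + |y - c|) ^ (2 * l + 1)) / s ^ (2 * l + 1) by ring,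
      le_div_iff₀ (by positivity), mul_comm]
    exact h2
  have h1 := H m c (s * μ) _ _ hW hu c hcI
  rw [← eval_TP_pow, sub_self, abs_zero, add_zero, mul_pow] at h1
  refine h1.trans (le_of_eq ?_)
  field_simp

/-- The `l`-th power of `x(1-x)D²` is controlled by `T_m^l` up to a Voronovskaya error. -/
theorem EP_pow_bound_half (l : ℕ) (hl : 1 ≤ l) : ∃ K : ℝ, 1 ≤ K ∧
    ∀ (g : ℝ[X]) (G M μ τ : ℝ) (m : ℕ), 1 ≤ m → 0 < μ → m * μ ^ 2 = 1 →
    (∀ y ∈ Icc (0 : ℝ) 1, |g.eval y| ≤ G) → WBound (2 * l + 1) M g →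
    (∀ y ∈ Icc (0 : ℝ) 1, |(((TP m) ^ l) g).eval y| ≤ τ) →
    ∀ x : ℝ, 0 ≤ x → x ≤ 1 / 2 → |((EP ^ l) g).eval x| ≤ K * ((m : ℝ) ^ l * τ + (G + M) * μ) := by
  obtain ⟨K₁, hK₁, H₁⟩ := taylorTrunc_coeff_bound l hl
  obtain ⟨K₂, hK₂, H₂⟩ := TP_pow_compare_local (2 * l) l
  obtain ⟨K₃, hK₃, H₃⟩ := EP_pow_local (2 * l) l hl
  obtain ⟨K₄, hK₄, H₄⟩ := TP_pow_remainder l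
  refine ⟨2 ^ l * (1 + K₂ * K₁ + K₄) + K₃ * K₁, ?_,
    fun g G M μ τ m hm hμ hmμ hG hM hτ x hx hx2 => ?_⟩
  · have h1 : (1 : ℝ) ≤ 2 ^ l := one_le_pow₀ (by norm_num)
    have h2 : 0 < K₂ * K₁ := by positivity
    have h3 : 0 < K₃ * K₁ := by positivity
    nlinarith
  have hG0 : 0 ≤ G := (abs_nonneg _).trans (hG 0 (by simp))
  have hM0 := hM.nonneg
  have hτ0 : 0 ≤ τ := (abs_nonneg _).trans (hτ 0 (by simp))
  have hm0 : (0 : ℝ) < m := by positivity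
  rcases eq_or_lt_of_le hx with h0 | h0
  · rw [← h0, EP_pow_eval_zero hl, abs_zero]
    positivity
  set s := √x with hs
  have hs0 : 0 < s := Real.sqrt_pos.mpr h0
  have hxs : x = s ^ 2 := (Real.sq_sqrt hx).symm
  obtain ⟨hc1, hc2⟩ := H₁ g G M x s hG hM hs0 hxs hx2
  set P := taylorTrunc x (2 * l + 1) g with hP
  have hPd : P.natDegree ≤ 2 * l := natDegree_taylorTrunc _ _ _
  have hH0 : 0 ≤ K₁ * (G + M) := by positivity
  rcases le_total s μ with hsμ | hsμ
  · rw [EP_pow_eval_taylorTrunc]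
    refine (H₃ P x s _ hPd hs0 hxs hx2 hH0 hc1 hc2).trans ?_
    calc K₃ * (K₁ * (G + M) * s) ≤ K₃ * (K₁ * (G + M) * μ) := by gcongr
      _ = (0 + K₃ * K₁) * (0 + (G + M) * μ) := by ring
      _ ≤ _ := by gcongr <;> positivity
  · have h1 := H₂ P m x s μ _ hPd hm hs0 hxs hx2 hμ hmμ hsμ hH0 hc1 hc2
    have h2 := H₄ g M x s μ m hM hl hm hs0 hxs hx2 hμ hmμ hsμ
    have h3 := hτ x ⟨hx, by linarith⟩
    rw [map_sub, eval_sub, ← hP] at h2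
    rw [_root_.smul_pow, LinearMap.smul_apply, eval_smul, smul_eq_mul, ← EP_pow_eval_taylorTrunc] at h1
    set E := ((EP ^ l) g).eval x with hE
    have h4 : |(-(1 / (2 * (m : ℝ)))) ^ l * E|
        ≤ τ + K₄ * (M * μ ^ (2 * l + 1)) + K₂ * (K₁ * (G + M) * μ ^ (2 * l + 1)) := by
      rw [abs_le] at h1 h2 h3 ⊢
      constructor <;> linarith
    rw [abs_mul, abs_pow, abs_neg, abs_of_pos (by positivity : 0 < 1 / (2 * (m : ℝ)))] at h4
    have hmul : (m : ℝ) ^ l * μ ^ (2 * l + 1) = μ := by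
      rw [pow_succ, pow_mul, ← mul_assoc, ← mul_pow, hmμ, one_pow, one_mul]
    calc |E| = (2 * (m : ℝ)) ^ l * ((1 / (2 * (m : ℝ))) ^ l * |E|) := by
          rw [← mul_assoc, ← mul_pow, mul_one_div_cancel (by positivity), one_pow, one_mul]
      _ ≤ (2 * (m : ℝ)) ^ l * (τ + K₄ * (M * μ ^ (2 * l + 1))
          + K₂ * (K₁ * (G + M) * μ ^ (2 * l + 1))) := by gcongr
      _ = 2 ^ l * ((m : ℝ) ^ l * τ + (K₄ * M + K₂ * K₁ * (G + M)) * ((m : ℝ) ^ l * μ ^ (2 * l + 1))) := by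
          rw [mul_pow]; ring
      _ = 2 ^ l * (1 * ((m : ℝ) ^ l * τ) + K₄ * (M * μ) + K₂ * K₁ * ((G + M) * μ)) := by
          rw [hmul]; ring
      _ ≤ 2 ^ l * (1 * ((m : ℝ) ^ l * τ + (G + M) * μ) + K₄ * ((m : ℝ) ^ l * τ + (G + M) * μ)
          + K₂ * K₁ * ((m : ℝ) ^ l * τ + (G + M) * μ)) := by
          have e1 : 0 ≤ (m : ℝ) ^ l * τ := by positivity
          have e2 : 0 ≤ G * μ := by positivity
          have e3 : 0 ≤ M * μ := by positivity
          gcongr <;> nlinarith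
      _ = (2 ^ l * (1 + K₂ * K₁ + K₄) + 0) * ((m : ℝ) ^ l * τ + (G + M) * μ) := by ring
      _ ≤ _ := by gcongr; positivity

theorem EP_pow_reflect (l : ℕ) (p : ℝ[X]) :
    ((EP ^ l) p).comp (1 - X) = (EP ^ l) (p.comp (1 - X)) := by
  induction l with
  | zero => simp
  | succ l ih =>
    rw [pow_succ', Module.End.mul_apply, Module.End.mul_apply, ← ih, EP_apply, EP_apply]
    simp only [derivative_comp, mul_comp, sub_comp, X_comp, one_comp, derivative_mul,
      derivative_sub, derivative_one, derivative_X, derivative_zero]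
    ring

/-- Weighted smoothness of `g` from the decay of `T_m^l g`, up to a Voronovskaya error. -/
theorem WBound_of_TP_pow (l : ℕ) (hl : 1 ≤ l) : ∃ K : ℝ, 1 ≤ K ∧
    ∀ (g : ℝ[X]) (G M μ τ : ℝ) (m : ℕ), 1 ≤ m → 0 < μ → m * μ ^ 2 = 1 →
    (∀ y ∈ Icc (0 : ℝ) 1, |g.eval y| ≤ G) → WBound (2 * l + 1) M g →
    (∀ y ∈ Icc (0 : ℝ) 1, |(((TP m) ^ l) g).eval y| ≤ τ) →
    WBound (2 * l) (K * ((m : ℝ) ^ l * τ + (G + M) * μ)) g := by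
  obtain ⟨K, hK, H⟩ := EP_pow_bound_half l hl
  obtain ⟨C, hC, H'⟩ := WBound_of_EP_pow l 0
  refine ⟨C * K, one_le_mul_of_one_le_of_one_le hC hK, fun g G M μ τ m hm hμ hmμ hG hM hτ => ?_⟩
  have h1 : WBound (2 * 0) (K * ((m : ℝ) ^ l * τ + (G + M) * μ)) ((EP ^ l) g) := by
    refine WBound.of_half (fun x hx hx2 => ?_) (fun x hx hx2 => ?_)
    · simpa using H g G M μ τ m hm hμ hmμ hG hM hτ x hx hx2
    · rw [EP_pow_reflect]
      have := H (g.comp (1 - X)) G M μ τ m hm hμ hmμ (fun y hy => by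
        simpa [eval_comp] using hG _ (one_sub_mem_Icc hy)) hM.reflect (fun y hy => by
        rw [← TP_pow_reflect hm]
        simpa [eval_comp] using hτ _ (one_sub_mem_Icc hy)) x hx hx2
      simpa using this
  have h2 := H' _ g h1
  rwa [zero_add, ← mul_assoc] at h2

end InverseStep

section Converse
open Polynomial

theorem WBound.sub {k : ℕ} {M M' : ℝ} {g p : ℝ[X]} (hg : WBound k M g) (hp : WBound k M' p) :
    WBound k (M + M') (g - p) := by
  intro x hx
  have h1 := hg x hx
  have h2 := hp x hx
  rw [iterate_map_sub, eval_sub]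
  have h3 := mul_le_mul_of_nonneg_left
    (abs_sub ((derivative^[k] g).eval x) ((derivative^[k] p).eval x)) (pow_nonneg (phiDT_nonneg x) k)
  rw [mul_add] at h3
  linarith

theorem WBound.mono {k : ℕ} {M M' : ℝ} {g : ℝ[X]} (hg : WBound k M g) (h : M ≤ M') :
    WBound k M' g := fun x hx => (hg x hx).trans h

theorem continuous_phiDT : Continuous phiDT := by
  unfold phiDT
  fun_prop

theorem WBound.absorb {k : ℕ} {A : ℝ} {g : ℝ[X]}
    (h : ∀ M, WBound k M g → WBound k (A + M / 2) g) : WBound k (2 * A) g := by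
  have hc : Continuous fun x => phiDT x ^ k * |(derivative^[k] g).eval x| :=
    (continuous_phiDT.pow k).mul (Polynomial.continuous _).abs
  obtain ⟨x₀, hx₀, hmax⟩ := isCompact_Icc.exists_isMaxOn (nonempty_Icc.mpr (zero_le_one' ℝ))
    hc.continuousOn
  have h1 : WBound k (phiDT x₀ ^ k * |(derivative^[k] g).eval x₀|) g := fun x hx => hmax hx
  have h2 := h _ h1 x₀ hx₀
  exact h1.mono (by linarith)

/-- Simultaneous approximation and weighted smoothness of the generalized Bernstein polynomial
under the assumed rate. -/
theorem exists_smooth_approx (l : ℕ) (hl : 1 ≤ l) {f : ℝ → ℝ} {F lam C₁ : ℝ} (hlam : 0 < lam)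
    (hlam2 : lam ≤ 2 * l) (hC₁ : 0 ≤ C₁) (hF : ∀ x ∈ Icc (0 : ℝ) 1, |f x| ≤ F)
    (hrate : ∀ m : ℕ, 1 ≤ m → ∀ x ∈ Icc (0 : ℝ) 1,
      |((TopL m) ^ l) f x| ≤ C₁ * (m : ℝ) ^ (-(lam / 2))) :
    ∃ C : ℝ, 0 ≤ C ∧ ∀ n : ℕ, 2 ≤ n → ∃ p : ℝ[X],
      (∀ x ∈ Icc (0 : ℝ) 1, |f x - p.eval x| ≤ C * (n : ℝ) ^ (-(lam / 2))) ∧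
      WBound (2 * l) (C * (n : ℝ) ^ (l - lam / 2)) p := by
  obtain ⟨K₀, hK₀, H₀⟩ := WBound_of_TP_pow l hl
  obtain ⟨K₁, hK₁, H₁⟩ := WBound_BPoly (2 * l)
  obtain ⟨K₂, hK₂, H₂⟩ := WBound_genBernstein l hl
  obtain ⟨KT, hKT, HT⟩ := TopL_pow_bound l
  obtain ⟨KQ, hKQ, HQ⟩ := Qop_bound l
  obtain ⟨q, hq⟩ := exists_nat_gt (2 * (K₀ * K₂))
  have hq0 : (0 : ℝ) < q := lt_trans (by positivity) hq
  have hqN : 0 < q := by exact_mod_cast hq0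
  have hF0 : 0 ≤ F := (abs_nonneg _).trans (hF 0 (by simp))
  set G := F + (2 + KT) * C₁ with hG
  have hG0 : 0 ≤ G := by positivity
  set A := K₀ * (((q : ℝ) ^ 2) ^ l * ((1 + KT * (2 + KT)) * C₁) + G) + K₁ * KQ * C₁ with hA
  have hA0 : 0 ≤ A := by positivity
  refine ⟨C₁ + 2 * A, by positivity, fun n hn => ?_⟩
  have hn0 : (0 : ℝ) < n := by positivity
  have hn1 : (1 : ℝ) ≤ n := by exact_mod_cast (by omega : 1 ≤ n)
  set Λ : ℝ := C₁ * (n : ℝ) ^ (-(lam / 2)) with hΛ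
  have hΛ0 : 0 ≤ Λ := by positivity
  have hΛ1 : Λ ≤ C₁ := mul_le_of_le_one_right hC₁
    (Real.rpow_le_one_of_one_le_of_nonpos hn1 (by linarith))
  have hnΛ : (n : ℝ) ^ l * Λ = C₁ * (n : ℝ) ^ ((l : ℝ) - lam / 2) := by
    rw [sub_eq_add_neg, Real.rpow_add hn0, Real.rpow_natCast, hΛ]; ring
  have hpow1 : 1 ≤ (n : ℝ) ^ ((l : ℝ) - lam / 2) := Real.one_le_rpow hn1 (by linarith)
  set h : ℝ[X] := BPoly n (Qop n l f) with hh
  have heval : ∀ x, h.eval x = f x - ((TopL n) ^ l) f x := fun x => by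
    rw [hh, eval_BPoly, Bop_Qop]; rfl
  have hfh : ∀ x ∈ Icc (0 : ℝ) 1, |f x - h.eval x| ≤ Λ := fun x hx => by
    rw [heval, sub_sub_cancel]
    exact hrate n (by omega) x hx
  set g : ℝ[X] := h - ((TP n) ^ l) h with hg
  have hhg : ∀ x ∈ Icc (0 : ℝ) 1, |h.eval x - g.eval x| ≤ (1 + KT) * Λ := fun x hx => by
    rw [hg, eval_sub, sub_sub_cancel, eval_TP_pow]
    have e : (fun y => h.eval y) = f - (fun y => f y - h.eval y) := by funext y; simp
    rw [e, map_sub, Pi.sub_apply]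
    have h1 := hrate n (by omega) x hx
    have h2 := HT n Λ (fun y => f y - h.eval y) (by omega) hfh x hx
    refine (abs_sub _ _).trans ?_
    linarith
  have hfg : ∀ x ∈ Icc (0 : ℝ) 1, |f x - g.eval x| ≤ (2 + KT) * Λ := fun x hx => by
    have h1 := hfh x hx
    have h2 := hhg x hx
    rw [abs_le] at h1 h2 ⊢
    constructor <;> linarith
  have hgG : ∀ x ∈ Icc (0 : ℝ) 1, |g.eval x| ≤ G := fun x hx => by
    have h1 := hfg x hx
    have h2 := hF x hx
    have h3 : (2 + KT) * Λ ≤ (2 + KT) * C₁ := by gcongr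
    rw [abs_le] at h1 h2 ⊢
    constructor <;> linarith
  set m := q ^ 2 * n with hm
  have hm1 : 1 ≤ m := Nat.one_le_iff_ne_zero.mpr (by positivity)
  have hmR : (m : ℝ) = q ^ 2 * n := by rw [hm]; push_cast; ring
  have hnm : (n : ℝ) ≤ m := by
    exact_mod_cast (Nat.le_mul_of_pos_left n (by positivity) : n ≤ q ^ 2 * n)
  have hgT : ∀ x ∈ Icc (0 : ℝ) 1, |(((TP m) ^ l) g).eval x| ≤ (1 + KT * (2 + KT)) * Λ := fun x hx => by
    rw [eval_TP_pow]
    have e : (fun y => g.eval y) = f - (fun y => f y - g.eval y) := by funext y; simp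
    rw [e, map_sub, Pi.sub_apply]
    have h1 : |((TopL m) ^ l) f x| ≤ Λ := by
      refine (hrate m hm1 x hx).trans ?_
      rw [hΛ]
      refine mul_le_mul_of_nonneg_left ?_ hC₁
      exact Real.rpow_le_rpow_of_nonpos hn0 hnm (by linarith)
    have h2 := HT m _ (fun y => f y - g.eval y) hm1 hfg x hx
    refine (abs_sub _ _).trans ?_
    linarith
  set μ : ℝ := 1 / (q * √n) with hμ
  have hsn : √(n : ℝ) ^ 2 = n := Real.sq_sqrt hn0.le
  have hsn1 : 1 ≤ √(n : ℝ) := Real.one_le_sqrt.mpr hn1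
  have hsn0 : 0 < √(n : ℝ) := by linarith
  have hμ0 : 0 < μ := by positivity
  have hmμ : (m : ℝ) * μ ^ 2 = 1 := by
    rw [hmR, hμ, div_pow, mul_pow, hsn]
    field_simp
  have hμ1 : μ ≤ 1 := by
    have : (1 : ℝ) ≤ q := by exact_mod_cast hqN
    rw [hμ, div_le_one (by positivity)]
    exact one_le_mul_of_one_le_of_one_le this hsn1
  have hdiff : WBound (2 * l) (K₁ * √n ^ (2 * l) * (KQ * Λ)) (g - h) := by
    have e : g - h = BPoly n (Qop n l (fun y => h.eval y - f y)) := by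
      refine Polynomial.funext fun x => ?_
      have e1 : (fun y => h.eval y - f y) = (fun y => h.eval y) - f := rfl
      rw [eval_BPoly, Bop_Qop, e1, map_sub, eval_sub, hg, eval_sub, eval_TP_pow]
      simp only [Pi.sub_apply, heval]
      ring
    rw [e]
    exact H₁ n _ _ hn (HQ n Λ _ (by omega) fun y hy => by rw [abs_sub_comm]; exact hfh y hy)
  have hpow : √(n : ℝ) ^ (2 * l) = (n : ℝ) ^ l := by rw [pow_mul, hsn]
  refine ⟨h, fun x hx => (hfh x hx).trans ?_, ?_⟩
  · rw [hΛ]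
    gcongr
    linarith
  have hmain : WBound (2 * l) (2 * (A * (n : ℝ) ^ ((l : ℝ) - lam / 2))) h := by
    refine WBound.absorb fun M hM => ?_
    have hM0 := hM.nonneg
    have h1 := H₀ g G (K₂ * √n * M) μ _ m hm1 hμ0 hmμ hgG (H₂ n M h hn hM) hgT
    have h2 := h1.sub hdiff
    rw [sub_sub_cancel] at h2
    refine h2.mono ?_
    have e1 : K₂ * √n * M * μ = K₂ * M / q := by rw [hμ]; field_simp
    have e2 : K₀ * (K₂ * M / q) ≤ M / 2 := by
      rw [mul_div_assoc', div_le_div_iff₀ hq0 (by norm_num)]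
      nlinarith
    have e3 : G * μ ≤ G * (n : ℝ) ^ ((l : ℝ) - lam / 2) := by
      gcongr
      linarith
    rw [hpow, hmR, mul_pow, add_mul G, e1]
    calc K₀ * (((q : ℝ) ^ 2) ^ l * (n : ℝ) ^ l * ((1 + KT * (2 + KT)) * Λ) + (G * μ + K₂ * M / q))
          + K₁ * (n : ℝ) ^ l * (KQ * Λ)
        = K₀ * (((q : ℝ) ^ 2) ^ l * ((1 + KT * (2 + KT)) * ((n : ℝ) ^ l * Λ)) + G * μ)
          + K₁ * KQ * ((n : ℝ) ^ l * Λ) + K₀ * (K₂ * M / q) := by ring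
      _ ≤ K₀ * (((q : ℝ) ^ 2) ^ l * ((1 + KT * (2 + KT)) * ((n : ℝ) ^ l * Λ))
            + G * (n : ℝ) ^ ((l : ℝ) - lam / 2))
          + K₁ * KQ * ((n : ℝ) ^ l * Λ) + M / 2 := by gcongr
      _ = A * (n : ℝ) ^ ((l : ℝ) - lam / 2) + M / 2 := by rw [hnΛ, hA]; ring
  refine hmain.mono ?_
  rw [← mul_assoc]
  gcongr
  linarith

end Converse

section ModulusBound
open Polynomial

theorem altSum_eval_eq_zero {r : ℕ} {P : ℝ[X]} (hP : P.natDegree < r) (y u : ℝ) :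
    altSum r (fun t => P.eval t) y u = 0 := by
  have hQ : (P.comp (C y + C u * X)).natDegree < r := by
    refine lt_of_le_of_lt natDegree_comp_le (lt_of_le_of_lt ?_ hP)
    have : (C y + C u * X : ℝ[X]).natDegree ≤ 1 := by compute_degree
    exact (Nat.mul_le_mul_left _ this).trans (by simp)
  have h0 := congrFun (Polynomial.fwdDiff_iter_eq_zero_of_degree_lt hQ) 0
  have h1 := abs_fwdDiff_iter r (fun t => (P.comp (C y + C u * X)).eval t) 0 1
  have h2 : (fwdDiff (1 : ℝ))^[r] (fun t => (P.comp (C y + C u * X)).eval t) 0 = 0 := h0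
  rw [h2, abs_zero] at h1
  have h3 := abs_eq_zero.mp h1.symm
  rw [← h3, altSum, altSum]
  refine Finset.sum_congr rfl fun k _ => ?_
  simp only [eval_comp, eval_add, eval_mul, eval_C, eval_X, zero_add, mul_one, mul_comm u]

theorem abs_dtDiff_le {r : ℕ} {h x B : ℝ} {f : ℝ → ℝ}
    (H : ∀ k ≤ r, |f (x + ((r : ℝ) - 2 * k) * (h / 2) * phiDT x)| ≤ B) :
    |dtDiff r h f x| ≤ 2 ^ r * B := by
  have e : (2 : ℝ) ^ r = ∑ k ∈ Finset.range (r + 1), (r.choose k : ℝ) := by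
    exact_mod_cast (Nat.sum_range_choose r).symm
  rw [dtDiff, e, Finset.sum_mul]
  refine (Finset.abs_sum_le_sum_abs _ _).trans (Finset.sum_le_sum fun k hk => ?_)
  rw [abs_mul, abs_mul, abs_pow, abs_neg, abs_one, one_pow, one_mul, Nat.abs_cast]
  exact mul_le_mul_of_nonneg_left (H k (Nat.lt_succ_iff.mp (Finset.mem_range.mp hk)))
    (Nat.cast_nonneg _)

theorem dtDiff_sub (r : ℕ) (h : ℝ) (f g : ℝ → ℝ) (x : ℝ) :
    dtDiff r h (fun y => f y - g y) x = dtDiff r h f x - dtDiff r h g x := by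
  simp only [dtDiff, mul_sub, Finset.sum_sub_distrib]

theorem abs_dtDiff_le_of_polynomial {l : ℕ} {h x B : ℝ} {f : ℝ → ℝ} {P : ℝ[X]}
    (hP : P.natDegree < 2 * l)
    (H : ∀ k ≤ 2 * l, |f (x + (((2 * l : ℕ) : ℝ) - 2 * k) * (h / 2) * phiDT x)
      - P.eval (x + (((2 * l : ℕ) : ℝ) - 2 * k) * (h / 2) * phiDT x)| ≤ B) :
    |dtDiff (2 * l) h f x| ≤ 2 ^ (2 * l) * B := by
  have := abs_dtDiff_le (f := fun y => f y - P.eval y) H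
  rwa [dtDiff_sub, dtDiff_eq_altSum l h (fun y => P.eval y), altSum_eval_eq_zero hP, sub_zero] at this

theorem WBound.abs_dtDiff_le {l : ℕ} (hl : 1 ≤ l) {M h x : ℝ} {p : ℝ[X]} (hp : WBound (2 * l) M p)
    (hh : 0 ≤ h) (hx : dtAdmissible (2 * l) h x) :
    |dtDiff (2 * l) h (fun y => p.eval y) x| ≤ 2 ^ (2 * l) * (M * (l * h) ^ (2 * l)) := by
  have hM := hp.nonneg
  rcases (phiDT_nonneg x).eq_or_lt with h0 | h0
  · refine abs_dtDiff_le_of_polynomial (P := C (p.eval x)) (by rw [natDegree_C]; omega)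
      fun k _ => ?_
    rw [← h0]
    simp only [mul_zero, add_zero, eval_C, sub_self, abs_zero]
    positivity
  · refine abs_dtDiff_le_of_polynomial (P := taylorTrunc x (2 * l) p)
      (lt_of_le_of_lt (natDegree_taylorTrunc x (2 * l) p) (by omega)) fun k hk => ?_
    have hT := hp.taylor (by omega) hx.1 (hx.2 k hk)
    have hk' : (k : ℝ) ≤ 2 * l := by exact_mod_cast hk
    have hk0 : (0 : ℝ) ≤ k := k.cast_nonneg
    have hc : |((2 * l : ℕ) : ℝ) - 2 * k| ≤ 2 * l := by
      push_cast
      rw [abs_le]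
      constructor <;> linarith
    have hd : |x + (((2 * l : ℕ) : ℝ) - 2 * k) * (h / 2) * phiDT x - x| ≤ l * h * phiDT x := by
      rw [add_sub_cancel_left, abs_mul, abs_mul, abs_of_pos h0, abs_of_nonneg (by linarith : 0 ≤ h / 2)]
      refine mul_le_mul_of_nonneg_right ?_ h0.le
      calc |((2 * l : ℕ) : ℝ) - 2 * k| * (h / 2) ≤ 2 * l * (h / 2) := by gcongr
        _ = l * h := by ring
    have hb := hT.trans (mul_le_mul_of_nonneg_left (pow_le_pow_left₀ (abs_nonneg _) hd (2 * l)) hM)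
    rw [mul_pow _ (phiDT x)] at hb
    refine le_of_mul_le_mul_left (hb.trans_eq ?_) (pow_pos h0 (2 * l))
    ring

/-- Inverse theorem: the rate of `(I - B_m)^l f` controls the symmetric differences of `f`. -/
theorem abs_dtDiff_le_of_rate (l : ℕ) (hl : 1 ≤ l) {f : ℝ → ℝ} {F lam C₁ : ℝ} (hlam : 0 < lam)
    (hlam2 : lam ≤ 2 * l) (hC₁ : 0 ≤ C₁) (hF : ∀ x ∈ Icc (0 : ℝ) 1, |f x| ≤ F)
    (hrate : ∀ m : ℕ, 1 ≤ m → ∀ x ∈ Icc (0 : ℝ) 1,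
      |((TopL m) ^ l) f x| ≤ C₁ * (m : ℝ) ^ (-(lam / 2))) :
    ∃ C : ℝ, 0 ≤ C ∧ ∀ t x : ℝ, 0 < t → t ≤ 1 → dtAdmissible (2 * l) t x →
      |dtDiff (2 * l) t f x| ≤ C * t ^ lam := by
  obtain ⟨C, hC, H⟩ := exists_smooth_approx l hl hlam hlam2 hC₁ hF hrate
  refine ⟨2 ^ (2 * l) * C + 2 ^ (2 * l) * (C * 3 ^ ((l : ℝ) - lam / 2) * (l : ℝ) ^ (2 * l)),
    by positivity, fun t x ht ht1 hx => ?_⟩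
  set a : ℝ := (t ^ 2)⁻¹ with ha
  have ha1 : 1 ≤ a := (one_le_inv₀ (by positivity)).mpr (pow_le_one₀ ht.le ht1)
  set n : ℕ := ⌈a⌉₊ + 1 with hn
  have hn2 : 2 ≤ n := by
    have : 0 < ⌈a⌉₊ := Nat.ceil_pos.mpr (by linarith)
    omega
  have hna : a ≤ (n : ℝ) := by
    rw [hn]; push_cast
    linarith [Nat.le_ceil a]
  have hna3 : (n : ℝ) ≤ 3 * a := by
    rw [hn]; push_cast
    linarith [Nat.ceil_lt_add_one (by linarith : 0 ≤ a)]
  have hapow : ∀ b : ℝ, a ^ b = t ^ (-(2 * b)) := by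
    intro b
    rw [ha, Real.inv_rpow (by positivity), ← Real.rpow_natCast, ← Real.rpow_mul ht.le,
      ← Real.rpow_neg ht.le]
    norm_num
  obtain ⟨p, hp1, hp2⟩ := H n hn2
  have hr1 : (n : ℝ) ^ (-(lam / 2)) ≤ t ^ lam := by
    refine (Real.rpow_le_rpow_of_nonpos (by linarith) hna (by linarith)).trans_eq ?_
    rw [hapow]
    congr 1
    ring
  have hr2 : (n : ℝ) ^ ((l : ℝ) - lam / 2) * t ^ (2 * l) ≤ 3 ^ ((l : ℝ) - lam / 2) * t ^ lam := by
    have h1 : (n : ℝ) ^ ((l : ℝ) - lam / 2) ≤ (3 * a) ^ ((l : ℝ) - lam / 2) :=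
      Real.rpow_le_rpow (by positivity) hna3 (by linarith)
    refine (mul_le_mul_of_nonneg_right h1 (by positivity)).trans_eq ?_
    rw [Real.mul_rpow (by norm_num) (by linarith), hapow, ← Real.rpow_natCast t, mul_assoc,
      ← Real.rpow_add ht]
    congr 2
    push_cast
    ring
  have e1 : |dtDiff (2 * l) t (fun y => f y - p.eval y) x| ≤ 2 ^ (2 * l) * (C * t ^ lam) :=
    _root_.abs_dtDiff_le fun k hk =>
      (hp1 _ (hx.2 k hk)).trans (mul_le_mul_of_nonneg_left hr1 hC)
  have e2 := hp2.abs_dtDiff_le hl ht.le hx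
  rw [dtDiff_sub] at e1
  have e3 : C * (n : ℝ) ^ ((l : ℝ) - lam / 2) * (l * t) ^ (2 * l)
      ≤ C * 3 ^ ((l : ℝ) - lam / 2) * (l : ℝ) ^ (2 * l) * t ^ lam := by
    rw [mul_pow]
    calc _ = C * (l : ℝ) ^ (2 * l) * ((n : ℝ) ^ ((l : ℝ) - lam / 2) * t ^ (2 * l)) := by ring
      _ ≤ C * (l : ℝ) ^ (2 * l) * (3 ^ ((l : ℝ) - lam / 2) * t ^ lam) := by gcongr
      _ = _ := by ring
  calc |dtDiff (2 * l) t f x|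
      ≤ |dtDiff (2 * l) t f x - dtDiff (2 * l) t (fun y => p.eval y) x|
        + |dtDiff (2 * l) t (fun y => p.eval y) x| := by
        simpa using abs_add_le (dtDiff (2 * l) t f x - dtDiff (2 * l) t (fun y => p.eval y) x)
          (dtDiff (2 * l) t (fun y => p.eval y) x)
    _ ≤ 2 ^ (2 * l) * (C * t ^ lam)
        + 2 ^ (2 * l) * (C * 3 ^ ((l : ℝ) - lam / 2) * (l : ℝ) ^ (2 * l) * t ^ lam) :=
        add_le_add e1 (e2.trans (mul_le_mul_of_nonneg_left e3 (by positivity)))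
    _ = _ := by ring

end ModulusBound

/-- saturation equivalence for generalized Bernstein polynomials. -/
theorem genBernstein_rate_iff (l : ℕ) (hl : 1 ≤ l) (f : ℝ → ℝ)
    (hf : ContinuousOn f (Set.Icc 0 1)) (lam : ℝ) (hlam : 0 < lam)
    (hlam2 : lam ≤ 2 * (l : ℝ)) :
    (∃ C₁ : ℝ, ∀ m : ℕ, 1 ≤ m →
        supNorm (fun x => f x - GBop m l f x) ≤ C₁ * (m : ℝ) ^ (-(lam / 2))) ↔
      (∃ C₂ : ℝ, ∀ t ∈ Set.Ioc (0 : ℝ) 1, omegaDT (2 * l) f t ≤ C₂ * t ^ lam) := by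
  obtain ⟨F, hF⟩ := isCompact_Icc.exists_bound_of_continuousOn hf
  simp only [Real.norm_eq_abs] at hF
  constructor
  · rintro ⟨C₁, h⟩
    obtain ⟨K, -, HK⟩ := TopL_pow_bound l
    have hrate : ∀ m : ℕ, 1 ≤ m → ∀ x ∈ Icc (0 : ℝ) 1,
        |((TopL m) ^ l) f x| ≤ max C₁ 0 * (m : ℝ) ^ (-(lam / 2)) := by
      intro m hm x hx
      have hbdd : BddAbove (range fun y : Icc (0 : ℝ) 1 => |f (y : ℝ) - GBop m l f y|) := by
        refine ⟨K * F, ?_⟩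
        rintro _ ⟨y, rfl⟩
        simp only [sub_GBop_eq]
        exact HK m F f hm hF y y.2
      have h1 := le_ciSup hbdd ⟨x, hx⟩
      simp only [sub_GBop_eq m l f x] at h1
      refine (h1.trans (h m hm)).trans ?_
      gcongr
      exact le_max_left _ _
    obtain ⟨C, hC, H⟩ := abs_dtDiff_le_of_rate l hl hlam hlam2 (le_max_right _ _) hF hrate
    refine ⟨C, fun t ht => Real.sSup_le ?_ (mul_nonneg hC (Real.rpow_nonneg ht.1.le _))⟩
    rintro _ ⟨h, x, hh, hht, hx, rfl⟩
    refine (H h x hh (hht.trans ht.2) hx).trans ?_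
    gcongr
  · rintro ⟨C₂, h⟩
    have hmod : ModHyp l lam (max C₂ 0) f := by
      refine modHyp_of_dtDiff hl fun t x ht ht1 hx => ?_
      have hbdd : BddAbove {y | ∃ h x, 0 < h ∧ h ≤ t ∧ dtAdmissible (2 * l) h x ∧
          y = |dtDiff (2 * l) h f x|} := by
        refine ⟨2 ^ (2 * l) * F, ?_⟩
        rintro _ ⟨h, x, -, -, hx, rfl⟩
        exact abs_dtDiff_le fun k hk => hF _ (hx.2 k hk)
      refine ((le_csSup hbdd ⟨t, x, ht, le_rfl, hx, rfl⟩).trans (h t ⟨ht, ht1⟩)).trans ?_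
      gcongr
      exact le_max_left _ _
    obtain ⟨C, H⟩ := direct_estimate l hl hlam hlam2 (le_max_right _ _) hf hmod
    refine ⟨C, fun m hm => ciSup_le fun x => ?_⟩
    simp only [sub_GBop_eq]
    exact H m hm x x.2
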